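/- (Necessity of the integral test for the lower class at 0.) Let ξ : (0, e^e] → (0, ∞) be a nondecreasing continuous function. Suppose ξ belongs to the lower-lower class of M at 0, i.e. almost surely there exists t₀ > 0 such that M(t) ≥ ξ(t) for every t ∈ (0, t₀), and suppose there exists a constant c ≥ 1 such that ξ(2t) ≤ c·ξ(t) for all t ∈ (0, e^e/2]. Then the function t ↦ ξ(t)/t^{H+θ} is bounded on (0, e^e] and the integral I₀(ξ) := ∫₀^{e^e} (ξ(t)/t^{H+θ})^{−1/β} · φ(ξ(t)/t^{H+θ}) · dt/t is finite. -/

import Mathlib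

open MeasureTheory ProbabilityTheory Real Set Filter

/-- A process is a centered Gaussian process if every finite linear combination of its
values has a centered Gaussian distribution. -/
def IsCenteredGaussianProcess {Ω : Type*} [MeasurableSpace Ω] (P : Measure Ω)
    (X : ℝ → Ω → ℝ) : Prop :=
  ∀ (n : ℕ) (t : Fin n → ℝ) (c : Fin n → ℝ), ∃ v : NNReal,
    P.map (fun ω => ∑ i, c i * X (t i) ω) = ProbabilityTheory.gaussianReal 0 v

/-- The covariance function of the generalized fractional Brownian motion:
`E[X s X t] = ∫_ℝ ((s−u)₊^α − (−u)₊^α)((t−u)₊^α − (−u)₊^α)|u|^{−γ} du`. -/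
noncomputable def gfbmCov (α γ s t : ℝ) : ℝ :=
  ∫ u : ℝ, ((max (s - u) 0) ^ α - (max (-u) 0) ^ α) *
    ((max (t - u) 0) ^ α - (max (-u) 0) ^ α) * |u| ^ (-γ)

/-- `X` is a generalized fractional Brownian motion with parameters `(α, γ)` under `P`. -/
def IsGFBM {Ω : Type*} [MeasurableSpace Ω] (P : Measure Ω) (α γ : ℝ)
    (X : ℝ → Ω → ℝ) : Prop :=
  IsCenteredGaussianProcess P X ∧
  (∀ ω, ContinuousOn (fun t => X t ω) (Set.Ici 0)) ∧
  (∀ ω, X 0 ω = 0) ∧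
  (∀ s t : ℝ, 0 ≤ s → 0 ≤ t → ∫ ω, X s ω * X t ω ∂P = gfbmCov α γ s t)

/-- The fractional integral `Y(t) = (1/Γ(θ)) ∫₀^t (t−u)^{θ−1} X(u) du` of a process `X`. -/
noncomputable def fracInt {Ω : Type*} (θ : ℝ) (X : ℝ → Ω → ℝ) (t : ℝ) (ω : Ω) : ℝ :=
  (Real.Gamma θ)⁻¹ * ∫ u in (0:ℝ)..t, (t - u) ^ (θ - 1) * X u ω

/-- The running maximum `M(t) = sup_{0 ≤ s ≤ t} |Y(s)|`. -/
noncomputable def runSup {Ω : Type*} (Y : ℝ → Ω → ℝ) (t : ℝ) (ω : Ω) : ℝ :=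
  ⨆ s : Set.Icc (0:ℝ) t, |Y s.1 ω|

/-- The small ball function `φ(ε) = P(M(1) ≤ ε)`. -/
noncomputable def smallBall {Ω : Type*} [MeasurableSpace Ω] (P : Measure Ω)
    (Y : ℝ → Ω → ℝ) (ε : ℝ) : ℝ :=
  (P {ω | runSup Y 1 ω ≤ ε}).toReal

open scoped ENNReal NNReal Topology Pointwise

/-- Midpoint Prékopa–Leindler property of a measure. -/
def MidpointPrekopaLeindler {E : Type*} [MeasurableSpace E] [AddCommGroup E] [Module ℝ E]
    (μ : Measure E) : Prop :=
  ∀ f g h : E → ℝ≥0∞, Measurable f → Measurable g → Measurable h →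
    (∀ x y, f x * g y ≤ h ((1 / 2 : ℝ) • (x + y)) ^ 2) →
    (∫⁻ x, f x ∂μ) * (∫⁻ x, g x ∂μ) ≤ (∫⁻ x, h x ∂μ) ^ 2

lemma volume_add_le_of_isCompact {A B C : Set ℝ} (hA : IsCompact A) (hB : IsCompact B)
    (hA0 : A.Nonempty) (hB0 : B.Nonempty)
    (hC : ∀ x ∈ A, ∀ y ∈ B, x + y ∈ C) : volume A + volume B ≤ volume C := by
  obtain ⟨a, haA, ha⟩ := hA.exists_isGreatest hA0
  obtain ⟨b, hbB, hb⟩ := hB.exists_isLeast hB0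
  have h1 : volume ((fun x => x + b) '' A) = volume A := by
    simp
  have h2 : volume ((fun x => a + x) '' B) = volume B := by
    simp
  have hdisj : AEDisjoint volume ((fun x => x + b) '' A) ((fun x => a + x) '' B) := by
    refine measure_mono_null (t := {a + b}) ?_ (by simp)
    rintro z ⟨⟨x, hx, rfl⟩, ⟨y, hy, hxy⟩⟩
    have := ha hx
    have := hb hy
    simp only [mem_singleton_iff] at *
    linarith
  rw [← h1, ← h2, ← measure_union₀ _ hdisj]
  · apply measure_mono
    rintro z (⟨x, hx, rfl⟩ | ⟨y, hy, rfl⟩)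
    · exact hC x hx b hbB
    · exact hC a haA y hy
  · exact (hB.image (continuous_const.add continuous_id)).measurableSet.nullMeasurableSet

lemma volume_add_le_of_measurableSet {A B C : Set ℝ} (hA : MeasurableSet A) (hB : MeasurableSet B)
    (hA0 : A.Nonempty) (hB0 : B.Nonempty)
    (hC : ∀ x ∈ A, ∀ y ∈ B, x + y ∈ C) : volume A + volume B ≤ volume C := by
  obtain ⟨a, ha⟩ := hA0
  obtain ⟨b, hb⟩ := hB0
  have key : ∀ K ⊆ A, IsCompact K → ∀ K' ⊆ B, IsCompact K' → volume K + volume K' ≤ volume C := by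
    intro K hK hKc K' hK' hKc'
    refine (add_le_add (measure_mono (subset_insert a K)) (measure_mono (subset_insert b K'))).trans
      (volume_add_le_of_isCompact (hKc.insert a) (hKc'.insert b) (insert_nonempty _ _)
        (insert_nonempty _ _) ?_)
    intro x hx y hy
    exact hC x (insert_subset ha hK hx) y (insert_subset hb hK' hy)
  rw [hA.measure_eq_iSup_isCompact, hB.measure_eq_iSup_isCompact]
  simp_rw [iSup_and']
  refine ENNReal.biSup_add_biSup_le' (p := fun K : Set ℝ => K ⊆ A ∧ IsCompact K)
    (q := fun K : Set ℝ => K ⊆ B ∧ IsCompact K) ⟨∅, by simp⟩ ⟨∅, by simp⟩ ?_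
  rintro K ⟨h1, h2⟩ K' ⟨h3, h4⟩
  exact key K h1 h2 K' h3 h4

/-- Additive form of the one-dimensional inequality, after normalising the suprema to one. -/
lemma lintegral_add_le_of_mul_le {f g h : ℝ → ℝ} (hf : Measurable f) (hg : Measurable g)
    (hh : Measurable h) (hf0 : ∀ x, 0 ≤ f x) (hg0 : ∀ x, 0 ≤ g x) (hh0 : ∀ x, 0 ≤ h x)
    (hf1 : IsLUB (range f) 1) (hg1 : IsLUB (range g) 1)
    (hfg : ∀ x y, f x * g y ≤ h ((1 / 2 : ℝ) • (x + y)) ^ 2) :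
    (∫⁻ x, ENNReal.ofReal (f x)) + (∫⁻ x, ENNReal.ofReal (g x)) ≤
      2 * ∫⁻ x, ENNReal.ofReal (h x) := by
  rw [lintegral_eq_lintegral_meas_lt volume (ae_of_all _ hf0) hf.aemeasurable,
    lintegral_eq_lintegral_meas_lt volume (ae_of_all _ hg0) hg.aemeasurable,
    lintegral_eq_lintegral_meas_lt volume (ae_of_all _ hh0) hh.aemeasurable]
  have hanti : ∀ u : ℝ → ℝ, Measurable fun t => volume {a : ℝ | t < u a} := fun u =>
    Antitone.measurable fun s t hst => measure_mono fun a (ha : t < u a) => hst.trans_lt ha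
  rw [← lintegral_add_left (hanti f), ← lintegral_const_mul _ (hanti h)]
  refine setLIntegral_mono' measurableSet_Ioi fun t (ht : 0 < t) => ?_
  by_cases ht1 : t < 1
  · obtain ⟨_, ⟨x, rfl⟩, hx⟩ := (lt_isLUB_iff hf1).1 ht1
    obtain ⟨_, ⟨y, rfl⟩, hy⟩ := (lt_isLUB_iff hg1).1 ht1
    have h2 := volume_add_le_of_measurableSet (A := {a | t < f a}) (B := {a | t < g a})
      (C := (2 : ℝ) • {a | t < h a}) (measurableSet_lt measurable_const hf)
      (measurableSet_lt measurable_const hg) ⟨x, hx⟩ ⟨y, hy⟩ (by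
        intro x hx y hy
        refine ⟨(1 / 2 : ℝ) • (x + y), ?_, by simp⟩
        have h3 := hfg x y
        simp only [mem_ofPred_eq] at hx hy ⊢
        by_contra! hc
        have := mul_lt_mul'' hx hy ht.le ht.le
        nlinarith [hh0 ((1 / 2 : ℝ) • (x + y))])
    refine h2.trans (le_of_eq ?_)
    rw [Measure.addHaar_smul]
    simp
  · have h1 : ∀ u : ℝ → ℝ, IsLUB (range u) 1 → volume {a : ℝ | t < u a} = 0 := by
      intro u hu
      have : {a : ℝ | t < u a} = ∅ := by
        ext a
        simp only [mem_ofPred_eq, mem_empty_iff_false, iff_false, not_lt]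
        exact (hu.1 ⟨a, rfl⟩).trans (not_lt.1 ht1)
      rw [this, measure_empty]
    rw [h1 f hf1, h1 g hg1]
    simp

lemma lintegral_mul_le_of_bounded {f g h : ℝ → ℝ} (hf : Measurable f) (hg : Measurable g)
    (hh : Measurable h) (hf0 : ∀ x, 0 ≤ f x) (hg0 : ∀ x, 0 ≤ g x) (hh0 : ∀ x, 0 ≤ h x)
    (hfb : BddAbove (range f)) (hgb : BddAbove (range g))
    (hfg : ∀ x y, f x * g y ≤ h ((1 / 2 : ℝ) • (x + y)) ^ 2) :
    (∫⁻ x, ENNReal.ofReal (f x)) * (∫⁻ x, ENNReal.ofReal (g x)) ≤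
      (∫⁻ x, ENNReal.ofReal (h x)) ^ 2 := by
  have hF := isLUB_csSup (range_nonempty f) hfb
  have hG := isLUB_csSup (range_nonempty g) hgb
  set F := sSup (range f)
  set G := sSup (range g)
  have hF0 : 0 ≤ F := (hf0 0).trans (hF.1 ⟨0, rfl⟩)
  have hG0 : 0 ≤ G := (hg0 0).trans (hG.1 ⟨0, rfl⟩)
  rcases hF0.eq_or_lt with hF1 | hF1
  · have : ∀ x, f x = 0 := fun x => le_antisymm (hF1 ▸ hF.1 ⟨x, rfl⟩) (hf0 x)
    simp [this]
  rcases hG0.eq_or_lt with hG1 | hG1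
  · have : ∀ x, g x = 0 := fun x => le_antisymm (hG1 ▸ hG.1 ⟨x, rfl⟩) (hg0 x)
    simp [this]
  have hFG : 0 < √(F * G) := Real.sqrt_pos.2 (mul_pos hF1 hG1)
  have hlub : ∀ (u : ℝ → ℝ) (U : ℝ), 0 < U → IsLUB (range u) U →
      IsLUB (range fun x => u x / U) 1 := by
    intro u U hU hu
    refine ⟨?_, ?_⟩
    · rintro _ ⟨x, rfl⟩
      exact (div_le_one hU).2 (hu.1 ⟨x, rfl⟩)
    · intro b hb
      have : U ≤ b * U := hu.2 (by
        rintro _ ⟨x, rfl⟩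
        exact (div_le_iff₀ hU).1 (hb ⟨x, rfl⟩))
      nlinarith
  have key := lintegral_add_le_of_mul_le (f := fun x => f x / F) (g := fun x => g x / G)
    (h := fun x => h x / √(F * G)) (hf.div_const _) (hg.div_const _) (hh.div_const _)
    (fun x => div_nonneg (hf0 x) hF0) (fun x => div_nonneg (hg0 x) hG0)
    (fun x => div_nonneg (hh0 x) hFG.le) (hlub f F hF1 hF) (hlub g G hG1 hG) (by
      intro x y
      rw [div_mul_div_comm, div_pow, Real.sq_sqrt (mul_pos hF1 hG1).le]
      gcongr
      exact hfg x y)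
  have hdiv : ∀ (u : ℝ → ℝ) (U : ℝ), 0 < U → Measurable u →
      (∫⁻ x, ENNReal.ofReal (u x)) = ENNReal.ofReal U * ∫⁻ x, ENNReal.ofReal (u x / U) := by
    intro u U hU hu
    rw [← lintegral_const_mul _ (hu.div_const _).ennreal_ofReal]
    congr 1
    ext x
    rw [← ENNReal.ofReal_mul hU.le, mul_div_cancel₀ _ hU.ne']
  rw [hdiv f F hF1 hf, hdiv g G hG1 hg, hdiv h _ hFG hh]
  set a := ∫⁻ x, ENNReal.ofReal (f x / F)
  set b := ∫⁻ x, ENNReal.ofReal (g x / G)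
  set d := ∫⁻ x, ENNReal.ofReal (h x / √(F * G))
  have h1 : a * b ≤ d ^ 2 := by
    clear_value a b d
    rcases eq_or_ne d ⊤ with hd | hd
    · simp [hd]
    have hab : a + b ≠ ⊤ := ne_top_of_le_ne_top (ENNReal.mul_ne_top (by simp) hd) key
    have ha : a ≠ ⊤ := fun h => hab (by simp [h])
    have hb : b ≠ ⊤ := fun h => hab (by simp [h])
    lift a to ℝ≥0 using ha
    lift b to ℝ≥0 using hb
    lift d to ℝ≥0 using hd
    norm_cast at key ⊢
    have key' : (a : ℝ) + b ≤ 2 * d := by exact_mod_cast key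
    have : (a : ℝ) * b ≤ d ^ 2 := by
      nlinarith [sq_nonneg ((a : ℝ) - b), a.2, b.2, d.2, NNReal.coe_nonneg a, NNReal.coe_nonneg b]
    exact_mod_cast this
  calc _ = ENNReal.ofReal F * ENNReal.ofReal G * (a * b) := by ring
    _ ≤ ENNReal.ofReal F * ENNReal.ofReal G * d ^ 2 := by gcongr
    _ = _ := by
      rw [mul_pow, ← ENNReal.ofReal_mul hF0, ← ENNReal.ofReal_pow hFG.le,
        Real.sq_sqrt (mul_pos hF1 hG1).le]

lemma midpointPrekopaLeindler_volume : MidpointPrekopaLeindler (volume : Measure ℝ) := by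
  intro f g h hf hg hh hfg
  have key : ∀ n : ℕ, (∫⁻ x, min (f x) n) * (∫⁻ x, min (g x) n) ≤ (∫⁻ x, h x) ^ 2 := by
    intro n
    have hn : ∀ (u : ℝ → ℝ≥0∞) x, ENNReal.ofReal ((min (u x) n).toReal) = min (u x) n := by
      intro u x
      exact ENNReal.ofReal_toReal (ne_top_of_le_ne_top (by simp) (min_le_right _ (n : ℝ≥0∞)))
    have hb : ∀ (u : ℝ → ℝ≥0∞), BddAbove (range fun x => (min (u x) n).toReal) := by
      intro u
      refine ⟨n, ?_⟩
      rintro _ ⟨x, rfl⟩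
      exact ENNReal.toReal_le_of_le_ofReal (by simp) (by simp)
    have := lintegral_mul_le_of_bounded (f := fun x => (min (f x) n).toReal)
      (g := fun x => (min (g x) n).toReal) (h := fun x => (min (h x) n).toReal)
      (hf.min measurable_const).ennreal_toReal (hg.min measurable_const).ennreal_toReal
      (hh.min measurable_const).ennreal_toReal (fun _ => ENNReal.toReal_nonneg)
      (fun _ => ENNReal.toReal_nonneg) (fun _ => ENNReal.toReal_nonneg) (hb f) (hb g) (by
        intro x y
        rw [← ENNReal.toReal_mul, ← ENNReal.toReal_pow]
        refine ENNReal.toReal_mono (by simp) ?_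
        rcases min_choice (h ((1 / 2 : ℝ) • (x + y))) n with hm | hm
        · rw [hm]
          exact (mul_le_mul' (min_le_left _ _) (min_le_left _ _)).trans (hfg x y)
        · rw [hm, sq]
          exact mul_le_mul' (min_le_right _ _) (min_le_right _ _))
    simp only [hn] at this
    refine this.trans ?_
    gcongr
    exact min_le_left _ _
  have hlim : ∀ u : ℝ → ℝ≥0∞, Measurable u →
      Tendsto (fun n : ℕ => ∫⁻ x, min (u x) n) atTop (𝓝 (∫⁻ x, u x)) := by
    intro u hu
    refine lintegral_tendsto_of_tendsto_of_monotone
      (fun n => (hu.min measurable_const).aemeasurable)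
      (ae_of_all _ fun x m n hmn => min_le_min le_rfl (by exact_mod_cast hmn))
      (ae_of_all _ fun x => ?_)
    have := (tendsto_const_nhds (x := u x)).min ENNReal.tendsto_nat_nhds_top
    simpa using this
  by_cases h0 : (∫⁻ x, f x) = 0
  · simp [h0]
  by_cases h1 : (∫⁻ x, g x) = 0
  · simp [h1]
  exact le_of_tendsto' (ENNReal.Tendsto.mul (hlim f hf) (Or.inl h0) (hlim g hg) (Or.inl h1)) key

lemma MidpointPrekopaLeindler.withDensity {E : Type*} [MeasurableSpace E] [AddCommGroup E]
    [Module ℝ E] {μ : Measure E} (hμ : MidpointPrekopaLeindler μ) {ρ : E → ℝ≥0∞}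
    (hρm : Measurable ρ) (hρ : ∀ x y, ρ x * ρ y ≤ ρ ((1 / 2 : ℝ) • (x + y)) ^ 2) :
    MidpointPrekopaLeindler (μ.withDensity ρ) := by
  intro f g h hf hg hh hfg
  rw [lintegral_withDensity_eq_lintegral_mul _ hρm hf, lintegral_withDensity_eq_lintegral_mul _ hρm hg,
    lintegral_withDensity_eq_lintegral_mul _ hρm hh]
  refine hμ _ _ _ (hρm.mul hf) (hρm.mul hg) (hρm.mul hh) fun x y => ?_
  calc (ρ * f) x * (ρ * g) y = (ρ x * ρ y) * (f x * g y) := by simp only [Pi.mul_apply]; ring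
    _ ≤ ρ ((1 / 2 : ℝ) • (x + y)) ^ 2 * h ((1 / 2 : ℝ) • (x + y)) ^ 2 := mul_le_mul' (hρ x y) (hfg x y)
    _ = _ := by simp only [Pi.mul_apply]; ring

lemma midpointPrekopaLeindler_gaussianReal : MidpointPrekopaLeindler (gaussianReal 0 1) := by
  rw [gaussianReal_of_var_ne_zero 0 one_ne_zero]
  refine midpointPrekopaLeindler_volume.withDensity (measurable_gaussianPDF _ _) fun x y => ?_
  simp only [gaussianPDF, gaussianPDFReal]
  rw [← ENNReal.ofReal_mul (by positivity), ← ENNReal.ofReal_pow (by positivity)]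
  refine ENNReal.ofReal_le_ofReal ?_
  rw [mul_mul_mul_comm, ← Real.exp_add, mul_pow, ← pow_two, ← Real.exp_nat_mul]
  gcongr
  simp only [NNReal.coe_one, smul_eq_mul, Nat.cast_ofNat]
  nlinarith [sq_nonneg (x - y)]

lemma MidpointPrekopaLeindler.map {E F : Type*} [MeasurableSpace E] [AddCommGroup E]
    [Module ℝ E] [MeasurableSpace F] [AddCommGroup F] [Module ℝ F] {μ : Measure E}
    (hμ : MidpointPrekopaLeindler μ) (T : E →ₗ[ℝ] F) (hT : Measurable T) :
    MidpointPrekopaLeindler (μ.map T) := by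
  intro f g h hf hg hh hfg
  rw [lintegral_map hf hT, lintegral_map hg hT, lintegral_map hh hT]
  refine hμ _ _ _ (hf.comp hT) (hg.comp hT) (hh.comp hT) fun x y => ?_
  simpa using hfg (T x) (T y)

lemma MidpointPrekopaLeindler.prod {E F : Type*} [MeasurableSpace E] [AddCommGroup E]
    [Module ℝ E] [MeasurableSpace F] [AddCommGroup F] [Module ℝ F] {μ : Measure E}
    {ν : Measure F} [SFinite μ] [SFinite ν] (hμ : MidpointPrekopaLeindler μ)
    (hν : MidpointPrekopaLeindler ν) : MidpointPrekopaLeindler (μ.prod ν) := by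
  intro f g h hf hg hh hfg
  rw [lintegral_prod _ hf.aemeasurable, lintegral_prod _ hg.aemeasurable,
    lintegral_prod _ hh.aemeasurable]
  refine hμ _ _ _ hf.lintegral_prod_right' hg.lintegral_prod_right' hh.lintegral_prod_right'
    fun x x' => ?_
  refine hν _ _ _ (hf.comp measurable_prodMk_left) (hg.comp measurable_prodMk_left)
    (hh.comp measurable_prodMk_left) fun y y' => ?_
  simpa using hfg (x, y) (x', y')

lemma midpointPrekopaLeindler_pi_gaussianReal (n : ℕ) :
    MidpointPrekopaLeindler (Measure.pi fun _ : Fin n => gaussianReal 0 1) := by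
  induction n with
  | zero =>
    intro f g h hf hg hh hfg
    have := hfg 0 0
    simp only [Measure.pi_of_empty _ (0 : Fin 0 → ℝ), lintegral_dirac]
    simpa using this
  | succ n ih =>
    have h1 := midpointPrekopaLeindler_gaussianReal.prod ih
    have h2 := (measurePreserving_piFinSuccAbove
      (fun _ : Fin (n + 1) => gaussianReal 0 1) 0).symm
    let T : ℝ × (Fin n → ℝ) →ₗ[ℝ] (Fin (n + 1) → ℝ) :=
      { toFun := fun p => Fin.cons p.1 p.2
        map_add' := by
          intro p q; ext i; refine Fin.cases ?_ (fun j => ?_) i <;> simp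
        map_smul' := by
          intro c p; ext i; refine Fin.cases ?_ (fun j => ?_) i <;> simp }
    have hT : (T : ℝ × (Fin n → ℝ) → (Fin (n + 1) → ℝ)) =
        (MeasurableEquiv.piFinSuccAbove (fun _ : Fin (n + 1) => ℝ) 0).symm := by
      ext p i
      refine Fin.cases ?_ (fun j => ?_) i <;> simp [T, MeasurableEquiv.piFinSuccAbove]
    have h3 := h1.map T (hT ▸ MeasurableEquiv.measurable _)
    rw [hT] at h3
    rwa [h2.map_eq] at h3

/-- A linear space of measurable centered Gaussian random variables. -/
structure IsGaussSpace {Ω : Type*} [MeasurableSpace Ω] (P : Measure Ω)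
    (S : Submodule ℝ (Ω → ℝ)) : Prop where
  measurable : ∀ f ∈ S, Measurable f
  gauss : ∀ f ∈ S, ∃ v : ℝ≥0, P.map f = gaussianReal 0 v

namespace IsGaussSpace

variable {Ω : Type*} [MeasurableSpace Ω] {P : Measure Ω} {S : Submodule ℝ (Ω → ℝ)}

lemma hasGaussianLaw (hS : IsGaussSpace P S) {ι : Type*} [Finite ι] {f : ι → Ω → ℝ}
    (hf : ∀ i, f i ∈ S) : HasGaussianLaw (fun ω i => f i ω) P := by
  have := Fintype.ofFinite ι
  classical
  have hm : Measurable fun ω i => f i ω := measurable_pi_lambda _ fun i => hS.measurable _ (hf i)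
  refine ⟨isGaussian_of_map_eq_gaussianReal fun L => ?_⟩
  rw [Measure.map_map (by fun_prop) hm]
  have h1 : (L ∘ fun ω i => f i ω) = ∑ i, L (Pi.single i 1) • f i := by
    ext ω
    have : (fun i => f i ω) = ∑ i, f i ω • (Pi.single i (1 : ℝ) : ι → ℝ) := by
      ext j
      simp [Finset.sum_apply, Pi.single_apply]
    simp only [Function.comp_apply, Finset.sum_apply, Pi.smul_apply, smul_eq_mul]
    rw [this, map_sum]
    simp [mul_comm]
  rw [h1]
  obtain ⟨v, hv⟩ := hS.gauss _ (S.sum_mem fun i _ => S.smul_mem (L (Pi.single i 1)) (hf i))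
  exact ⟨0, v, hv⟩

lemma hasGaussianLaw_single (hS : IsGaussSpace P S) {f : Ω → ℝ} (hf : f ∈ S) :
    HasGaussianLaw f P := by
  obtain ⟨v, hv⟩ := hS.gauss f hf
  exact ⟨by rw [hv]; infer_instance⟩

lemma isProbabilityMeasure (hS : IsGaussSpace P S) : IsProbabilityMeasure P :=
  (hS.hasGaussianLaw_single S.zero_mem).isProbabilityMeasure

lemma memLp (hS : IsGaussSpace P S) {f : Ω → ℝ} (hf : f ∈ S) {p : ℝ≥0∞} (hp : p ≠ ⊤) :
    MemLp f p P := (hS.hasGaussianLaw_single hf).memLp hp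

lemma integrable (hS : IsGaussSpace P S) {f : Ω → ℝ} (hf : f ∈ S) : Integrable f P :=
  (hS.hasGaussianLaw_single hf).integrable

lemma integrable_mul (hS : IsGaussSpace P S) {f g : Ω → ℝ} (hf : f ∈ S) (hg : g ∈ S) :
    Integrable (fun ω => f ω * g ω) P :=
  (hS.memLp hf (p := 2) (by simp)).integrable_mul (hS.memLp hg (p := 2) (by simp))

lemma integral_eq_zero (hS : IsGaussSpace P S) {f : Ω → ℝ} (hf : f ∈ S) : ∫ ω, f ω ∂P = 0 := by
  obtain ⟨v, hv⟩ := hS.gauss f hf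
  have : ∫ x, id x ∂(P.map f) = ∫ ω, f ω ∂P :=
    integral_map (hS.measurable f hf).aemeasurable (by fun_prop)
  rw [← this, hv]
  simp

lemma map_eq (hS : IsGaussSpace P S) {f : Ω → ℝ} (hf : f ∈ S) :
    P.map f = gaussianReal 0 (∫ ω, f ω ^ 2 ∂P).toNNReal := by
  rw [(hS.hasGaussianLaw_single hf).map_eq_gaussianReal, hS.integral_eq_zero hf,
    variance_of_integral_eq_zero (hS.measurable f hf).aemeasurable (hS.integral_eq_zero hf)]

lemma covariance_eq (hS : IsGaussSpace P S) {f g : Ω → ℝ} (hf : f ∈ S) (hg : g ∈ S) :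
    cov[f, g; P] = ∫ ω, f ω * g ω ∂P := by
  simp [covariance, hS.integral_eq_zero hf, hS.integral_eq_zero hg]

lemma integral_dual_and_variance_dual (hS : IsGaussSpace P S) {ι : Type*} [Fintype ι]
    [DecidableEq ι] {f : ι → Ω → ℝ} (hf : ∀ i, f i ∈ S) (L : StrongDual ℝ (ι → ℝ)) :
    (∫ ω, L (fun i => f i ω) ∂P) = 0 ∧ Var[fun ω => L (fun i => f i ω); P] =
      ∑ i, ∑ j, L (Pi.single i 1) * L (Pi.single j 1) * ∫ ω, f i ω * f j ω ∂P := by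
  have e1 : ∀ ω, L (fun i => f i ω) = ∑ i, L (Pi.single i 1) * f i ω := by
    intro ω
    have : (fun i => f i ω) = ∑ i, f i ω • (Pi.single i (1 : ℝ) : ι → ℝ) := by
      ext j
      simp [Finset.sum_apply, Pi.single_apply]
    rw [this, map_sum]
    simp [mul_comm]
  have e0 : (fun ω => L (fun i => f i ω)) ∈ S := by
    have : (fun ω => L (fun i => f i ω)) = ∑ i, L (Pi.single i 1) • f i := by
      ext ω; rw [e1]; simp
    rw [this]
    exact S.sum_mem fun i _ => S.smul_mem _ (hf i)
  refine ⟨hS.integral_eq_zero e0, ?_⟩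
  rw [variance_of_integral_eq_zero (hS.measurable _ e0).aemeasurable (hS.integral_eq_zero e0)]
  simp_rw [e1, sq, Finset.sum_mul_sum]
  rw [integral_finsetSum]
  · refine Finset.sum_congr rfl fun i _ => ?_
    rw [integral_finsetSum]
    · refine Finset.sum_congr rfl fun j _ => ?_
      rw [← integral_const_mul]
      congr 1; ext ω; ring
    · intro j _
      have := (hS.integrable_mul (hf i) (hf j)).const_mul (L (Pi.single i 1) * L (Pi.single j 1))
      refine this.congr (ae_of_all _ fun ω => ?_)
      ring
  · intro i _
    refine integrable_finsetSum _ fun j _ => ?_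
    have := (hS.integrable_mul (hf i) (hf j)).const_mul (L (Pi.single i 1) * L (Pi.single j 1))
    refine this.congr (ae_of_all _ fun ω => ?_)
    ring

/-- Centered Gaussian vectors with the same second moments have the same law. -/
lemma map_eq_map {Ω' : Type*} [MeasurableSpace Ω'] {Q : Measure Ω'} {S' : Submodule ℝ (Ω' → ℝ)}
    (hS : IsGaussSpace P S) (hS' : IsGaussSpace Q S') {ι : Type*} [Finite ι]
    {f : ι → Ω → ℝ} {g : ι → Ω' → ℝ} (hf : ∀ i, f i ∈ S) (hg : ∀ i, g i ∈ S')
    (h : ∀ i j, ∫ ω, f i ω * f j ω ∂P = ∫ ω, g i ω * g j ω ∂Q) :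
    P.map (fun ω i => f i ω) = Q.map (fun ω i => g i ω) := by
  have := Fintype.ofFinite ι
  have := hS.isProbabilityMeasure
  have := hS'.isProbabilityMeasure
  have h1 := hS.hasGaussianLaw hf
  have h2 := hS'.hasGaussianLaw hg
  classical
  have := h1.isGaussian_map
  have := h2.isGaussian_map
  refine Measure.ext_of_charFunDual (funext fun L => ?_)
  rw [h1.charFunDual_map_eq_fun, h2.charFunDual_map_eq_fun,
    (hS.integral_dual_and_variance_dual hf L).1, (hS.integral_dual_and_variance_dual hf L).2,
    (hS'.integral_dual_and_variance_dual hg L).1, (hS'.integral_dual_and_variance_dual hg L).2]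
  simp_rw [h]

lemma of_hasGaussianLaw {ι : Type*} [Finite ι] {f : ι → Ω → ℝ}
    (hm : ∀ i, Measurable (f i)) (hf : HasGaussianLaw (fun ω i => f i ω) P)
    (h0 : ∀ i, ∫ ω, f i ω ∂P = 0) : IsGaussSpace P (Submodule.span ℝ (range f)) := by
  have := Fintype.ofFinite ι
  have key : ∀ g ∈ Submodule.span ℝ (range f), ∃ c : ι → ℝ, g = ∑ i, c i • f i := by
    intro g hg
    obtain ⟨c, hc⟩ := (Submodule.mem_span_range_iff_exists_fun ℝ).1 hg
    exact ⟨c, hc.symm⟩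
  refine ⟨fun g hg => ?_, fun g hg => ?_⟩
  · obtain ⟨c, rfl⟩ := key g hg
    have : (∑ i, c i • f i) = fun ω => ∑ i, c i * f i ω := by ext ω; simp
    rw [this]
    exact Finset.measurable_sum _ fun i _ => (hm i).const_mul (c i)
  · obtain ⟨c, rfl⟩ := key g hg
    let L : (ι → ℝ) →L[ℝ] ℝ := ∑ i, c i • ContinuousLinearMap.proj i
    have hL : (∑ i, c i • f i) = fun ω => L (fun i => f i ω) := by
      ext ω; simp [L]
    have h1 := hf.map_fun L
    rw [hL]
    have this : (fun ω => L (fun i => f i ω)) = fun ω => ∑ i, c i * f i ω := by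
      ext ω; simp [L]
    have h2 : ∫ ω, L (fun i => f i ω) ∂P = 0 := by
      rw [this, integral_finsetSum]
      · simp [integral_const_mul, h0]
      · intro i _
        exact (hf.eval i).integrable.const_mul _
    exact ⟨_, h2 ▸ h1.map_eq_gaussianReal⟩

end IsGaussSpace

lemma midpointPrekopaLeindler_stdGaussian (n : ℕ) :
    MidpointPrekopaLeindler (stdGaussian (EuclideanSpace ℝ (Fin n))) := by
  rw [← map_pi_eq_stdGaussian]
  exact (midpointPrekopaLeindler_pi_gaussianReal n).map
    (WithLp.linearEquiv 2 ℝ (Fin n → ℝ)).symm.toLinearMap (by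
      change Measurable (WithLp.toLp 2 : (Fin n → ℝ) → _)
      fun_prop)

open scoped MatrixOrder in
/-- The law of a centered Gaussian vector has the Prékopa–Leindler property. -/
lemma IsGaussSpace.midpointPrekopaLeindler {Ω : Type*} [MeasurableSpace Ω] {P : Measure Ω}
    {S : Submodule ℝ (Ω → ℝ)} (hS : IsGaussSpace P S) {n : ℕ} {f : Fin n → Ω → ℝ}
    (hf : ∀ i, f i ∈ S) : MidpointPrekopaLeindler (P.map fun ω i => f i ω) := by
  have := hS.isProbabilityMeasure
  let C : Matrix (Fin n) (Fin n) ℝ := Matrix.of fun i j => ∫ ω, f i ω * f j ω ∂P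
  have hC : C.PosSemidef := by
    refine Matrix.PosSemidef.of_dotProduct_mulVec_nonneg ?_ fun x => ?_
    · ext i j
      simp [C, mul_comm]
    · have h1 : star x ⬝ᵥ C.mulVec x = ∫ ω, (∑ i, x i * f i ω) ^ 2 ∂P := by
        simp_rw [sq, Finset.sum_mul_sum]
        rw [integral_finsetSum]
        · simp only [dotProduct, Matrix.mulVec, Pi.star_apply, star_trivial]
          refine Finset.sum_congr rfl fun i _ => ?_
          rw [integral_finsetSum, Finset.mul_sum]
          · refine Finset.sum_congr rfl fun j _ => ?_
            simp only [C, Matrix.of_apply]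
            rw [mul_comm _ (x j), ← mul_assoc, ← integral_const_mul]
            congr 1; ext ω; ring
          · intro j _
            refine ((hS.integrable_mul (hf i) (hf j)).const_mul (x i * x j)).congr
              (ae_of_all _ fun ω => ?_)
            ring
        · intro i _
          refine integrable_finsetSum _ fun j _ => ?_
          refine ((hS.integrable_mul (hf i) (hf j)).const_mul (x i * x j)).congr
              (ae_of_all _ fun ω => ?_)
          ring
      rw [h1]
      exact integral_nonneg fun ω => sq_nonneg _
  set Q := multivariateGaussian 0 C with hQ
  have hQ1 : MidpointPrekopaLeindler Q := by
    rw [hQ, multivariateGaussian]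
    simp only [zero_add]
    exact (midpointPrekopaLeindler_stdGaussian n).map (LinearMap.mk
      ⟨fun x => Matrix.toEuclideanCLM (𝕜 := ℝ) (CFC.sqrt C) x, by simp⟩ (by simp)) (by
        change Measurable fun x => Matrix.toEuclideanCLM (𝕜 := ℝ) (CFC.sqrt C) x
        fun_prop)
  let g : Fin n → EuclideanSpace ℝ (Fin n) → ℝ := fun i x => x i
  have hg1 : HasGaussianLaw (fun x i => g i x) Q :=
    IsGaussian.hasGaussianLaw_id.map (PiLp.continuousLinearEquiv 2 ℝ fun _ : Fin n => ℝ).toContinuousLinearMap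
  have hg2 : ∀ i, ∫ x, g i x ∂Q = 0 := by
    intro i
    have := ((EuclideanSpace.proj (𝕜 := ℝ) i).integral_comp_comm
      (IsGaussian.hasGaussianLaw_id (μ := Q)).integrable)
    simpa [g, hQ] using this
  have hg3 := IsGaussSpace.of_hasGaussianLaw (P := Q) (f := g) (fun i => by fun_prop) hg1 hg2
  have hgm : ∀ i, g i ∈ Submodule.span ℝ (range g) := fun i => Submodule.subset_span ⟨i, rfl⟩
  rw [hS.map_eq_map hg3 hf hgm]
  · exact hQ1.map (WithLp.linearEquiv 2 ℝ (Fin n → ℝ)).toLinearMap (by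
      change Measurable fun (x : EuclideanSpace ℝ (Fin n)) i => x i
      fun_prop)
  · intro i j
    rw [← hg3.covariance_eq (hgm i) (hgm j)]
    exact (covariance_eval_multivariateGaussian hC i j).symm

namespace IsGaussSpace

variable {Ω : Type*} [MeasurableSpace Ω] {P : Measure Ω} {S : Submodule ℝ (Ω → ℝ)}

lemma measurable_pi (hS : IsGaussSpace P S) {ι : Type*} {f : ι → Ω → ℝ}
    (hf : ∀ i, f i ∈ S) : Measurable fun ω i => f i ω :=
  measurable_pi_lambda _ fun i => hS.measurable _ (hf i)

lemma measurableSet_box {ι : Type*} [Countable ι] (z : ι → ℝ) (x : ℝ) :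
    MeasurableSet {w : ι → ℝ | ∀ i, |w i + z i| ≤ x} := by
  rw [show {w : ι → ℝ | ∀ i, |w i + z i| ≤ x} = ⋂ i, {w | |w i + z i| ≤ x} by ext; simp]
  exact MeasurableSet.iInter fun i => measurableSet_le (by fun_prop) measurable_const

/-- Translating a centered Gaussian vector decreases the probability of a centered box. -/
lemma measure_box_add_le (hS : IsGaussSpace P S) {n : ℕ} {f : Fin n → Ω → ℝ}
    (hf : ∀ i, f i ∈ S) (z : Fin n → ℝ) (x : ℝ) :
    P {ω | ∀ i, |f i ω + z i| ≤ x} ≤ P {ω | ∀ i, |f i ω| ≤ x} := by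
  have := hS.isProbabilityMeasure
  have hm := hS.measurable_pi hf
  set μ := P.map fun ω i => f i ω with hμ
  have e : ∀ z : Fin n → ℝ, μ {w | ∀ i, |w i + z i| ≤ x} = P {ω | ∀ i, |f i ω + z i| ≤ x} :=
    fun z => Measure.map_apply hm (measurableSet_box z x)
  have hneg : μ = P.map fun ω i => (-f i) ω := by
    refine hS.map_eq_map hS hf (fun i => S.neg_mem (hf i)) fun i j => ?_
    simp
  have e' : P {ω | ∀ i, |f i ω + (-z) i| ≤ x} = P {ω | ∀ i, |f i ω + z i| ≤ x} := by
    rw [← e z, hneg, Measure.map_apply (hS.measurable_pi fun i => S.neg_mem (hf i))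
      (measurableSet_box z x)]
    congr 1
    ext ω
    refine forall_congr' fun i => ?_
    simp only [Pi.neg_apply]
    rw [← abs_neg, neg_add, neg_neg]
  have key := hS.midpointPrekopaLeindler hf
    (indicator {w | ∀ i, |w i + z i| ≤ x} 1) (indicator {w | ∀ i, |w i + (-z) i| ≤ x} 1)
    (indicator {w | ∀ i, |w i + (0 : Fin n → ℝ) i| ≤ x} 1)
    (measurable_one.indicator (measurableSet_box _ _))
    (measurable_one.indicator (measurableSet_box _ _))
    (measurable_one.indicator (measurableSet_box _ _)) (by
      intro u v
      by_cases hu : u ∈ {w | ∀ i, |w i + z i| ≤ x}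
      · by_cases hv : v ∈ {w | ∀ i, |w i + (-z) i| ≤ x}
        · have : (1 / 2 : ℝ) • (u + v) ∈ {w : Fin n → ℝ | ∀ i, |w i + (0 : Fin n → ℝ) i| ≤ x} := by
            intro i
            have h1 := abs_le.1 (hu i)
            have h2 := abs_le.1 (hv i)
            simp only [Pi.neg_apply, Pi.smul_apply, Pi.add_apply, Pi.zero_apply, smul_eq_mul,
              add_zero] at h1 h2 ⊢
            rw [abs_le]
            constructor <;> linarith
          rw [indicator_of_mem hu, indicator_of_mem hv, indicator_of_mem this]
          simp
        · rw [indicator_of_notMem hv]; simp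
      · rw [indicator_of_notMem hu]; simp)
  rw [lintegral_indicator_one (measurableSet_box _ _),
    lintegral_indicator_one (measurableSet_box _ _),
    lintegral_indicator_one (measurableSet_box _ _), ← hμ, e, e, e, e', ← sq] at key
  simp only [Pi.zero_apply, add_zero] at key
  exact (ENNReal.pow_le_pow_left_iff (by norm_num)).1 key

/-- Midpoint log-concavity of the probability of centered boxes. -/
lemma measure_box_mul_le (hS : IsGaussSpace P S) {n : ℕ} {f : Fin n → Ω → ℝ}
    (hf : ∀ i, f i ∈ S) (a b : ℝ) :
    P {ω | ∀ i, |f i ω| ≤ a} * P {ω | ∀ i, |f i ω| ≤ b} ≤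
      P {ω | ∀ i, |f i ω| ≤ (a + b) / 2} ^ 2 := by
  have hm := hS.measurable_pi hf
  set μ := P.map fun ω i => f i ω with hμ
  have hmb : ∀ x, MeasurableSet {w : Fin n → ℝ | ∀ i, |w i| ≤ x} := fun x => by
    simpa using measurableSet_box (0 : Fin n → ℝ) x
  have e : ∀ x, μ {w | ∀ i, |w i| ≤ x} = P {ω | ∀ i, |f i ω| ≤ x} :=
    fun x => Measure.map_apply hm (hmb x)
  have key := hS.midpointPrekopaLeindler hf
    (indicator {w | ∀ i, |w i| ≤ a} 1) (indicator {w | ∀ i, |w i| ≤ b} 1)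
    (indicator {w | ∀ i, |w i| ≤ (a + b) / 2} 1)
    (measurable_one.indicator (hmb _)) (measurable_one.indicator (hmb _))
    (measurable_one.indicator (hmb _)) (by
      intro u v
      by_cases hu : u ∈ {w : Fin n → ℝ | ∀ i, |w i| ≤ a}
      · by_cases hv : v ∈ {w : Fin n → ℝ | ∀ i, |w i| ≤ b}
        · have : (1 / 2 : ℝ) • (u + v) ∈ {w : Fin n → ℝ | ∀ i, |w i| ≤ (a + b) / 2} := by
            intro i
            have h1 := abs_le.1 (hu i)
            have h2 := abs_le.1 (hv i)
            simp only [Pi.smul_apply, Pi.add_apply, smul_eq_mul]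
            rw [abs_le]
            constructor <;> linarith
          rw [indicator_of_mem hu, indicator_of_mem hv, indicator_of_mem this]
          simp
        · rw [indicator_of_notMem hv]; simp
      · rw [indicator_of_notMem hu]; simp)
  rwa [lintegral_indicator_one (hmb _), lintegral_indicator_one (hmb _),
    lintegral_indicator_one (hmb _), ← hμ, e, e, e] at key

lemma indepFun (hS : IsGaussSpace P S) {ι κ : Type*} [Finite ι] [Finite κ] {f : ι → Ω → ℝ}
    {g : κ → Ω → ℝ} (hf : ∀ i, f i ∈ S) (hg : ∀ i, g i ∈ S)
    (h : ∀ i j, ∫ ω, f i ω * g j ω ∂P = 0) :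
    IndepFun (fun ω i => f i ω) (fun ω j => g j ω) P := by
  have := Fintype.ofFinite ι
  have := Fintype.ofFinite κ
  refine HasGaussianLaw.indepFun_of_covariance_eval ?_ fun i j => ?_
  · have h1 := hS.hasGaussianLaw (f := Sum.elim f g) (by rintro (i | i) <;> simp [hf, hg])
    let L : (ι ⊕ κ → ℝ) →L[ℝ] (ι → ℝ) × (κ → ℝ) :=
      (ContinuousLinearMap.pi fun i => ContinuousLinearMap.proj (Sum.inl i)).prod
        (ContinuousLinearMap.pi fun i => ContinuousLinearMap.proj (Sum.inr i))
    exact h1.map_fun L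
  · rw [hS.covariance_eq (hf i) (hg j), h]

/-- Conditionally on `g`, the vector `f` lies in a centered box with probability at most that of
its residual. -/
lemma measure_inter_box_le (hS : IsGaussSpace P S) {ι : Type*} [Fintype ι] {n : ℕ}
    {f : Fin n → Ω → ℝ} {g : ι → Ω → ℝ} (hf : ∀ i, f i ∈ S) (hg : ∀ i, g i ∈ S)
    (c : Fin n → ι → ℝ)
    (h : ∀ i j, ∫ ω, (f i ω - ∑ k, c i k * g k ω) * g j ω ∂P = 0)
    {E : Set (ι → ℝ)} (hE : MeasurableSet E) (x : ℝ) :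
    P {ω | (fun j => g j ω) ∈ E ∧ ∀ i, |f i ω| ≤ x} ≤
      P {ω | (fun j => g j ω) ∈ E} * P {ω | ∀ i, |f i ω - ∑ k, c i k * g k ω| ≤ x} := by
  have := hS.isProbabilityMeasure
  let W : Fin n → Ω → ℝ := fun i => f i - ∑ k, c i k • g k
  have hW : ∀ i, W i ∈ S := fun i =>
    S.sub_mem (hf i) (S.sum_mem fun k _ => S.smul_mem _ (hg k))
  have hWe : ∀ i ω, W i ω = f i ω - ∑ k, c i k * g k ω := by
    intro i ω; simp [W]
  have hind := hS.indepFun hg hW (by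
    intro j i
    rw [← h i j]
    simp_rw [hWe, mul_comm])
  have hgm := hS.measurable_pi hg
  have hWm := hS.measurable_pi hW
  have hpr := (indepFun_iff_map_prod_eq_prod_map_map hgm.aemeasurable hWm.aemeasurable).1 hind
  set B : Set ((ι → ℝ) × (Fin n → ℝ)) :=
    {p | p.1 ∈ E ∧ ∀ i, |p.2 i + ∑ k, c i k * p.1 k| ≤ x} with hB
  have hBm : MeasurableSet B := by
    refine MeasurableSet.inter (s₁ := {p : (ι → ℝ) × (Fin n → ℝ) | p.1 ∈ E})
      (s₂ := {p : (ι → ℝ) × (Fin n → ℝ) | ∀ i, |p.2 i + ∑ k, c i k * p.1 k| ≤ x})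
      (measurable_fst hE) ?_
    rw [show {p : (ι → ℝ) × (Fin n → ℝ) | ∀ i, |p.2 i + ∑ k, c i k * p.1 k| ≤ x} =
      ⋂ i, {p | |p.2 i + ∑ k, c i k * p.1 k| ≤ x} by ext; simp]
    refine MeasurableSet.iInter fun i => measurableSet_le ?_ measurable_const
    fun_prop
  have e1 : P {ω | (fun j => g j ω) ∈ E ∧ ∀ i, |f i ω| ≤ x} =
      (P.map fun ω => (fun j => g j ω, fun i => W i ω)) B := by
    rw [Measure.map_apply (hgm.prodMk hWm) hBm]
    congr 1
    ext ω
    simp [hB, hWe]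
  rw [e1, hpr, Measure.prod_apply hBm]
  have e2 : P {ω | (fun j => g j ω) ∈ E} = ∫⁻ u, indicator E 1 u ∂(P.map fun ω j => g j ω) := by
    rw [lintegral_indicator_one hE, Measure.map_apply hgm hE]
    rfl
  rw [e2, ← lintegral_mul_const _ (measurable_one.indicator hE)]
  refine lintegral_mono fun u => ?_
  by_cases hu : u ∈ E
  · rw [indicator_of_mem hu, Measure.map_apply hWm (measurable_prodMk_left hBm)]
    simp only [Pi.one_apply, one_mul]
    have := hS.measure_box_add_le hW (fun i => ∑ k, c i k * u k) x
    simp only [hWe] at this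
    refine le_trans (le_of_eq ?_) this
    congr 1
    ext ω
    simp [hB, hu, hWe]
  · rw [indicator_of_notMem hu]
    have : Prod.mk u ⁻¹' B = ∅ := by
      ext v; simp [hB, hu]
    simp [this]

/-- The embedding of a Gaussian space into `L²`. -/
noncomputable def toL2 (hS : IsGaussSpace P S) : S →ₗ[ℝ] Lp ℝ 2 P where
  toFun f := (hS.memLp f.2 (p := 2) (by simp)).toLp f.1
  map_add' f g := MemLp.toLp_add (hS.memLp f.2 (p := 2) (by simp)) (hS.memLp g.2 (p := 2) (by simp))
  map_smul' c f := MemLp.toLp_const_smul c (hS.memLp f.2 (p := 2) (by simp))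

lemma inner_toL2 (hS : IsGaussSpace P S) (f g : S) :
    inner ℝ (hS.toL2 f) (hS.toL2 g) = ∫ ω, f.1 ω * g.1 ω ∂P := by
  rw [L2.inner_def]
  refine integral_congr_ae ?_
  filter_upwards [MemLp.coeFn_toLp (hS.memLp f.2 (p := 2) (by simp)),
    MemLp.coeFn_toLp (hS.memLp g.2 (p := 2) (by simp))] with ω h1 h2
  simp [toL2, h1, h2, mul_comm]

/-- Orthogonal projection onto the span of finitely many elements. -/
lemma exists_projection (hS : IsGaussSpace P S) {ι : Type*} [Fintype ι] {f : Ω → ℝ}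
    {g : ι → Ω → ℝ} (hf : f ∈ S) (hg : ∀ i, g i ∈ S) :
    ∃ c : ι → ℝ, ∀ j, ∫ ω, (f ω - ∑ k, c k * g k ω) * g j ω ∂P = 0 := by
  let F : S := ⟨f, hf⟩
  let G : ι → S := fun i => ⟨g i, hg i⟩
  let K := Submodule.span ℝ (range fun i => hS.toL2 (G i))
  have : FiniteDimensional ℝ K := FiniteDimensional.span_of_finite ℝ (finite_range _)
  obtain ⟨c, hc⟩ := (Submodule.mem_span_range_iff_exists_fun ℝ).1
    (K.starProjection_apply_mem (hS.toL2 F))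
  refine ⟨c, fun j => ?_⟩
  have h1 : inner ℝ (hS.toL2 F - ∑ k, c k • hS.toL2 (G k)) (hS.toL2 (G j)) = 0 := by
    rw [hc]
    exact K.starProjection_inner_eq_zero _ _ (Submodule.subset_span ⟨j, rfl⟩)
  simp_rw [← map_smul] at h1
  rw [← map_sum, ← map_sub, inner_toL2] at h1
  rw [← h1]
  simp [F, G]

end IsGaussSpace

/-- A dense sequence in the unit interval. -/
noncomputable def unitSeq (n : ℕ) : ℝ := (TopologicalSpace.denseSeq (Icc (0:ℝ) 1) n).1

lemma unitSeq_mem (n : ℕ) : unitSeq n ∈ Icc (0:ℝ) 1 := Subtype.coe_prop _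

lemma runSup_bddAbove {Ω : Type*} {Y : ℝ → Ω → ℝ} {ω : Ω} (hY : Continuous fun t => Y t ω) (t : ℝ) :
    BddAbove (range fun s : Icc (0:ℝ) t => |Y s.1 ω|) := by
  have := (isCompact_Icc (a := (0:ℝ)) (b := t)).bddAbove_image (f := fun s => |Y s ω|)
    (by fun_prop)
  rwa [image_eq_range] at this

lemma runSup_le_iff {Ω : Type*} {Y : ℝ → Ω → ℝ} {ω : Ω} (hY : Continuous fun t => Y t ω) {t : ℝ}
    (ht : 0 ≤ t) (a : ℝ) : runSup Y t ω ≤ a ↔ ∀ s ∈ Icc 0 t, |Y s ω| ≤ a := by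
  have : Nonempty (Icc (0:ℝ) t) := ⟨⟨0, by simp [ht]⟩⟩
  constructor
  · intro h s hs
    exact (le_ciSup (runSup_bddAbove hY t) ⟨s, hs⟩).trans h
  · intro h
    exact ciSup_le fun s => h s.1 s.2

lemma runSup_le_iff_unitSeq {Ω : Type*} {Y : ℝ → Ω → ℝ} {ω : Ω} (hY : Continuous fun t => Y t ω)
    {t : ℝ} (ht : 0 ≤ t) (a : ℝ) : runSup Y t ω ≤ a ↔ ∀ n, |Y (t * unitSeq n) ω| ≤ a := by
  rw [runSup_le_iff hY ht]
  constructor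
  · intro h n
    have := unitSeq_mem n
    exact h _ ⟨mul_nonneg ht this.1, mul_le_of_le_one_right ht this.2⟩
  · intro h s hs
    have h1 : ∀ u : Icc (0:ℝ) 1, |Y (t * u.1) ω| ≤ a := by
      have hcl : IsClosed {u : Icc (0:ℝ) 1 | |Y (t * u.1) ω| ≤ a} :=
        isClosed_le (by fun_prop) continuous_const
      have hd : Dense {u : Icc (0:ℝ) 1 | |Y (t * u.1) ω| ≤ a} :=
        (TopologicalSpace.denseRange_denseSeq (Icc (0:ℝ) 1)).mono (by
          rintro _ ⟨n, rfl⟩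
          exact h n)
      intro u
      have := hcl.closure_eq ▸ hd u
      exact this
    rcases ht.eq_or_lt with h0 | h0
    · have := h1 ⟨0, by simp⟩
      have hs0 : s = 0 := le_antisymm (h0 ▸ hs.2) hs.1
      simpa [hs0] using this
    · have := h1 ⟨s / t, div_nonneg hs.1 ht, (div_le_one h0).2 hs.2⟩
      simpa [mul_div_cancel₀ _ h0.ne'] using this

lemma runSup_nonneg {Ω : Type*} (Y : ℝ → Ω → ℝ) (t : ℝ) (ω : Ω) : 0 ≤ runSup Y t ω :=
  Real.iSup_nonneg fun _ => abs_nonneg _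

/-- A continuous self-similar centered Gaussian process. -/
structure IsSelfSimilarGaussian {Ω : Type*} [MeasurableSpace Ω] (P : Measure Ω)
    (S : Submodule ℝ (Ω → ℝ)) (Y : ℝ → Ω → ℝ) (κ : ℝ) : Prop where
  gaussSpace : IsGaussSpace P S
  mem : ∀ t, Y t ∈ S
  continuous : ∀ ω, Continuous fun t => Y t ω
  scaling : ∀ r s t : ℝ, 0 < r → 0 ≤ s → 0 ≤ t →
    ∫ ω, Y (r * s) ω * Y (r * t) ω ∂P = (r ^ κ) ^ 2 * ∫ ω, Y s ω * Y t ω ∂P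

lemma antitone_grid {Ω : Type*} (s t a : ℝ) (Y : ℝ → Ω → ℝ) (b : ℝ) :
    Antitone fun n : ℕ => {ω | (∀ i : Fin n, |Y (s * unitSeq i) ω| ≤ a) ∧
      ∀ i : Fin n, |Y (t * unitSeq i) ω| ≤ b} := by
  intro m n hmn ω hω
  exact ⟨fun i => hω.1 (Fin.castLE hmn i), fun i => hω.2 (Fin.castLE hmn i)⟩

namespace IsSelfSimilarGaussian

variable {Ω : Type*} [MeasurableSpace Ω] {P : Measure Ω} {S : Submodule ℝ (Ω → ℝ)}
  {Y : ℝ → Ω → ℝ} {κ : ℝ}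

lemma measurable (h : IsSelfSimilarGaussian P S Y κ) (t : ℝ) : Measurable (Y t) :=
  h.gaussSpace.measurable _ (h.mem t)

lemma setOf_runSup_le (h : IsSelfSimilarGaussian P S Y κ) {t : ℝ} (ht : 0 ≤ t) (a : ℝ) :
    {ω | runSup Y t ω ≤ a} = ⋂ n : ℕ, {ω | ∀ i : Fin n, |Y (t * unitSeq i) ω| ≤ a} := by
  ext ω
  simp only [mem_ofPred_eq, mem_iInter]
  rw [runSup_le_iff_unitSeq (h.continuous ω) ht]
  exact ⟨fun h n i => h i, fun h n => h (n + 1) ⟨n, by simp⟩⟩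

lemma measurableSet_grid (h : IsSelfSimilarGaussian P S Y κ) {ι : Type*} [Countable ι]
    (t : ι → ℝ) (a : ℝ) : MeasurableSet {ω | ∀ i, |Y (t i) ω| ≤ a} := by
  rw [show {ω | ∀ i, |Y (t i) ω| ≤ a} = ⋂ i, {ω | |Y (t i) ω| ≤ a} by ext; simp]
  exact MeasurableSet.iInter fun i => measurableSet_le (h.measurable _).norm measurable_const

lemma measurable_runSup (h : IsSelfSimilarGaussian P S Y κ) {t : ℝ} (ht : 0 ≤ t) :
    Measurable (runSup Y t) := by
  refine measurable_of_Iic fun a => ?_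
  change MeasurableSet {ω | runSup Y t ω ≤ a}
  rw [h.setOf_runSup_le ht]
  exact MeasurableSet.iInter fun n => h.measurableSet_grid _ _

/-- The joint law of two running suprema is a limit of finite-dimensional probabilities. -/
lemma tendsto_grid (h : IsSelfSimilarGaussian P S Y κ) {s t : ℝ} (hs : 0 ≤ s) (ht : 0 ≤ t)
    (a b : ℝ) : Tendsto (fun n : ℕ => P {ω | (∀ i : Fin n, |Y (s * unitSeq i) ω| ≤ a) ∧
      ∀ i : Fin n, |Y (t * unitSeq i) ω| ≤ b}) atTop
      (𝓝 (P {ω | runSup Y s ω ≤ a ∧ runSup Y t ω ≤ b})) := by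
  have := h.gaussSpace.isProbabilityMeasure
  have e : {ω | runSup Y s ω ≤ a ∧ runSup Y t ω ≤ b} =
      ⋂ n : ℕ, {ω | (∀ i : Fin n, |Y (s * unitSeq i) ω| ≤ a) ∧
      ∀ i : Fin n, |Y (t * unitSeq i) ω| ≤ b} := by
    have h1 := h.setOf_runSup_le hs a
    have h2 := h.setOf_runSup_le ht b
    ext ω
    have h1' := Set.ext_iff.1 h1 ω
    have h2' := Set.ext_iff.1 h2 ω
    simp only [mem_ofPred_eq, mem_iInter] at h1' h2' ⊢
    rw [h1', h2', forall_and]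
  rw [e]
  exact tendsto_measure_iInter_atTop (fun n => ((h.measurableSet_grid _ _).inter
    (h.measurableSet_grid _ _)).nullMeasurableSet) (antitone_grid s t a Y b) ⟨0, by simp⟩

lemma tendsto_grid_single (h : IsSelfSimilarGaussian P S Y κ) {t : ℝ} (ht : 0 ≤ t)
    (a : ℝ) : Tendsto (fun n : ℕ => P {ω | ∀ i : Fin n, |Y (t * unitSeq i) ω| ≤ a}) atTop
      (𝓝 (P {ω | runSup Y t ω ≤ a})) := by
  have := h.tendsto_grid ht ht a a
  simpa using this

/-- Scaling of the joint law of two running suprema. -/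
lemma measure_scaling (h : IsSelfSimilarGaussian P S Y κ) {r s t : ℝ} (hr : 0 < r) (hs : 0 ≤ s)
    (ht : 0 ≤ t) (a b : ℝ) :
    P {ω | runSup Y (r * s) ω ≤ r ^ κ * a ∧ runSup Y (r * t) ω ≤ r ^ κ * b} =
      P {ω | runSup Y s ω ≤ a ∧ runSup Y t ω ≤ b} := by
  refine tendsto_nhds_unique (h.tendsto_grid (mul_nonneg hr.le hs) (mul_nonneg hr.le ht) _ _) ?_
  refine (h.tendsto_grid hs ht a b).congr fun n => ?_
  have hrk : 0 < r ^ κ := Real.rpow_pos_of_pos hr κ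
  have hS := h.gaussSpace
  let g : Fin n ⊕ Fin n → ℝ := Sum.elim (fun i => s * unitSeq i) (fun i => t * unitSeq i)
  have hg : ∀ i, 0 ≤ g i := by
    rintro (i | i)
    · exact mul_nonneg hs (unitSeq_mem _).1
    · exact mul_nonneg ht (unitSeq_mem _).1
  have hlaw : P.map (fun ω i => Y (r * g i) ω) = P.map (fun ω i => (r ^ κ • Y (g i)) ω) := by
    refine hS.map_eq_map hS (fun i => h.mem _) (fun i => S.smul_mem _ (h.mem _)) fun i j => ?_
    rw [h.scaling r _ _ hr (hg i) (hg j), ← integral_const_mul]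
    congr 1; ext ω
    simp only [Pi.smul_apply, smul_eq_mul]; ring
  set B : Set (Fin n ⊕ Fin n → ℝ) := {w | (∀ i, |w (Sum.inl i)| ≤ r ^ κ * a) ∧
    ∀ i, |w (Sum.inr i)| ≤ r ^ κ * b} with hB
  have hBm : MeasurableSet B := by
    have hm : ∀ (v : Fin n → Fin n ⊕ Fin n) (x : ℝ),
        MeasurableSet {w : Fin n ⊕ Fin n → ℝ | ∀ i, |w (v i)| ≤ x} := by
      intro v x
      rw [show {w : Fin n ⊕ Fin n → ℝ | ∀ i, |w (v i)| ≤ x} = ⋂ i, {w | |w (v i)| ≤ x} by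
        ext; simp]
      exact MeasurableSet.iInter fun i => measurableSet_le (by fun_prop) measurable_const
    exact (hm _ _).inter (hm _ _)
  have : P.map (fun ω i => Y (r * g i) ω) B = P.map (fun ω i => (r ^ κ • Y (g i)) ω) B := by
    rw [hlaw]
  rw [Measure.map_apply (hS.measurable_pi fun i => h.mem _) hBm, Measure.map_apply
    (hS.measurable_pi fun i => S.smul_mem _ (h.mem _)) hBm] at this
  have e1 : (fun ω i => Y (r * g i) ω) ⁻¹' B = {ω | (∀ i : Fin n, |Y (r * s * unitSeq i) ω| ≤
      r ^ κ * a) ∧ ∀ i : Fin n, |Y (r * t * unitSeq i) ω| ≤ r ^ κ * b} := by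
    ext ω
    simp [hB, g, mul_assoc]
  have e2 : (fun ω i => (r ^ κ • Y (g i)) ω) ⁻¹' B = {ω | (∀ i : Fin n, |Y (s * unitSeq i) ω| ≤ a) ∧
      ∀ i : Fin n, |Y (t * unitSeq i) ω| ≤ b} := by
    ext ω
    simp [hB, g, abs_mul, abs_of_pos hrk, hrk]
  rw [← e2, ← e1, this]

lemma measure_scaling_single (h : IsSelfSimilarGaussian P S Y κ) {t : ℝ} (ht : 0 < t) (a : ℝ) :
    P {ω | runSup Y t ω ≤ t ^ κ * a} = P {ω | runSup Y 1 ω ≤ a} := by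
  have := h.measure_scaling ht zero_le_one zero_le_one a a
  simpa using this

/-- Midpoint log-concavity of the small ball function. -/
lemma smallBall_mul_le (h : IsSelfSimilarGaussian P S Y κ) (a b : ℝ) :
    smallBall P Y a * smallBall P Y b ≤ smallBall P Y ((a + b) / 2) ^ 2 := by
  have := h.gaussSpace.isProbabilityMeasure
  unfold smallBall
  rw [← ENNReal.toReal_mul, ← ENNReal.toReal_pow]
  refine ENNReal.toReal_mono (by simp) ?_
  refine le_of_tendsto_of_tendsto' (ENNReal.Tendsto.mul (h.tendsto_grid_single zero_le_one a)
    (Or.inr (by simp)) (h.tendsto_grid_single zero_le_one b) (Or.inr (by simp)))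
    (((ENNReal.continuous_pow 2).tendsto _).comp (h.tendsto_grid_single zero_le_one _)) fun n => ?_
  exact h.gaussSpace.measure_box_mul_le (fun i => h.mem _) a b

end IsSelfSimilarGaussian

/-- The probability that a Gaussian variable stays within one standard deviation. -/
lemma exists_measure_abs_le : ∃ q : ℝ, 0 < q ∧ q < 1 ∧ ∀ {Ω : Type*} [MeasurableSpace Ω]
    {P : Measure Ω} {S : Submodule ℝ (Ω → ℝ)}, IsGaussSpace P S → ∀ f ∈ S, ∀ b : ℝ, 0 < b →
    b ^ 2 ≤ ∫ ω, f ω ^ 2 ∂P → P {ω | |f ω| ≤ b} ≤ ENNReal.ofReal q := by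
  set q₀ := gaussianReal 0 1 (Icc (-1) 1) with hq₀
  have hq1 : q₀ < 1 := by
    have h1 : gaussianReal 0 1 (Ioi 1) ≠ 0 := by
      intro h
      have := gaussianReal_absolutelyContinuous' (0:ℝ) (v := 1) one_ne_zero h
      simp at this
    have h2 : q₀ + gaussianReal 0 1 (Ioi 1) ≤ 1 := by
      rw [hq₀, ← measure_union (by
        rw [Set.disjoint_left]; intro x hx hx'; exact absurd hx.2 (not_le.2 hx')) measurableSet_Ioi]
      exact prob_le_one
    refine lt_of_lt_of_le ?_ h2
    exact ENNReal.lt_add_right (measure_ne_top _ _) h1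
  refine ⟨max q₀.toReal (1 / 2), by positivity, max_lt ?_ (by norm_num), ?_⟩
  · have := (ENNReal.toReal_lt_toReal (measure_ne_top _ _) ENNReal.one_ne_top).2 hq1
    simpa using this
  intro Ω _ P S hS f hf b hb hv
  set v := ∫ ω, f ω ^ 2 ∂P
  have hv0 : 0 < v := (by positivity : 0 < b ^ 2).trans_le hv
  have h1 : P {ω | |f ω| ≤ b} = P.map f {x | |x| ≤ b} := by
    rw [Measure.map_apply (hS.measurable f hf) (measurableSet_le (by fun_prop) measurable_const)]
    rfl
  have h2 : gaussianReal 0 v.toNNReal = (gaussianReal 0 1).map (√v * ·) := by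
    rw [gaussianReal_map_const_mul]
    congr 1
    · simp
    · ext
      simp [hv0.le]
  rw [h1, hS.map_eq hf, h2, Measure.map_apply (by fun_prop)
    (measurableSet_le (by fun_prop) measurable_const)]
  calc _ ≤ q₀ := by
        refine measure_mono fun x hx => ?_
        have hx' : |√v * x| ≤ b := hx
        rw [abs_mul, abs_of_nonneg (Real.sqrt_nonneg _)] at hx'
        have hb' : b ≤ √v := Real.le_sqrt_of_sq_le hv
        have : |x| ≤ 1 := by
          by_contra! hc
          have : √v * 1 < √v * |x| := mul_lt_mul_of_pos_left hc (Real.sqrt_pos.2 hv0)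
          linarith
        exact abs_le.1 this
    _ = ENNReal.ofReal q₀.toReal := (ENNReal.ofReal_toReal (measure_ne_top _ _)).symm
    _ ≤ _ := ENNReal.ofReal_le_ofReal (le_max_left _ _)

/-- One-sided strong local nondeterminism of order `β` on the unit interval. -/
def IsNondeterministic {Ω : Type*} [MeasurableSpace Ω] (P : Measure Ω) (Y : ℝ → Ω → ℝ)
    (β : ℝ) : Prop :=
  ∃ c : ℝ, 0 < c ∧ ∀ (ι : Type) [Fintype ι] (t a : ι → ℝ) (u v : ℝ), 0 ≤ u → u < v → v ≤ 1 →
    (∀ j, t j ∈ Icc 0 u) →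
    (c * (v - u) ^ β) ^ 2 ≤ ∫ ω, (Y v ω - ∑ j, a j * Y (t j) ω) ^ 2 ∂P

/-- The part of the process on the unit interval which is determined by the values before time `s`
is of order `s ^ ε`. -/
def IsDecorrelated {Ω : Type*} [MeasurableSpace Ω] (P : Measure Ω) (Y : ℝ → Ω → ℝ) : Prop :=
  ∃ D : ℝ, 0 < D ∧ ∃ ε : ℝ, 0 < ε ∧ ∀ s : ℝ, 0 < s → s ≤ 1 → ∀ (n m : ℕ) (t : Fin n → ℝ) (u : Fin m → ℝ),
    (∀ j, t j ∈ Icc 0 s) → (∀ i, u i ∈ Icc (0:ℝ) 1) →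
    ∃ c : Fin m → Fin n → ℝ,
      (∀ i j, ∫ ω, (Y (u i) ω - ∑ k, c i k * Y (t k) ω) * Y (t j) ω ∂P = 0) ∧
      2⁻¹ ≤ P {ω | ∀ i, |∑ k, c i k * Y (t k) ω| ≤ D * s ^ ε}

namespace IsSelfSimilarGaussian

variable {Ω : Type*} [MeasurableSpace Ω] {P : Measure Ω} {S : Submodule ℝ (Ω → ℝ)}
  {Y : ℝ → Ω → ℝ} {κ : ℝ}

lemma measure_inter_abs_le (h : IsSelfSimilarGaussian P S Y κ) {β c q δ b : ℝ}
    (hc : ∀ (ι : Type) [Fintype ι] (t a : ι → ℝ) (u v : ℝ), 0 ≤ u → u < v → v ≤ 1 →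
      (∀ j, t j ∈ Icc 0 u) →
      (c * (v - u) ^ β) ^ 2 ≤ ∫ ω, (Y v ω - ∑ j, a j * Y (t j) ω) ^ 2 ∂P)
    (hq : ∀ f ∈ S, ∀ b : ℝ, 0 < b →
      b ^ 2 ≤ ∫ ω, f ω ^ 2 ∂P → P {ω | |f ω| ≤ b} ≤ ENNReal.ofReal q)
    (hb : 0 < b) (hδ : 0 < δ) (hδb : b ≤ c * δ ^ β)
    {ι : Type} [Fintype ι] {t : ι → ℝ} {u : ℝ} (hu : 0 ≤ u) (hu1 : u + δ ≤ 1)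
    (ht : ∀ j, t j ∈ Icc 0 u) {E : Set (ι → ℝ)} (hE : MeasurableSet E) :
    P {ω | (fun j => Y (t j) ω) ∈ E ∧ |Y (u + δ) ω| ≤ b} ≤
      P {ω | (fun j => Y (t j) ω) ∈ E} * ENNReal.ofReal q := by
  obtain ⟨a, ha⟩ := h.gaussSpace.exists_projection (h.mem (u + δ)) (fun j => h.mem (t j))
  have h1 := h.gaussSpace.measure_inter_box_le (f := fun _ : Fin 1 => Y (u + δ))
    (fun _ => h.mem _) (fun j => h.mem (t j)) (fun _ => a) (fun _ => ha) hE b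
  simp only [forall_const] at h1
  refine h1.trans (mul_le_mul_right ?_ _)
  have h2 := hc ι t a u (u + δ) hu (by linarith) hu1 ht
  have hW : (Y (u + δ) - ∑ j, a j • Y (t j)) ∈ S :=
    S.sub_mem (h.mem _) (S.sum_mem fun k _ => S.smul_mem _ (h.mem _))
  have := hq _ hW b hb (by
    refine le_trans ?_ (h2.trans (le_of_eq ?_))
    · rw [add_sub_cancel_left]
      exact pow_le_pow_left₀ hb.le hδb 2
    · congr 1; ext ω; simp)
  simpa using this

/-- Exponential decay of the joint small ball probability in the number of grid steps. -/
lemma measure_runSup_grid_le (h : IsSelfSimilarGaussian P S Y κ) {β c q δ b : ℝ}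
    (hc : ∀ (ι : Type) [Fintype ι] (t a : ι → ℝ) (u v : ℝ), 0 ≤ u → u < v → v ≤ 1 →
      (∀ j, t j ∈ Icc 0 u) →
      (c * (v - u) ^ β) ^ 2 ≤ ∫ ω, (Y v ω - ∑ j, a j * Y (t j) ω) ^ 2 ∂P)
    (hq : ∀ f ∈ S, ∀ b : ℝ, 0 < b →
      b ^ 2 ≤ ∫ ω, f ω ^ 2 ∂P → P {ω | |f ω| ≤ b} ≤ ENNReal.ofReal q)
    (hb : 0 < b) (hδ : 0 < δ) (hδb : b ≤ c * δ ^ β) {s : ℝ} (hs : 0 ≤ s) (a : ℝ) (n : ℕ)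
    (hn : s + n * δ ≤ 1) :
    P {ω | runSup Y s ω ≤ a ∧ runSup Y 1 ω ≤ b} ≤
      P {ω | runSup Y s ω ≤ a} * ENNReal.ofReal q ^ n := by
  have := h.gaussSpace.isProbabilityMeasure
  have key : ∀ (N : ℕ) (n : ℕ), s + n * δ ≤ 1 →
      P {ω | (∀ i : Fin N, |Y (s * unitSeq i) ω| ≤ a) ∧
        ∀ k : Fin n, |Y (s + (k + 1 : ℕ) * δ) ω| ≤ b} ≤
      P {ω | ∀ i : Fin N, |Y (s * unitSeq i) ω| ≤ a} * ENNReal.ofReal q ^ n := by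
    intro N n
    induction n with
    | zero => intro _; simp
    | succ n ih =>
      intro hn
      push_cast at hn
      let t : Fin N ⊕ Fin n → ℝ :=
        Sum.elim (fun i => s * unitSeq i) (fun k => s + (k + 1 : ℕ) * δ)
      set E : Set (Fin N ⊕ Fin n → ℝ) :=
        {w | (∀ i, |w (Sum.inl i)| ≤ a) ∧ ∀ k, |w (Sum.inr k)| ≤ b} with hE
      have hEm : MeasurableSet E := by
        refine MeasurableSet.inter (s₁ := {w : Fin N ⊕ Fin n → ℝ | ∀ i, |w (Sum.inl i)| ≤ a})
          (s₂ := {w | ∀ k, |w (Sum.inr k)| ≤ b}) ?_ ?_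
        · rw [show {w : Fin N ⊕ Fin n → ℝ | ∀ i, |w (Sum.inl i)| ≤ a} =
            ⋂ i, {w | |w (Sum.inl i)| ≤ a} by ext; simp]
          exact MeasurableSet.iInter fun i => measurableSet_le (by fun_prop) measurable_const
        · rw [show {w : Fin N ⊕ Fin n → ℝ | ∀ i, |w (Sum.inr i)| ≤ b} =
            ⋂ i, {w | |w (Sum.inr i)| ≤ b} by ext; simp]
          exact MeasurableSet.iInter fun i => measurableSet_le (by fun_prop) measurable_const
      have ht : ∀ j, t j ∈ Icc 0 (s + n * δ) := by
        rintro (i | k)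
        · have hi := unitSeq_mem i
          refine ⟨mul_nonneg hs hi.1, (mul_le_of_le_one_right hs hi.2).trans ?_⟩
          have : 0 ≤ n * δ := by positivity
          linarith
        · refine ⟨by simp only [t, Sum.elim_inr]; positivity, ?_⟩
          have : ((k + 1 : ℕ) : ℝ) ≤ n := by exact_mod_cast k.2
          simp only [t, Sum.elim_inr]
          nlinarith
      have h1 := h.measure_inter_abs_le hc hq hb hδ hδb (t := t) (u := s + n * δ)
        (by positivity) (by linarith) ht hEm
      have e : {ω | (fun j => Y (t j) ω) ∈ E} = {ω | (∀ i : Fin N, |Y (s * unitSeq i) ω| ≤ a) ∧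
        ∀ k : Fin n, |Y (s + (k + 1 : ℕ) * δ) ω| ≤ b} := by
        ext ω; simp [hE, t]
      have e' : {ω | (∀ i : Fin N, |Y (s * unitSeq i) ω| ≤ a) ∧
          ∀ k : Fin (n + 1), |Y (s + (k + 1 : ℕ) * δ) ω| ≤ b} ⊆
          {ω | (fun j => Y (t j) ω) ∈ E ∧ |Y (s + n * δ + δ) ω| ≤ b} := by
        rintro ω ⟨h1, h2⟩
        refine ⟨⟨h1, fun k => h2 k.castSucc⟩, ?_⟩
        have := h2 (Fin.last n)
        simp only [Fin.val_last] at this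
        push_cast at this
        rwa [show s + n * δ + δ = s + (n + 1) * δ by ring]
      refine (measure_mono e').trans (h1.trans ?_)
      rw [e, pow_succ, ← mul_assoc]
      exact mul_le_mul_left (ih (by linarith)) _
  have hlim : Tendsto (fun N : ℕ => P {ω | ∀ i : Fin N, |Y (s * unitSeq i) ω| ≤ a} *
      ENNReal.ofReal q ^ n) atTop (𝓝 (P {ω | runSup Y s ω ≤ a} * ENNReal.ofReal q ^ n)) :=
    ENNReal.Tendsto.mul_const (h.tendsto_grid_single hs a) (Or.inr (by finiteness))
  refine ge_of_tendsto' hlim fun N => le_trans (measure_mono ?_) (key N n hn)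
  rintro ω ⟨h1, h2⟩
  refine ⟨fun i => (runSup_le_iff_unitSeq (h.continuous ω) hs a).1 h1 i, fun k => ?_⟩
  refine (runSup_le_iff (h.continuous ω) zero_le_one b).1 h2 _ ⟨by positivity, ?_⟩
  have : ((k + 1 : ℕ) : ℝ) ≤ n := by exact_mod_cast k.2
  nlinarith

/-- Near-diagonal bound on the joint small ball probability. -/
lemma exists_near_bound (h : IsSelfSimilarGaussian P S Y κ) {β : ℝ} (hβ : 0 < β)
    (hnd : IsNondeterministic P Y β) :
    ∃ C : ℝ, 0 < C ∧ ∃ c : ℝ, 0 < c ∧ ∀ s a b : ℝ, 0 ≤ s → s ≤ 1 → 0 < b →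
      P {ω | runSup Y s ω ≤ a ∧ runSup Y 1 ω ≤ b} ≤
        P {ω | runSup Y s ω ≤ a} * ENNReal.ofReal (C * Real.exp (-(c * (1 - s) * b ^ (-(1 / β))))) := by
  obtain ⟨c, hc0, hc⟩ := hnd
  obtain ⟨q, hq0, hq1, hq⟩ := exists_measure_abs_le
  refine ⟨q⁻¹, by positivity, -Real.log q * c ^ (1 / β), mul_pos (by
    simpa using Real.log_neg hq0 hq1) (by positivity), fun s a b hs hs1 hb => ?_⟩
  set δ := (b / c) ^ (1 / β) with hδ
  have hδ0 : 0 < δ := by positivity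
  have hδb : c * δ ^ β = b := by
    rw [hδ, ← Real.rpow_mul (by positivity), one_div_mul_cancel hβ.ne', Real.rpow_one,
      mul_div_cancel₀ _ hc0.ne']
  set n := ⌊(1 - s) / δ⌋₊
  have hn : n * δ ≤ 1 - s := by
    have := Nat.floor_le (a := (1 - s) / δ) (div_nonneg (by linarith) hδ0.le)
    rwa [le_div_iff₀ hδ0] at this
  refine (h.measure_runSup_grid_le hc (hq h.gaussSpace) hb hδ0 hδb.ge hs a n (by linarith)).trans ?_
  refine mul_le_mul_right ?_ _
  rw [← ENNReal.ofReal_pow hq0.le]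
  refine ENNReal.ofReal_le_ofReal ?_
  have h1 : (1 - s) / δ - 1 ≤ n := by
    have := Nat.lt_floor_add_one ((1 - s) / δ)
    linarith
  calc q ^ n = Real.exp (Real.log q * n) := by
        rw [← Real.rpow_natCast, Real.rpow_def_of_pos hq0]
    _ ≤ Real.exp (Real.log q * ((1 - s) / δ - 1)) := by
        refine Real.exp_le_exp.2 (mul_le_mul_of_nonpos_left h1 (Real.log_neg hq0 hq1).le)
    _ = _ := by
        rw [mul_sub, mul_one, Real.exp_sub, Real.exp_log hq0, div_eq_inv_mul, hδ,
          Real.div_rpow hb.le hc0.le, Real.rpow_neg hb.le]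
        congr 2
        field_simp

/-- Off-diagonal bound on the joint small ball probability. -/
lemma exists_far_bound (h : IsSelfSimilarGaussian P S Y κ) (hd : IsDecorrelated P Y) :
    ∃ D : ℝ, 0 < D ∧ ∃ ε : ℝ, 0 < ε ∧ ∀ s a b : ℝ, 0 < s → s ≤ 1 →
      P {ω | runSup Y s ω ≤ a ∧ runSup Y 1 ω ≤ b} ≤
        P {ω | runSup Y s ω ≤ a} * (2 * P {ω | runSup Y 1 ω ≤ b + D * s ^ ε}) := by
  obtain ⟨D, hD, ε, hε, hd⟩ := hd
  refine ⟨D, hD, ε, hε, fun s a b hs hs1 => ?_⟩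
  have hS := h.gaussSpace
  have := hS.isProbabilityMeasure
  have key : ∀ n : ℕ, P {ω | (∀ i : Fin n, |Y (s * unitSeq i) ω| ≤ a) ∧
      ∀ i : Fin n, |Y (1 * unitSeq i) ω| ≤ b} ≤
      P {ω | ∀ i : Fin n, |Y (s * unitSeq i) ω| ≤ a} *
        (2 * P {ω | ∀ i : Fin n, |Y (1 * unitSeq i) ω| ≤ b + D * s ^ ε}) := by
    intro n
    obtain ⟨c, hc, hcP⟩ := hd s hs hs1 n n (fun i => s * unitSeq i) (fun i => 1 * unitSeq i)
      (fun i => ⟨mul_nonneg hs.le (unitSeq_mem i).1, mul_le_of_le_one_right hs.le (unitSeq_mem i).2⟩)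
      (fun i => by simpa using unitSeq_mem i)
    have hbox : ∀ x : ℝ, MeasurableSet {w : Fin n → ℝ | ∀ i, |w i| ≤ x} := fun x => by
      simpa using IsGaussSpace.measurableSet_box (0 : Fin n → ℝ) x
    have h1 := hS.measure_inter_box_le (f := fun i : Fin n => Y (1 * unitSeq i))
      (g := fun i : Fin n => Y (s * unitSeq i)) (fun i => h.mem _) (fun i => h.mem _) c hc (hbox a) b
    refine h1.trans (mul_le_mul_right ?_ _)
    have hW : ∀ i : Fin n, (Y (1 * unitSeq i) - ∑ k, c i k • Y (s * unitSeq k)) ∈ S := fun i =>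
      S.sub_mem (h.mem _) (S.sum_mem fun k _ => S.smul_mem _ (h.mem _))
    have hZ : ∀ i : Fin n, (∑ k, c i k • Y (s * unitSeq k)) ∈ S := fun i =>
      (S.sum_mem fun k _ => S.smul_mem _ (h.mem _))
    have hind := hS.indepFun hW (fun i => h.mem (s * unitSeq (i : Fin n))) (fun i j => by
      rw [← hc i j]; congr 1; ext ω; simp)
    have hprod := hind.measure_inter_preimage_eq_mul {w | ∀ i, |w i| ≤ b}
      {w | ∀ i : Fin n, |∑ k, c i k * w k| ≤ D * s ^ ε} (hbox b) (by
        rw [show {w : Fin n → ℝ | ∀ i : Fin n, |∑ k, c i k * w k| ≤ D * s ^ ε} =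
          ⋂ i, {w | |∑ k, c i k * w k| ≤ D * s ^ ε} by ext; simp]
        exact MeasurableSet.iInter fun i => measurableSet_le (by fun_prop) measurable_const)
    set p := P {ω | ∀ i : Fin n, |Y (1 * unitSeq i) ω - ∑ k, c i k * Y (s * unitSeq k) ω| ≤ b} with hp
    have e1 : (fun ω (i : Fin n) => (Y (1 * unitSeq i) - ∑ k, c i k • Y (s * unitSeq k)) ω) ⁻¹'
        {w : Fin n → ℝ | ∀ i, |w i| ≤ b} =
        {ω | ∀ i : Fin n, |Y (1 * unitSeq i) ω - ∑ k, c i k * Y (s * unitSeq k) ω| ≤ b} := by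
      ext ω; simp
    rw [e1, ← hp] at hprod
    calc p = 2 * (p * 2⁻¹) := by
          rw [mul_comm p, ← mul_assoc, ENNReal.mul_inv_cancel (by simp) (by simp), one_mul]
      _ ≤ 2 * (p * P {ω | ∀ i : Fin n, |∑ k, c i k * Y (s * unitSeq k) ω| ≤ D * s ^ ε}) := by gcongr
      _ ≤ _ := by
          refine mul_le_mul_right (le_trans hprod.symm.le (measure_mono ?_)) _
          rintro ω ⟨h2, h3⟩ i
          have h2' := abs_le.1 (h2 i)
          have h3' := abs_le.1 (h3 i)
          rw [abs_le]
          constructor <;> linarith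
  refine le_of_tendsto_of_tendsto' (h.tendsto_grid hs.le zero_le_one a b)
    (ENNReal.Tendsto.mul (h.tendsto_grid_single hs.le a) (Or.inr (by finiteness))
      (ENNReal.Tendsto.const_mul (h.tendsto_grid_single zero_le_one _) (Or.inr (by simp)))
      (Or.inr (by finiteness))) key

end IsSelfSimilarGaussian

/-- Regularity of a midpoint log-concave function with a polynomial lower bound on its
exponential decay at zero. -/
lemma le_exp_one_mul_of_midpoint_logConcave {φ : ℝ → ℝ} (hpos : ∀ x, 0 < x → 0 < φ x)
    (hmono : Monotone φ) (hle : ∀ x, φ x ≤ 1)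
    (hlc : ∀ a b, φ a * φ b ≤ φ ((a + b) / 2) ^ 2) {K p : ℝ} (hK : 0 < K) (hp : 0 < p)
    (hsb : ∀ x : ℝ, 0 < x → x ≤ 1 → Real.exp (-(K * x ^ (-p))) ≤ φ x) (x₀ : ℝ) (hx₀ : 0 < x₀) :
    ∃ c : ℝ, 0 < c ∧ ∀ x h : ℝ, 0 < x → x ≤ x₀ → 0 ≤ h → h ≤ c * x ^ (1 + p) →
      φ (x + h) ≤ Real.exp 1 * φ x := by
  set c₁ := max 2 x₀
  have hc₁ : 0 < c₁ := by positivity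
  set K' := K * c₁ ^ p
  have hK' : 0 < K' := by positivity
  set c := (2 * (K' + x₀ ^ p))⁻¹ with hc
  refine ⟨c, by positivity, fun x h hx hxx₀ hh hhc => ?_⟩
  have hratio : ∀ n : ℕ, n * h ≤ x / 2 →
      φ (x + h) * φ (x - n * h) ≤ φ x * φ (x - (n - 1) * h) := by
    intro n
    induction n with
    | zero => intro _; simp [mul_comm]
    | succ n ih =>
      intro hn
      push_cast at hn ⊢
      have h0 := ih (by nlinarith)
      have h1 := hlc (x - (n - 1) * h) (x - (n + 1) * h)
      rw [show (x - (n - 1) * h + (x - (n + 1) * h)) / 2 = x - n * h by ring] at h1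
      have p1 : 0 < φ (x - (n - 1) * h) := hpos _ (by nlinarith)
      have p2 : 0 < φ (x - n * h) := hpos _ (by nlinarith)
      have p3 : 0 < φ (x - (n + 1) * h) := hpos _ (by nlinarith)
      have p4 : 0 < φ x := hpos _ hx
      rw [show x - (n + 1 - 1) * h = x - n * h by ring]
      refine le_of_mul_le_mul_right ?_ (mul_pos p1 p2)
      calc φ (x + h) * φ (x - (n + 1) * h) * (φ (x - (n - 1) * h) * φ (x - n * h))
          = (φ (x + h) * φ (x - n * h)) * (φ (x - (n - 1) * h) * φ (x - (n + 1) * h)) := by ring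
        _ ≤ (φ x * φ (x - (n - 1) * h)) * φ (x - n * h) ^ 2 := by gcongr
        _ = _ := by ring
  have hpow : ∀ n : ℕ, n * h ≤ x / 2 → φ (x + h) ^ n * φ (x - n * h) ≤ φ x ^ n * φ x := by
    intro n
    induction n with
    | zero => intro _; simp
    | succ n ih =>
      intro hn
      have hr := hratio (n + 1) hn
      push_cast at hn hr ⊢
      have h0 := ih (by nlinarith)
      rw [show x - (n + 1 - 1) * h = x - n * h by ring] at hr
      have p4 : 0 < φ x := hpos _ hx
      have p5 : 0 < φ (x + h) := hpos _ (by linarith)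
      calc φ (x + h) ^ (n + 1) * φ (x - (n + 1) * h)
          = φ (x + h) ^ n * (φ (x + h) * φ (x - (n + 1) * h)) := by ring
        _ ≤ φ (x + h) ^ n * (φ x * φ (x - n * h)) := by gcongr
        _ = φ x * (φ (x + h) ^ n * φ (x - n * h)) := by ring
        _ ≤ φ x * (φ x ^ n * φ x) := by gcongr
        _ = _ := by ring
  set n := ⌈K' * x ^ (-p)⌉₊ with hn
  have hxp : 0 < x ^ (-p) := by positivity
  have hn0 : 0 < n := Nat.ceil_pos.2 (by positivity)
  have hnle : (n : ℝ) ≤ (K' + x₀ ^ p) * x ^ (-p) := by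
    have h1 := (Nat.ceil_lt_add_one (a := K' * x ^ (-p)) (by positivity)).le
    have h2 : 1 ≤ x₀ ^ p * x ^ (-p) := by
      rw [Real.rpow_neg hx.le, ← div_eq_mul_inv, one_le_div (by positivity)]
      exact Real.rpow_le_rpow hx.le hxx₀ hp.le
    linarith
  have hnh : n * h ≤ x / 2 := by
    calc n * h ≤ ((K' + x₀ ^ p) * x ^ (-p)) * (c * x ^ (1 + p)) := by gcongr
      _ = ((K' + x₀ ^ p) * c) * (x ^ (-p) * x ^ (1 + p)) := by ring
      _ = x / 2 := by
        rw [← Real.rpow_add hx, show -p + (1 + p) = 1 by ring, Real.rpow_one, hc]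
        field_simp
  have h1 := hpow n hnh
  have hx1 : x / c₁ ≤ 1 := by
    rw [div_le_one hc₁]; exact hxx₀.trans (le_max_right _ _)
  have h2 : Real.exp (-n) ≤ φ (x - n * h) := by
    refine le_trans ?_ ((hsb (x / c₁) (by positivity) hx1).trans (hmono ?_))
    · rw [Real.exp_le_exp, neg_le_neg_iff, Real.div_rpow hx.le hc₁.le, Real.rpow_neg hc₁.le,
        div_inv_eq_mul]
      refine le_trans (le_of_eq ?_) (Nat.le_ceil (K' * x ^ (-p)))
      simp only [K']; ring
    · have : x / c₁ ≤ x / 2 := by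
        gcongr; exact le_max_left _ _
      linarith
  have p4 : 0 < φ x := hpos _ hx
  have p5 : 0 < φ (x + h) := hpos _ (by linarith)
  have h3 : φ (x + h) ^ n ≤ (Real.exp 1 * φ x) ^ n := by
    rw [mul_pow, ← Real.exp_nat_mul, mul_one]
    have : φ (x + h) ^ n * Real.exp (-n) ≤ φ x ^ n :=
      calc φ (x + h) ^ n * Real.exp (-n) ≤ φ (x + h) ^ n * φ (x - n * h) := by gcongr
        _ ≤ φ x ^ n * φ x := h1
        _ ≤ φ x ^ n * 1 := by gcongr; exact hle x
        _ = _ := mul_one _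
    rw [Real.exp_neg, ← div_eq_mul_inv, div_le_iff₀ (Real.exp_pos _)] at this
    linarith
  exact le_of_pow_le_pow_left₀ hn0.ne' (by positivity) h3

/-- The second moment method, with an off-diagonal bound on the pair probabilities. -/
lemma sq_lintegral_measure_le {Ω : Type*} [MeasurableSpace Ω] (P : Measure Ω)
    [IsProbabilityMeasure P] (ν : Measure ℝ) [IsFiniteMeasure ν] {E : Set (ℝ × Ω)}
    (hE : MeasurableSet E) {p : ℝ → ℝ≥0∞} {J : ℝ≥0∞} {b : ℝ → ℝ → ℝ≥0∞}
    (hp : Measurable p) (hpf : ∀ s, p s ≠ ∞)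
    (hpair : ∀ᵐ s ∂ν, ∀ᵐ t ∂ν, s ≤ t →
      P {ω | (s, ω) ∈ E ∧ (t, ω) ∈ E} ≤ p s * b s t)
    (hJ : ∀ᵐ s ∂ν, ∫⁻ t in Ici s, b s t ∂ν ≤ J) :
    (∫⁻ t, P {ω | (t, ω) ∈ E} ∂ν) ^ 2 ≤
      2 * (∫⁻ s, p s ∂ν) * J * P {ω | ν {t | (t, ω) ∈ E} ≠ 0} := by
  set Z : Ω → ℝ≥0∞ := fun ω => ν {t | (t, ω) ∈ E} with hZ
  have hZm : Measurable Z := measurable_measure_prodMk_right hE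
  have h1 : ∫⁻ t, P {ω | (t, ω) ∈ E} ∂ν = ∫⁻ ω, Z ω ∂P := by
    have e1 := Measure.prod_apply (μ := ν) (ν := P) hE
    have e2 := Measure.prod_apply_symm (μ := ν) (ν := P) hE
    exact e1.symm.trans e2
  have hpairE : MeasurableSet {x : (ℝ × ℝ) × Ω | (x.1.1, x.2) ∈ E ∧ (x.1.2, x.2) ∈ E} := by
    refine MeasurableSet.inter (s₁ := {x : (ℝ × ℝ) × Ω | (x.1.1, x.2) ∈ E})
      (s₂ := {x : (ℝ × ℝ) × Ω | (x.1.2, x.2) ∈ E}) ?_ ?_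
    · exact (show Measurable fun x : (ℝ × ℝ) × Ω => (x.1.1, x.2) by fun_prop) hE
    · exact (show Measurable fun x : (ℝ × ℝ) × Ω => (x.1.2, x.2) by fun_prop) hE
  set Q : ℝ → ℝ → ℝ≥0∞ := fun s t => P {ω | (s, ω) ∈ E ∧ (t, ω) ∈ E} with hQ
  have hQm : Measurable (Function.uncurry Q) := measurable_measure_prodMk_left hpairE
  have hQs : ∀ s t, Q s t = Q t s := fun s t => by simp only [hQ, and_comm]
  have h2 : ∫⁻ ω, Z ω ^ 2 ∂P = ∫⁻ s, ∫⁻ t, Q s t ∂ν ∂ν := by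
    have e1 := Measure.prod_apply (μ := ν.prod ν) (ν := P) hpairE
    have e2 := Measure.prod_apply_symm (μ := ν.prod ν) (ν := P) hpairE
    rw [e1] at e2
    refine Eq.trans ?_ (e2.symm.trans (lintegral_prod _ hQm.aemeasurable))
    refine lintegral_congr fun ω => ?_
    have : (fun x : ℝ × ℝ => (x, ω)) ⁻¹' {x : (ℝ × ℝ) × Ω | (x.1.1, x.2) ∈ E ∧ (x.1.2, x.2) ∈ E}
      = {t | (t, ω) ∈ E} ×ˢ {t | (t, ω) ∈ E} := by ext; simp
    rw [this, Measure.prod_prod, sq]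
  have h3 : ∫⁻ s, ∫⁻ t, Q s t ∂ν ∂ν ≤ 2 * ∫⁻ s, ∫⁻ t in Ici s, Q s t ∂ν ∂ν := by
    set F : ℝ → ℝ → ℝ≥0∞ := fun s t => {x : ℝ × ℝ | x.1 ≤ x.2}.indicator (Function.uncurry Q) (s, t)
    have hle : MeasurableSet {x : ℝ × ℝ | x.1 ≤ x.2} := measurableSet_le measurable_fst measurable_snd
    have hFm : Measurable (Function.uncurry F) := hQm.indicator hle
    have e : ∀ s, ∫⁻ t in Ici s, Q s t ∂ν = ∫⁻ t, F s t ∂ν := fun s => by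
      rw [← lintegral_indicator measurableSet_Ici]
      rfl
    simp_rw [e]
    have hs : ∫⁻ s, ∫⁻ t, F s t ∂ν ∂ν = ∫⁻ s, ∫⁻ t, F t s ∂ν ∂ν :=
      lintegral_lintegral_swap hFm.aemeasurable
    calc ∫⁻ s, ∫⁻ t, Q s t ∂ν ∂ν ≤ ∫⁻ s, ∫⁻ t, (F s t + F t s) ∂ν ∂ν := by
          refine lintegral_mono fun s => lintegral_mono fun t => ?_
          rcases le_total s t with h | h
          · refine le_add_right ?_
            simp only [F]
            rw [indicator_of_mem (by exact h)]
            rfl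
          · refine le_add_left ?_
            simp only [F]
            rw [indicator_of_mem (by exact h), hQs]
            rfl
      _ = ∫⁻ s, (∫⁻ t, F s t ∂ν + ∫⁻ t, F t s ∂ν) ∂ν := by
          refine lintegral_congr fun s => lintegral_add_left (hFm.comp measurable_prodMk_left) _
      _ = ∫⁻ s, ∫⁻ t, F s t ∂ν ∂ν + ∫⁻ s, ∫⁻ t, F t s ∂ν ∂ν :=
          lintegral_add_left hFm.lintegral_prod_right' _
      _ = _ := by rw [← hs, two_mul]
  have h4 : ∫⁻ s, ∫⁻ t in Ici s, Q s t ∂ν ∂ν ≤ (∫⁻ s, p s ∂ν) * J := by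
    rw [← lintegral_mul_const _ hp]
    refine lintegral_mono_ae ?_
    filter_upwards [hpair, hJ] with s hs hsJ
    calc ∫⁻ t in Ici s, Q s t ∂ν ≤ ∫⁻ t in Ici s, p s * b s t ∂ν := by
          refine lintegral_mono_ae ((ae_restrict_iff' measurableSet_Ici).2 ?_)
          filter_upwards [hs] with t ht using ht
      _ = p s * ∫⁻ t in Ici s, b s t ∂ν := lintegral_const_mul' _ _ (hpf s)
      _ ≤ p s * J := by gcongr
  have h5 : (∫⁻ ω, Z ω ∂P) ^ 2 ≤ (∫⁻ ω, Z ω ^ 2 ∂P) * P {ω | Z ω ≠ 0} := by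
    have hs : MeasurableSet {ω | Z ω ≠ 0} := hZm (measurableSet_singleton 0).compl
    have := ENNReal.lintegral_mul_le_Lp_mul_Lq P (p := (2:ℝ)) (q := (2:ℝ))
      (by rw [Real.holderConjugate_iff]; norm_num) hZm.aemeasurable
      (g := {ω | Z ω ≠ 0}.indicator (1 : Ω → ℝ≥0∞)) (measurable_one.indicator hs).aemeasurable
    have e1 : ∀ ω, (Z * {ω | Z ω ≠ 0}.indicator (1 : Ω → ℝ≥0∞)) ω = Z ω := fun ω => by
      by_cases h : Z ω = 0 <;> simp [h, indicator]
    have e2 : ∀ ω, ({ω | Z ω ≠ 0}.indicator (1 : Ω → ℝ≥0∞) ω) ^ (2 : ℝ)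
        = {ω | Z ω ≠ 0}.indicator 1 ω := fun ω => by
      by_cases h : Z ω = 0 <;> simp [h, indicator]
    simp_rw [e1, e2] at this
    rw [lintegral_indicator_one hs] at this
    calc _ ≤ _ := by exact pow_le_pow_left₀ (zero_le) this 2
      _ = _ := by
        rw [mul_pow, ← ENNReal.rpow_natCast, ← ENNReal.rpow_natCast, ← ENNReal.rpow_mul,
          ← ENNReal.rpow_mul]
        norm_num
  rw [h1]
  refine h5.trans ?_
  rw [h2]
  refine mul_le_mul_left ((h3.trans (mul_le_mul_right h4 2)).trans (le_of_eq (by ring))) _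

lemma lintegral_exp_kernel_le {c l : ℝ} (hc : 0 < c) (hl : 0 < l) (A : ℝ) (hA : 0 ≤ A) (s : ℝ) :
    ∫⁻ t in Ici s, ENNReal.ofReal (A * l * Real.exp (-(c * l * (t - s)))) ≤
      ENNReal.ofReal (A / c) := by
  have h1 : IntegrableOn (fun t => Real.exp (-(c * l) * t)) (Ioi s) :=
    integrableOn_exp_mul_Ioi (by nlinarith [mul_pos hc hl]) s
  have e : ∀ t, A * l * Real.exp (-(c * l * (t - s))) =
      (A * l * Real.exp (c * l * s)) * Real.exp (-(c * l) * t) := fun t => by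
    rw [mul_assoc (A * l), ← Real.exp_add]; ring_nf
  rw [setLIntegral_congr Ioi_ae_eq_Ici.symm, ← ofReal_integral_eq_lintegral_ofReal]
  · refine ENNReal.ofReal_le_ofReal (le_of_eq ?_)
    simp_rw [e]
    rw [integral_const_mul, integral_exp_mul_Ioi (by nlinarith [mul_pos hc hl]) s]
    have h2 : Real.exp (c * l * s) * Real.exp (-(c * l) * s) = 1 := by
      rw [← Real.exp_add]; simp
    have hcl : c * l ≠ 0 := (mul_pos hc hl).ne'
    rw [neg_div_neg_eq, mul_assoc, ← mul_div_assoc, h2]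
    field_simp
  · simp_rw [e]
    exact h1.const_mul _
  · exact Eventually.of_forall fun t => by positivity

lemma lintegral_inv_sq_kernel_le {s : ℝ} (hs : 0 < s) (B : ℝ) (hB : 0 ≤ B) :
    ∫⁻ t in Ici s, ENNReal.ofReal (B * (s / t) / t) ≤ ENNReal.ofReal B := by
  have h1 : IntegrableOn (fun t : ℝ => t ^ (-2 : ℝ)) (Ioi s) :=
    integrableOn_Ioi_rpow_of_lt (by norm_num) hs
  have e : ∀ t ∈ Ioi s, B * (s / t) / t = (B * s) * t ^ (-2 : ℝ) := fun t ht => by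
    have ht0 : 0 < t := hs.trans ht
    rw [Real.rpow_neg ht0.le, Real.rpow_two]
    field_simp
  rw [setLIntegral_congr Ioi_ae_eq_Ici.symm, ← ofReal_integral_eq_lintegral_ofReal]
  · refine ENNReal.ofReal_le_ofReal (le_of_eq ?_)
    rw [setIntegral_congr_fun measurableSet_Ioi e, integral_const_mul,
      integral_Ioi_rpow_of_lt (by norm_num) hs]
    norm_num
    rw [Real.rpow_neg_one]
    field_simp
  · exact (integrableOn_congr_fun e measurableSet_Ioi).2 (h1.const_mul _)
  · refine (ae_restrict_iff' measurableSet_Ioi).2 (Eventually.of_forall fun t ht => ?_)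
    have : 0 < t := hs.trans ht
    positivity

lemma rpow_le_mul_exp {a c x : ℝ} (ha : 0 < a) (hc : 0 < c) (hx : 0 ≤ x) :
    x ^ a ≤ (a / c) ^ a * Real.exp (c * x) := by
  have h1 : x ≤ (a / c) * Real.exp (c * x / a) := by
    have : c * x / a ≤ Real.exp (c * x / a) := by
      linarith [Real.add_one_le_exp (c * x / a)]
    calc x = (a / c) * (c * x / a) := by field_simp
      _ ≤ _ := by gcongr
  calc x ^ a ≤ ((a / c) * Real.exp (c * x / a)) ^ a := Real.rpow_le_rpow hx h1 ha.le
    _ = _ := by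
      rw [Real.mul_rpow (by positivity) (by positivity), ← Real.exp_mul, div_mul_cancel₀ _ ha.ne']

lemma exists_rpow_mul_exp_le {β c c₀ D ε p : ℝ} (hβ : 0 < β) (hc : 0 < c) (hc₀ : 0 < c₀)
    (hD : 0 < D) (hε : 0 < ε) (hp : 0 < p) :
    ∃ B : ℝ, 0 < B ∧ ∀ x r : ℝ, 0 < x → 0 < r → c₀ * x ^ (1 + p) < D * r ^ ε →
      x ^ (-(1 / β)) * Real.exp (-(c * x ^ (-(1 / β)))) ≤ B * r := by
  set k := β * (1 + p) / ε
  have hk : 0 < k := by positivity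
  refine ⟨((1 + k) / c) ^ (1 + k) * (D / c₀) ^ (1 / ε), by positivity, fun x r hx hr h => ?_⟩
  set L := x ^ (-(1 / β)) with hL
  have hL0 : 0 < L := by positivity
  have h1 := rpow_le_mul_exp (x := L) (by positivity : 0 < 1 + k) hc hL0.le
  have h2 : L * Real.exp (-(c * L)) ≤ ((1 + k) / c) ^ (1 + k) * L ^ (-k) := by
    rw [Real.exp_neg, ← div_eq_mul_inv, div_le_iff₀ (Real.exp_pos _)]
    rw [Real.rpow_add hL0, Real.rpow_one] at h1
    calc L = (L * L ^ k) * L ^ (-k) := by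
          rw [mul_assoc, ← Real.rpow_add hL0]; simp
      _ ≤ (((1 + k) / c) ^ (1 + k) * Real.exp (c * L)) * L ^ (-k) := by gcongr
      _ = _ := by ring
  refine h2.trans ?_
  rw [mul_assoc]
  gcongr
  have h3 : L ^ (-k) = (x ^ (1 + p)) ^ (1 / ε) := by
    rw [hL, ← Real.rpow_mul hx.le, ← Real.rpow_mul hx.le]
    congr 1
    simp only [k]; field_simp
  rw [h3]
  have h4 : x ^ (1 + p) ≤ (D / c₀) * r ^ ε := by
    rw [div_mul_eq_mul_div, le_div_iff₀ hc₀]; linarith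
  calc (x ^ (1 + p)) ^ (1 / ε) ≤ ((D / c₀) * r ^ ε) ^ (1 / ε) :=
        Real.rpow_le_rpow (by positivity) h4 (by positivity)
    _ = _ := by
      rw [Real.mul_rpow (by positivity) (by positivity), ← Real.rpow_mul hr.le,
        mul_one_div_cancel hε.ne', Real.rpow_one]

lemma near_kernel_le {β C c d κ s t x y : ℝ} (hβ : 0 < β) (hC : 0 < C) (hc : 0 < c) (hd : 0 < d)
    (hs : 0 < s) (hst : s ≤ t) (hts : t ≤ 2 * s) (hx : 0 < x) (hy : 0 < y)
    (hxy : x * 2 ^ (-κ) ≤ y) (hyx : y ≤ d * x) :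
    y ^ (-(1 / β)) / t * (C * Real.exp (-(c * (1 - s / t) * y ^ (-(1 / β))))) ≤
      (C * 2 ^ (κ / β)) * (x ^ (-(1 / β)) / s) *
        Real.exp (-((c / 2 * d ^ (-(1 / β))) * (x ^ (-(1 / β)) / s) * (t - s))) := by
  have ht : 0 < t := hs.trans_le hst
  have hβ' : -(1 / β) ≤ 0 := by
    have : 0 < 1 / β := by positivity
    linarith
  have h1 : y ^ (-(1 / β)) ≤ 2 ^ (κ / β) * x ^ (-(1 / β)) := by
    refine (Real.rpow_le_rpow_of_nonpos (by positivity) hxy hβ').trans (le_of_eq ?_)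
    rw [Real.mul_rpow hx.le (by positivity), ← Real.rpow_mul (by norm_num), mul_comm]
    congr 2
    ring
  have h2 : d ^ (-(1 / β)) * x ^ (-(1 / β)) ≤ y ^ (-(1 / β)) := by
    rw [← Real.mul_rpow hd.le hx.le]
    exact Real.rpow_le_rpow_of_nonpos hy hyx hβ'
  have h3 : y ^ (-(1 / β)) / t ≤ 2 ^ (κ / β) * (x ^ (-(1 / β)) / s) := by
    rw [← mul_div_assoc]
    gcongr
  have h4 : (t - s) / (2 * s) ≤ 1 - s / t := by
    rw [one_sub_div ht.ne']
    gcongr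
  have h5 : (c / 2 * d ^ (-(1 / β))) * (x ^ (-(1 / β)) / s) * (t - s) ≤
      c * (1 - s / t) * y ^ (-(1 / β)) := by
    calc (c / 2 * d ^ (-(1 / β))) * (x ^ (-(1 / β)) / s) * (t - s)
        = c * ((t - s) / (2 * s)) * (d ^ (-(1 / β)) * x ^ (-(1 / β))) := by field_simp
      _ ≤ _ := by
        have : 0 ≤ (t - s) / (2 * s) := div_nonneg (by linarith) (by positivity)
        gcongr
        exact mul_nonneg hc.le (this.trans h4)
  calc _ ≤ 2 ^ (κ / β) * (x ^ (-(1 / β)) / s) * (C * Real.exp (-((c / 2 * d ^ (-(1 / β))) *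
        (x ^ (-(1 / β)) / s) * (t - s)))) := by gcongr
    _ = _ := by ring

namespace IsSelfSimilarGaussian

variable {Ω : Type*} [MeasurableSpace Ω] {P : Measure Ω} {S : Submodule ℝ (Ω → ℝ)}
  {Y : ℝ → Ω → ℝ} {κ : ℝ}

lemma ofReal_smallBall (h : IsSelfSimilarGaussian P S Y κ) (a : ℝ) :
    ENNReal.ofReal (smallBall P Y a) = P {ω | runSup Y 1 ω ≤ a} := by
  have := h.gaussSpace.isProbabilityMeasure
  exact ENNReal.ofReal_toReal (by finiteness)

lemma measure_runSup_le (h : IsSelfSimilarGaussian P S Y κ) {t : ℝ} (ht : 0 < t) (a : ℝ) :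
    P {ω | runSup Y t ω ≤ a} = ENNReal.ofReal (smallBall P Y (a / t ^ κ)) := by
  have ht' : 0 < t ^ κ := by positivity
  rw [h.ofReal_smallBall, ← h.measure_scaling_single ht, mul_div_cancel₀ _ ht'.ne']

lemma exists_pair_bound (h : IsSelfSimilarGaussian P S Y κ) {β : ℝ} (hβ : 0 < β)
    (hnd : IsNondeterministic P Y β) (hdc : IsDecorrelated P Y) {ξ : ℝ → ℝ} {T : ℝ}
    (hξpos : ∀ t ∈ Ioc (0:ℝ) T, 0 < ξ t) (hξmono : MonotoneOn ξ (Ioc (0:ℝ) T))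
    {d : ℝ} (hd : 0 < d) (hdouble : ∀ t ∈ Ioc (0:ℝ) (T / 2), ξ (2 * t) ≤ d * ξ t)
    {p x₀ c₀ : ℝ} (hp : 0 < p) (hc₀ : 0 < c₀)
    (hbdd : ∀ t ∈ Ioc (0:ℝ) T, ξ t / t ^ κ ≤ x₀) (hκ : 0 ≤ κ)
    (hreg : ∀ x h : ℝ, 0 < x → x ≤ x₀ → 0 ≤ h → h ≤ c₀ * x ^ (1 + p) →
      smallBall P Y (x + h) ≤ Real.exp 1 * smallBall P Y x) :
    ∃ A B c E : ℝ, 0 < A ∧ 0 < B ∧ 0 < c ∧ 0 < E ∧ ∀ s t, 0 < s → s ≤ t → t ≤ T / 2 →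
      P {ω | runSup Y s ω ≤ ξ s ∧ runSup Y t ω ≤ ξ t} *
          ENNReal.ofReal ((ξ t / t ^ κ) ^ (-(1 / β)) / t) ≤
        P {ω | runSup Y s ω ≤ ξ s} *
          (ENNReal.ofReal (A * ((ξ s / s ^ κ) ^ (-(1 / β)) / s) *
              Real.exp (-(c * ((ξ s / s ^ κ) ^ (-(1 / β)) / s) * (t - s)))) +
            ENNReal.ofReal (B * (s / t) / t) +
            ENNReal.ofReal (E * ((ξ t / t ^ κ) ^ (-(1 / β)) / t *
              smallBall P Y (ξ t / t ^ κ)))) := by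
  obtain ⟨C, hC, c, hc, hnear⟩ := h.exists_near_bound hβ hnd
  obtain ⟨D, hD, ε, hε, hfar⟩ := h.exists_far_bound hdc
  obtain ⟨B, hB, hBx⟩ := exists_rpow_mul_exp_le hβ (half_pos hc) hc₀ hD hε hp
  have hφ0 : ∀ x, 0 ≤ smallBall P Y x := fun x => ENNReal.toReal_nonneg
  refine ⟨C * 2 ^ (κ / β), C * B, c / 2 * d ^ (-(1 / β)), 2 * Real.exp 1, by positivity,
    by positivity, by positivity, by positivity, fun s t hs hst htT => ?_⟩
  have ht : 0 < t := hs.trans_le hst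
  have htk : 0 < t ^ κ := by positivity
  have hsk : 0 < s ^ κ := by positivity
  have hr : 0 < s / t := by positivity
  have hr1 : s / t ≤ 1 := (div_le_one ht).2 hst
  have hξs := hξpos s ⟨hs, by linarith⟩
  have hξt := hξpos t ⟨ht, by linarith⟩
  have e1 : P {ω | runSup Y s ω ≤ ξ s ∧ runSup Y t ω ≤ ξ t} =
      P {ω | runSup Y (s / t) ω ≤ ξ s / t ^ κ ∧ runSup Y 1 ω ≤ ξ t / t ^ κ} := by
    rw [← h.measure_scaling ht hr.le zero_le_one, mul_div_cancel₀ _ htk.ne',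
      mul_div_cancel₀ _ htk.ne', mul_div_cancel₀ _ ht.ne', mul_one]
  have e2 : P {ω | runSup Y s ω ≤ ξ s} = P {ω | runSup Y (s / t) ω ≤ ξ s / t ^ κ} := by
    have := h.measure_scaling ht hr.le hr.le (ξ s / t ^ κ) (ξ s / t ^ κ)
    rw [mul_div_cancel₀ _ htk.ne', mul_div_cancel₀ _ ht.ne'] at this; simpa only [and_self] using this
  set y := ξ t / t ^ κ with hy
  have hy0 : 0 < y := by positivity
  set x := ξ s / s ^ κ with hx
  have hx0 : 0 < x := by positivity
  rw [e1, e2]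
  have n1 := hnear (s / t) (ξ s / t ^ κ) y hr.le hr1 hy0
  have f1 := hfar (s / t) (ξ s / t ^ κ) y hr hr1
  have hW : 0 ≤ y ^ (-(1 / β)) / t := by positivity
  rcases le_total t (2 * s) with hts | hts
  · refine (mul_le_mul_left n1 _).trans ?_
    rw [mul_assoc]
    refine mul_le_mul_right ?_ _
    rw [← ENNReal.ofReal_mul (by positivity), add_assoc]
    refine le_add_right (ENNReal.ofReal_le_ofReal ?_)
    rw [mul_comm]
    refine near_kernel_le hβ hC hc hd hs hst hts hx0 hy0 ?_ ?_
    · rw [hx, hy, Real.rpow_neg (by norm_num), ← div_eq_mul_inv, div_div,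
        ← Real.mul_rpow hs.le (by norm_num)]
      have := hξmono ⟨hs, by linarith⟩ ⟨ht, by linarith⟩ hst
      gcongr
      linarith
    · rw [hx, hy, ← mul_div_assoc]
      have h2s : ξ t ≤ d * ξ s :=
        (hξmono ⟨ht, by linarith⟩ ⟨by linarith, by linarith⟩ hts).trans
          (hdouble s ⟨hs, by linarith⟩)
      have : 0 < d * ξ s := by positivity
      gcongr
  · by_cases hcase : D * (s / t) ^ ε ≤ c₀ * y ^ (1 + p)
    · refine (mul_le_mul_left f1 _).trans ?_
      rw [mul_assoc]
      refine mul_le_mul_right ?_ _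
      refine le_add_left ?_
      have := hreg y (D * (s / t) ^ ε) hy0 (hbdd t ⟨ht, by linarith⟩) (by positivity) hcase
      rw [← h.ofReal_smallBall, ← ENNReal.ofReal_ofNat, ← ENNReal.ofReal_mul (by norm_num),
        ← ENNReal.ofReal_mul (mul_nonneg (by norm_num) (hφ0 _))]
      refine ENNReal.ofReal_le_ofReal ?_
      calc 2 * smallBall P Y (y + D * (s / t) ^ ε) * (y ^ (-(1 / β)) / t)
          ≤ 2 * (Real.exp 1 * smallBall P Y y) * (y ^ (-(1 / β)) / t) := by gcongr
        _ = _ := by ring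
    · push Not at hcase
      refine (mul_le_mul_left n1 _).trans ?_
      rw [mul_assoc]
      refine mul_le_mul_right ?_ _
      rw [← ENNReal.ofReal_mul (by positivity), add_assoc, add_left_comm]
      refine le_add_right (ENNReal.ofReal_le_ofReal ?_)
      have h1 := hBx y (s / t) hy0 hr hcase
      have h2 : 1 / 2 ≤ 1 - s / t := by
        have : s / t ≤ 1 / 2 := by rw [div_le_div_iff₀ ht (by norm_num)]; linarith
        linarith
      calc C * Real.exp (-(c * (1 - s / t) * y ^ (-(1 / β)))) * (y ^ (-(1 / β)) / t)
          ≤ C * Real.exp (-(c * (1 / 2) * y ^ (-(1 / β)))) * (y ^ (-(1 / β)) / t) := by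
            gcongr
        _ = C * (y ^ (-(1 / β)) * Real.exp (-(c / 2 * y ^ (-(1 / β))))) / t := by
          rw [show c * (1 / 2) = c / 2 by ring]; ring
        _ ≤ C * (B * (s / t)) / t := by gcongr
        _ = _ := by ring

end IsSelfSimilarGaussian

lemma exists_lt_measure_of_lowerClass {Ω : Type*} [MeasurableSpace Ω] {P : Measure Ω}
    [IsProbabilityMeasure P] {ξ : ℝ → ℝ} {M : ℝ → Ω → ℝ}
    (hLLC : ∀ᵐ ω ∂P, ∃ t₀ > (0:ℝ), ∀ t : ℝ, 0 < t → t < t₀ → ξ t ≤ M t ω)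
    {η : ℝ≥0∞} (hη : η < 1) :
    ∃ t₀ : ℝ, 0 < t₀ ∧ η < P {ω | ∀ t : ℝ, 0 < t → t < t₀ → ξ t ≤ M t ω} := by
  set G : ℕ → Set Ω := fun n => {ω | ∀ t : ℝ, 0 < t → t < 1 / ((n : ℝ) + 1) → ξ t ≤ M t ω} with hG
  have hmono : Monotone G := fun m n hmn ω hω t h1 h2 =>
    hω t h1 (h2.trans_le (one_div_le_one_div_of_le (by positivity) (by gcongr)))
  have h1 : P (⋃ n, G n) = 1 := by
    refine le_antisymm prob_le_one ?_
    rw [← measure_univ (μ := P)]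
    refine measure_mono_ae ?_
    filter_upwards [hLLC] with ω hω _
    obtain ⟨t₀, ht₀, h⟩ := hω
    obtain ⟨n, hn⟩ := exists_nat_one_div_lt ht₀
    exact mem_iUnion.2 ⟨n, fun t h1 h2 => h t h1 (h2.trans hn)⟩
  have h2 := tendsto_measure_iUnion_atTop (μ := P) hmono
  rw [h1] at h2
  obtain ⟨n, hn⟩ := (h2.eventually_const_lt hη).exists
  exact ⟨1 / ((n : ℝ) + 1), by positivity, hn⟩

lemma smallBall_monotone {Ω : Type*} [MeasurableSpace Ω] (P : Measure Ω) [IsFiniteMeasure P]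
    (Y : ℝ → Ω → ℝ) : Monotone (smallBall P Y) := fun _ _ hab =>
  ENNReal.toReal_mono (by finiteness) (measure_mono fun _ h => le_trans h hab)

lemma smallBall_nonneg {Ω : Type*} [MeasurableSpace Ω] (P : Measure Ω)
    (Y : ℝ → Ω → ℝ) (x : ℝ) : 0 ≤ smallBall P Y x := ENNReal.toReal_nonneg

lemma smallBall_le_one {Ω : Type*} [MeasurableSpace Ω] (P : Measure Ω) [IsProbabilityMeasure P]
    (Y : ℝ → Ω → ℝ) (x : ℝ) : smallBall P Y x ≤ 1 :=
  ENNReal.toReal_le_of_le_ofReal zero_le_one (by simpa using prob_le_one)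

lemma exists_lt_smallBall {Ω : Type*} [MeasurableSpace Ω] (P : Measure Ω) [IsProbabilityMeasure P]
    (Y : ℝ → Ω → ℝ) {q : ℝ} (hq : q < 1) : ∃ x : ℝ, 0 < x ∧ q < smallBall P Y x := by
  have h1 : Tendsto (fun n : ℕ => smallBall P Y n) atTop (𝓝 1) := by
    have := tendsto_measure_iUnion_atTop (μ := P) (s := fun n : ℕ => {ω | runSup Y 1 ω ≤ n})
      (fun m n hmn ω hω => le_trans (show runSup Y 1 ω ≤ m from hω) (by exact_mod_cast hmn))
    rw [show (⋃ n : ℕ, {ω | runSup Y 1 ω ≤ n}) = univ by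
      ext ω; simpa using exists_nat_ge (runSup Y 1 ω), measure_univ] at this
    have h2 := (ENNReal.tendsto_toReal ENNReal.one_ne_top).comp this
    rwa [ENNReal.toReal_one] at h2
  obtain ⟨n, hn⟩ := (h1.eventually_const_lt hq).exists
  exact ⟨n + 1, by positivity, hn.trans_le (smallBall_monotone P Y (by linarith))⟩

namespace IsSelfSimilarGaussian

variable {Ω : Type*} [MeasurableSpace Ω] {P : Measure Ω} {S : Submodule ℝ (Ω → ℝ)}
  {Y : ℝ → Ω → ℝ} {κ : ℝ}

lemma exists_div_rpow_le (h : IsSelfSimilarGaussian P S Y κ) (hκ : 0 ≤ κ) {ξ : ℝ → ℝ} {T : ℝ}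
    (hT : 0 < T)
    (hξpos : ∀ t ∈ Ioc (0:ℝ) T, 0 < ξ t) (hξmono : MonotoneOn ξ (Ioc (0:ℝ) T))
    (hLLC : ∀ᵐ ω ∂P, ∃ t₀ > (0:ℝ), ∀ t : ℝ, 0 < t → t < t₀ → ξ t ≤ runSup Y t ω) :
    ∃ C : ℝ, ∀ t ∈ Ioc (0:ℝ) T, ξ t / t ^ κ ≤ C := by
  have := h.gaussSpace.isProbabilityMeasure
  obtain ⟨t₀, ht₀, hG⟩ := exists_lt_measure_of_lowerClass hLLC (ENNReal.one_half_lt_one)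
  obtain ⟨R, hR, hRφ⟩ := exists_lt_smallBall P Y (q := 1 / 2) (by norm_num)
  refine ⟨max (2 * R) (ξ T / t₀ ^ κ), fun t ht => ?_⟩
  rcases lt_or_ge t t₀ with htt | htt
  · refine le_max_of_le_left ?_
    by_contra! hlt
    have ht0 := ht.1
    have htk : 0 < t ^ κ := by positivity
    have hm : MeasurableSet {ω | runSup Y t ω ≤ ξ t / 2} :=
      h.measurable_runSup ht.1.le measurableSet_Iic
    have h1 : P {ω | ∀ t : ℝ, 0 < t → t < t₀ → ξ t ≤ runSup Y t ω} ≤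
        P {ω | runSup Y t ω ≤ ξ t / 2}ᶜ := by
      refine measure_mono fun ω hω hle => ?_
      have h2 := hω t ht.1 htt
      have h3 := hξpos t ht
      have h4 : runSup Y t ω ≤ ξ t / 2 := hle
      linarith
    rw [prob_compl_eq_one_sub hm, h.measure_runSup_le ht.1] at h1
    have h2 : 1 / 2 < smallBall P Y (ξ t / 2 / t ^ κ) :=
      hRφ.trans_le (smallBall_monotone P Y (by rw [div_right_comm]; linarith))
    have h3 : (2:ℝ≥0∞)⁻¹ < 1 - ENNReal.ofReal (smallBall P Y (ξ t / 2 / t ^ κ)) := by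
      simpa using hG.trans_le h1
    rw [← ENNReal.ofReal_one, ← ENNReal.ofReal_sub _ (smallBall_nonneg _ _ _),
      ← ENNReal.ofReal_ofNat, ← ENNReal.ofReal_inv_of_pos (by norm_num),
      ENNReal.ofReal_lt_ofReal_iff_of_nonneg (by norm_num)] at h3
    linarith
  · refine le_max_of_le_right ?_
    have hξT := hξpos T ⟨hT, le_rfl⟩
    have := hξmono ht ⟨hT, le_rfl⟩ ht.2
    gcongr

end IsSelfSimilarGaussian

lemma density_le {ξ : ℝ → ℝ} {T κ β : ℝ} (hβ : 0 < β) (hκ : 0 ≤ κ)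
    (hξpos : ∀ t ∈ Ioc (0:ℝ) T, 0 < ξ t) (hξmono : MonotoneOn ξ (Ioc (0:ℝ) T)) {a t : ℝ}
    (ha : 0 < a) (hat : a ≤ t) (htT : t ≤ T) :
    (ξ t / t ^ κ) ^ (-(1 / β)) / t ≤ (ξ a / T ^ κ) ^ (-(1 / β)) / a := by
  have ht : 0 < t := ha.trans_le hat
  have hT : 0 < T := ht.trans_le htT
  have h1 := hξpos a ⟨ha, hat.trans htT⟩
  have h2 := hξmono ⟨ha, hat.trans htT⟩ ⟨ht, htT⟩ hat
  have hβ' : -(1 / β) ≤ 0 := by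
    have : 0 < 1 / β := by positivity
    linarith
  have h3 : ξ a / T ^ κ ≤ ξ t / t ^ κ := by
    have := h1.trans_le h2
    gcongr
  have := Real.rpow_le_rpow_of_nonpos (by positivity) h3 hβ'
  gcongr

namespace IsSelfSimilarGaussian

variable {Ω : Type*} [MeasurableSpace Ω] {P : Measure Ω} {S : Submodule ℝ (Ω → ℝ)}
  {Y : ℝ → Ω → ℝ} {κ : ℝ}

/-- The truncated integral is bounded by one as soon as the lower class event is likely enough. -/
lemma setLIntegral_le_one (h : IsSelfSimilarGaussian P S Y κ) {β : ℝ} (hβ : 0 < β) (hκ : 0 ≤ κ)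
    {ξ : ℝ → ℝ} {T : ℝ} (hξm : Measurable ξ)
    (hξpos : ∀ t ∈ Ioc (0:ℝ) T, 0 < ξ t) (hξmono : MonotoneOn ξ (Ioc (0:ℝ) T))
    {p x₀ c₀ : ℝ} (hc₀ : 0 < c₀)
    (hp : 0 < p) (hbdd : ∀ t ∈ Ioc (0:ℝ) T, ξ t / t ^ κ ≤ x₀)
    (hreg : ∀ x h : ℝ, 0 < x → x ≤ x₀ → 0 ≤ h → h ≤ c₀ * x ^ (1 + p) →
      smallBall P Y (x + h) ≤ Real.exp 1 * smallBall P Y x)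
    {A B c E : ℝ} (hA : 0 < A) (hB : 0 < B) (hc : 0 < c) (hE : 0 < E)
    (hpair : ∀ s t, 0 < s → s ≤ t → t ≤ T / 2 →
      P {ω | runSup Y s ω ≤ ξ s ∧ runSup Y t ω ≤ ξ t} *
          ENNReal.ofReal ((ξ t / t ^ κ) ^ (-(1 / β)) / t) ≤
        P {ω | runSup Y s ω ≤ ξ s} *
          (ENNReal.ofReal (A * ((ξ s / s ^ κ) ^ (-(1 / β)) / s) *
              Real.exp (-(c * ((ξ s / s ^ κ) ^ (-(1 / β)) / s) * (t - s)))) +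
            ENNReal.ofReal (B * (s / t) / t) +
            ENNReal.ofReal (E * ((ξ t / t ^ κ) ^ (-(1 / β)) / t *
              smallBall P Y (ξ t / t ^ κ)))))
    {q : ℝ} (hq : 0 ≤ q) (hqs : 2 * (A / c + B + E) * Real.exp 1 ^ 2 * q < 1)
    {a r t₀ : ℝ} (ha : 0 < a) (hrT : r ≤ T / 2) (hrt : r < t₀)
    (hG : ENNReal.ofReal (1 - q) ≤ P {ω | ∀ t : ℝ, 0 < t → t < t₀ → ξ t ≤ runSup Y t ω}) :
    ∫⁻ t in Ioc a r, ENNReal.ofReal ((ξ t / t ^ κ) ^ (-(1 / β)) / t) *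
      ENNReal.ofReal (smallBall P Y (ξ t / t ^ κ)) ≤ 1 := by
  have hP := h.gaussSpace.isProbabilityMeasure
  have hφm : Measurable (smallBall P Y) := (smallBall_monotone P Y).measurable
  set ψ : ℝ → ℝ := fun t => ξ t / t ^ κ with hψ
  have hψm : Measurable ψ := by fun_prop
  have hψ0 : ∀ t ∈ Ioc 0 T, 0 < ψ t := fun t ht => by
    have := ht.1
    have := hξpos t ht
    positivity
  set W : ℝ → ℝ≥0∞ := fun t => ENNReal.ofReal (ψ t ^ (-(1 / β)) / t) with hW
  have hWm : Measurable W := by fun_prop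
  set δ : ℝ → ℝ := fun t => min (ψ t / 2) (c₀ * (ψ t / 2) ^ (1 + p)) with hδ
  have hδm : Measurable δ := by fun_prop
  have hδ0 : ∀ t ∈ Ioc 0 T, 0 < δ t := fun t ht => by
    have := hψ0 t ht
    exact lt_min (by positivity) (by positivity)
  have hmem : ∀ t ∈ Ioc a r, t ∈ Ioc 0 T := fun t ht =>
    ⟨ha.trans ht.1, by have := ht.1; have := ht.2; linarith⟩
  have hW0 : ∀ t ∈ Ioc a r, W t ≠ 0 := fun t ht => by
    have h1 := hψ0 t (hmem t ht)
    have h2 := ha.trans ht.1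
    simp only [hW, ne_eq, ENNReal.ofReal_eq_zero, not_le]
    positivity
  set ν : Measure ℝ := (volume.restrict (Ioc a r)).withDensity W with hν
  have hνfin : IsFiniteMeasure ν := by
    refine isFiniteMeasure_withDensity (ne_of_lt ?_)
    calc ∫⁻ t in Ioc a r, W t ≤
        ∫⁻ t in Ioc a r, ENNReal.ofReal ((ξ a / T ^ κ) ^ (-(1 / β)) / a) := by
          refine setLIntegral_mono measurable_const fun t ht => ENNReal.ofReal_le_ofReal ?_
          exact density_le hβ hκ hξpos hξmono ha ht.1.le (hmem t ht).2
      _ < ∞ := by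
        rw [setLIntegral_const]
        exact ENNReal.mul_lt_top (by finiteness) measure_Ioc_lt_top
  have hae : ∀ᵐ t ∂ν, t ∈ Ioc a r :=
    (withDensity_absolutelyContinuous _ _).ae_le (ae_restrict_mem measurableSet_Ioc)
  set G : ℝ → ℝ := fun t => t ^ κ * (ψ t - δ t) with hGdef
  have hYm : Measurable (Function.uncurry Y) :=
    measurable_uncurry_of_continuous_of_measurable h.continuous h.measurable
  set Ev : Set (ℝ × Ω) := {x | ∀ n : ℕ, |Y (x.1 * unitSeq n) x.2| ≤ G x.1} with hEv
  have hEvm : MeasurableSet Ev := by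
    rw [show Ev = ⋂ n : ℕ, {x | |Y (x.1 * unitSeq n) x.2| ≤ G x.1} by ext; simp [hEv]]
    refine MeasurableSet.iInter fun n => measurableSet_le ?_ (by fun_prop)
    exact (hYm.comp (show Measurable fun x : ℝ × Ω => (x.1 * (unitSeq n : ℝ), x.2) by fun_prop)).norm
  have hEviff : ∀ t ∈ Ioc a r, ∀ ω, (t, ω) ∈ Ev ↔ runSup Y t ω ≤ G t := fun t ht ω =>
    (runSup_le_iff_unitSeq (h.continuous ω) (ha.trans ht.1).le _).symm
  have hGξ : ∀ t ∈ Ioc a r, G t < ξ t := fun t ht => by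
    have h1 := hδ0 t (hmem t ht)
    have h2 := ha.trans ht.1
    have h3 : 0 < t ^ κ := by positivity
    calc G t < t ^ κ * ψ t := by simp only [hGdef]; gcongr; linarith
      _ = ξ t := mul_div_cancel₀ _ h3.ne'
  set k : ℝ → ℝ → ℝ≥0∞ := fun s t =>
    ENNReal.ofReal (A * (ψ s ^ (-(1 / β)) / s) *
        Real.exp (-(c * (ψ s ^ (-(1 / β)) / s) * (t - s)))) +
      ENNReal.ofReal (B * (s / t) / t) +
      ENNReal.ofReal (E * (ψ t ^ (-(1 / β)) / t * smallBall P Y (ψ t))) with hk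
  set pr : ℝ → ℝ≥0∞ := fun t => ENNReal.ofReal (smallBall P Y (ψ t)) with hpr
  have hprm : Measurable pr := by fun_prop
  set m : ℝ≥0∞ := ∫⁻ t, pr t ∂ν with hm
  have hmtop : m ≠ ∞ := by
    refine ne_of_lt (lt_of_le_of_lt (lintegral_mono (g := fun _ => 1) fun t => ?_) ?_)
    · simpa [hpr] using smallBall_le_one P Y (ψ t)
    · simp
  have hmW : ∫⁻ t in Ioc a r, W t * pr t = m := by
    rw [hm, hν, lintegral_withDensity_eq_lintegral_mul _ hWm hprm]
    rfl
  have hJ : ∀ᵐ s ∂ν, ∫⁻ t in Ici s, k s t / W t ∂ν ≤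
      ENNReal.ofReal (A / c) + ENNReal.ofReal B + ENNReal.ofReal E * m := by
    filter_upwards [hae] with s hs
    have hs0 := ha.trans hs.1
    have hψs := hψ0 s (hmem s hs)
    rw [hν, restrict_withDensity measurableSet_Ici]
    refine (lintegral_withDensity_le_lintegral_mul _ hWm _).trans ?_
    rw [Measure.restrict_restrict measurableSet_Ici]
    calc ∫⁻ t in Ici s ∩ Ioc a r, (W * fun t => k s t / W t) t
        = ∫⁻ t in Ici s ∩ Ioc a r, k s t := by
          refine setLIntegral_congr_fun (measurableSet_Ici.inter measurableSet_Ioc) fun t ht => ?_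
          exact ENNReal.mul_div_cancel (hW0 t ht.2) ENNReal.ofReal_ne_top
      _ = (∫⁻ t in Ici s ∩ Ioc a r, ENNReal.ofReal (A * (ψ s ^ (-(1 / β)) / s) *
            Real.exp (-(c * (ψ s ^ (-(1 / β)) / s) * (t - s))))) +
          (∫⁻ t in Ici s ∩ Ioc a r, ENNReal.ofReal (B * (s / t) / t)) +
          ∫⁻ t in Ici s ∩ Ioc a r, ENNReal.ofReal (E * (ψ t ^ (-(1 / β)) / t *
            smallBall P Y (ψ t))) := by
          rw [lintegral_add_left (by fun_prop), lintegral_add_left (by fun_prop)]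
      _ ≤ _ := by
        refine add_le_add (add_le_add ?_ ?_) ?_
        · exact (lintegral_mono_set inter_subset_left).trans
            (lintegral_exp_kernel_le hc (by positivity) A hA.le s)
        · exact (lintegral_mono_set inter_subset_left).trans
            (lintegral_inv_sq_kernel_le hs0 B hB.le)
        · refine (lintegral_mono_set inter_subset_right).trans ?_
          rw [← hmW, ← lintegral_const_mul _ (by fun_prop)]
          refine lintegral_mono fun t => le_of_eq ?_
          rw [ENNReal.ofReal_mul hE.le, ENNReal.ofReal_mul' (smallBall_nonneg _ _ _)]
  have hmain := sq_lintegral_measure_le P ν hEvm hprm (fun s => ENNReal.ofReal_ne_top)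
    (b := fun s t => k s t / W t) (by
      filter_upwards [hae] with s hs
      filter_upwards [hae] with t ht hst
      rw [← mul_div_assoc, ENNReal.le_div_iff_mul_le (Or.inl (hW0 t ht))
        (Or.inl ENNReal.ofReal_ne_top)]
      have h1 := hpair s t (ha.trans hs.1) hst (ht.2.trans hrT)
      rw [h.measure_runSup_le (ha.trans hs.1)] at h1
      refine le_trans (mul_le_mul_left (measure_mono ?_) _) h1
      rintro ω ⟨h2, h3⟩
      exact ⟨((hEviff s hs ω).1 h2).trans (hGξ s hs).le, ((hEviff t ht ω).1 h3).trans (hGξ t ht).le⟩)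
    hJ
  have hlow : ENNReal.ofReal (Real.exp 1)⁻¹ * m ≤ ∫⁻ t, P {ω | (t, ω) ∈ Ev} ∂ν := by
    rw [hm, ← lintegral_const_mul _ hprm]
    refine lintegral_mono_ae ?_
    filter_upwards [hae] with t ht
    have ht0 := ha.trans ht.1
    have htk : 0 < t ^ κ := by positivity
    have h1 : {ω | (t, ω) ∈ Ev} = {ω | runSup Y t ω ≤ G t} := by
      ext ω; exact hEviff t ht ω
    rw [h1, h.measure_runSup_le ht0, ← ENNReal.ofReal_mul (by positivity)]
    refine ENNReal.ofReal_le_ofReal ?_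
    have h2 := hψ0 t (hmem t ht)
    have h3 : δ t ≤ ψ t / 2 := min_le_left _ _
    have h4 : δ t ≤ c₀ * (ψ t / 2) ^ (1 + p) := min_le_right _ _
    have h5 := hδ0 t (hmem t ht)
    have h6 := hreg (ψ t - δ t) (δ t) (by linarith) (by linarith [hbdd t (hmem t ht)]) h5.le (by
      refine h4.trans ?_
      have : ψ t / 2 ≤ ψ t - δ t := by linarith
      gcongr)
    rw [sub_add_cancel] at h6
    rw [show G t / t ^ κ = ψ t - δ t from mul_div_cancel_left₀ _ htk.ne',
      inv_mul_le_iff₀ (Real.exp_pos 1)]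
    exact h6
  have hZ : P {ω | ν {t | (t, ω) ∈ Ev} ≠ 0} ≤ ENNReal.ofReal q := by
    have hZm : MeasurableSet {ω | ν {t | (t, ω) ∈ Ev} = 0} :=
      measurable_measure_prodMk_right hEvm (measurableSet_singleton 0)
    have h1 : P {ω | ∀ t : ℝ, 0 < t → t < t₀ → ξ t ≤ runSup Y t ω} ≤
        P {ω | ν {t | (t, ω) ∈ Ev} = 0} := by
      refine measure_mono fun ω hω => ?_
      refine measure_mono_null (t := (Ioc a r)ᶜ) (fun t ht htr => ?_) hae
      have h2 := (hEviff t htr ω).1 ht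
      have h3 := hω t (ha.trans htr.1) (htr.2.trans_lt hrt)
      exact absurd (h3.trans h2) (not_le.2 (hGξ t htr))
    have h2 := hG.trans h1
    rw [show {ω | ν {t | (t, ω) ∈ Ev} ≠ 0} = {ω | ν {t | (t, ω) ∈ Ev} = 0}ᶜ from rfl,
      prob_compl_eq_one_sub hZm]
    refine (tsub_le_tsub_left h2 1).trans ?_
    rw [tsub_le_iff_right, ← ENNReal.ofReal_one]
    refine le_trans (ENNReal.ofReal_le_ofReal ?_) ENNReal.ofReal_add_le
    linarith
  have hfinal : (ENNReal.ofReal (Real.exp 1)⁻¹ * m) ^ 2 ≤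
      2 * m * (ENNReal.ofReal (A / c) + ENNReal.ofReal B + ENNReal.ofReal E * m) *
        ENNReal.ofReal q :=
    (pow_le_pow_left₀ zero_le hlow 2).trans (hmain.trans (mul_le_mul_right hZ _))
  rw [hmW]
  obtain ⟨x, hx0, hx⟩ : ∃ x : ℝ, 0 ≤ x ∧ m = ENNReal.ofReal x :=
    ⟨m.toReal, ENNReal.toReal_nonneg, (ENNReal.ofReal_toReal hmtop).symm⟩
  rw [hx] at hfinal ⊢
  rw [← ENNReal.ofReal_mul (by positivity), ← ENNReal.ofReal_pow (by positivity),
    ← ENNReal.ofReal_mul hE.le, ← ENNReal.ofReal_add (by positivity) hB.le,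
    ← ENNReal.ofReal_add (by positivity) (by positivity), ← ENNReal.ofReal_ofNat,
    ← ENNReal.ofReal_mul (by norm_num), ← ENNReal.ofReal_mul (by positivity),
    ← ENNReal.ofReal_mul (by positivity),
    ENNReal.ofReal_le_ofReal_iff (by positivity)] at hfinal
  rw [ENNReal.ofReal_le_one]
  by_contra! hx1
  have h1 : 2 * x * (A / c + B + E * x) * q ≤ x ^ 2 * (2 * (A / c + B + E) * q) := by
    have : A / c + B + E * x ≤ (A / c + B + E) * x := by
      have : 0 < A / c + B := by positivity
      nlinarith
    calc 2 * x * (A / c + B + E * x) * q ≤ 2 * x * ((A / c + B + E) * x) * q := by gcongr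
      _ = _ := by ring
  have h2 := hfinal.trans h1
  rw [mul_pow, inv_pow, mul_comm, mul_le_mul_iff_right₀ (by positivity),
    inv_le_iff_one_le_mul₀ (by positivity)] at h2
  linarith

/-- Necessity of the integral test, for a self-similar Gaussian process which is locally
nondeterministic and decorrelated and has a polynomial small ball exponent. -/
theorem lowerClass_necessity (h : IsSelfSimilarGaussian P S Y κ) {β : ℝ} (hβ : 0 < β)
    (hκ : 0 ≤ κ) (hnd : IsNondeterministic P Y β) (hdc : IsDecorrelated P Y)
    {K p : ℝ} (hK : 0 < K) (hp : 0 < p)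
    (hsb : ∀ x : ℝ, 0 < x → x ≤ 1 → Real.exp (-(K * x ^ (-p))) ≤ smallBall P Y x)
    {ξ : ℝ → ℝ} {T : ℝ} (hT : 0 < T) (hξpos : ∀ t ∈ Ioc (0:ℝ) T, 0 < ξ t)
    (hξmono : MonotoneOn ξ (Ioc (0:ℝ) T)) (hξcont : ContinuousOn ξ (Ioc (0:ℝ) T))
    (hLLC : ∀ᵐ ω ∂P, ∃ t₀ > (0:ℝ), ∀ t : ℝ, 0 < t → t < t₀ → ξ t ≤ runSup Y t ω)
    {d : ℝ} (hd : 0 < d) (hdouble : ∀ t ∈ Ioc (0:ℝ) (T / 2), ξ (2 * t) ≤ d * ξ t) :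
    (∃ C : ℝ, ∀ t ∈ Ioc (0:ℝ) T, ξ t / t ^ κ ≤ C) ∧
    ∫⁻ t in Ioc (0:ℝ) T, ENNReal.ofReal ((ξ t / t ^ κ) ^ (-(1 / β)) *
      smallBall P Y (ξ t / t ^ κ) / t) < ⊤ := by
  have hP := h.gaussSpace.isProbabilityMeasure
  obtain ⟨C, hC⟩ := h.exists_div_rpow_le hκ hT hξpos hξmono hLLC
  refine ⟨⟨C, hC⟩, ?_⟩
  set x₀ := max C 1
  have hx₀ : 0 < x₀ := by positivity
  have hbdd : ∀ t ∈ Ioc (0:ℝ) T, ξ t / t ^ κ ≤ x₀ := fun t ht => (hC t ht).trans (le_max_left _ _)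
  have hφpos : ∀ x, 0 < x → 0 < smallBall P Y x := fun x hx =>
    (Real.exp_pos _).trans_le ((hsb (min x 1) (by positivity) (min_le_right _ _)).trans
      (smallBall_monotone P Y (min_le_left _ _)))
  obtain ⟨c₀, hc₀, hreg⟩ := le_exp_one_mul_of_midpoint_logConcave hφpos (smallBall_monotone P Y)
    (smallBall_le_one P Y) h.smallBall_mul_le hK hp hsb x₀ hx₀
  obtain ⟨A, B, c, E, hA, hB, hc, hE, hpair⟩ :=
    h.exists_pair_bound hβ hnd hdc hξpos hξmono hd hdouble hp hc₀ hbdd hκ hreg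
  set F := 2 * (A / c + B + E) * Real.exp 1 ^ 2 with hF
  have hF0 : 0 < F := by positivity
  set q := (2 * F)⁻¹ with hq
  have hq0 : 0 < q := by positivity
  have hFq : F * q < 1 := by
    rw [hq, mul_inv, mul_left_comm, mul_inv_cancel₀ hF0.ne']; norm_num
  obtain ⟨t₀, ht₀, hG⟩ := exists_lt_measure_of_lowerClass hLLC (η := ENNReal.ofReal (1 - q)) (by
    rw [ENNReal.ofReal_lt_one]; linarith)
  set r := min (T / 2) (t₀ / 2) with hr
  have hr0 : 0 < r := by positivity
  have hrT : r ≤ T / 2 := min_le_left _ _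
  have hrt : r < t₀ := (min_le_right _ _).trans_lt (by linarith)
  set ξ' : ℝ → ℝ := (Ioc 0 T).indicator ξ with hξ'
  have hξ'm : Measurable ξ' := by
    classical
    rw [hξ', ← Set.piecewise_eq_indicator]
    exact hξcont.measurable_piecewise continuousOn_const measurableSet_Ioc
  have hξe : ∀ t ∈ Ioc 0 T, ξ' t = ξ t := fun t ht => indicator_of_mem ht _
  set g : ℝ → ℝ≥0∞ := fun t => ENNReal.ofReal ((ξ' t / t ^ κ) ^ (-(1 / β)) / t) *
      ENNReal.ofReal (smallBall P Y (ξ' t / t ^ κ)) with hg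
  have hge : ∫⁻ t in Ioc (0:ℝ) T, ENNReal.ofReal ((ξ t / t ^ κ) ^ (-(1 / β)) *
      smallBall P Y (ξ t / t ^ κ) / t) = ∫⁻ t in Ioc (0:ℝ) T, g t := by
    refine setLIntegral_congr_fun measurableSet_Ioc fun t ht => ?_
    simp only [hg]
    rw [hξe t ht, ← ENNReal.ofReal_mul' (smallBall_nonneg _ _ _), div_mul_eq_mul_div]
  have h1 : ∀ a, 0 < a → ∫⁻ t in Ioc a r, g t ≤ 1 := by
    intro a ha
    refine h.setLIntegral_le_one hβ hκ (T := T) hξ'm (fun t ht => ?_) (fun s hs t ht hst => ?_) hc₀ hp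
      (x₀ := x₀) (fun t ht => ?_) hreg hA hB hc hE (fun s t hs hst htT => ?_) hq0.le hFq ha hrT hrt
      (hG.le.trans (measure_mono fun ω hω t h1 h2 => ?_))
    · rw [hξe t ht]; exact hξpos t ht
    · rw [hξe t ht, hξe s hs]; exact hξmono hs ht hst
    · rw [hξe t ht]; exact hbdd t ht
    · rw [hξe t ⟨by linarith, by linarith⟩, hξe s ⟨by linarith, by linarith⟩]
      exact hpair s t hs hst htT
    · by_cases ht : t ∈ Ioc 0 T
      · rw [hξe t ht]; exact hω t h1 h2
      · rw [hξ', indicator_of_notMem ht]; exact runSup_nonneg _ _ _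
  have h2 : ∫⁻ t in Ioc 0 r, g t ≤ 1 := by
    have hmono : Monotone fun n : ℕ => Ioc (1 / ((n : ℝ) + 1)) r := fun m n hmn =>
      Ioc_subset_Ioc_left (one_div_le_one_div_of_le (by positivity) (by gcongr))
    have hU : Ioc 0 r = ⋃ n : ℕ, Ioc (1 / ((n : ℝ) + 1)) r := by
      ext t
      simp only [mem_iUnion, mem_Ioc]
      constructor
      · rintro ⟨h1, h2⟩
        obtain ⟨n, hn⟩ := exists_nat_one_div_lt h1
        exact ⟨n, hn, h2⟩
      · rintro ⟨n, hn, h2⟩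
        exact ⟨lt_trans (by positivity) hn, h2⟩
    rw [← withDensity_apply _ measurableSet_Ioc, hU, hmono.measure_iUnion]
    refine iSup_le fun n => ?_
    rw [withDensity_apply _ measurableSet_Ioc]
    exact h1 _ (by positivity)
  have h3 : ∫⁻ t in Ioc r T, g t < ∞ := by
    calc ∫⁻ t in Ioc r T, g t ≤
        ∫⁻ t in Ioc r T, ENNReal.ofReal ((ξ r / T ^ κ) ^ (-(1 / β)) / r) := by
          refine setLIntegral_mono measurable_const fun t ht => ?_
          simp only [hg]
          rw [hξe t ⟨hr0.trans ht.1, ht.2⟩]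
          refine (mul_le_of_le_one_right' ?_).trans (ENNReal.ofReal_le_ofReal
            (density_le hβ hκ hξpos hξmono hr0 ht.1.le ht.2))
          simpa using smallBall_le_one P Y _
      _ < ∞ := by
        rw [setLIntegral_const]
        exact ENNReal.mul_lt_top (by finiteness) measure_Ioc_lt_top
  rw [hge, ← Ioc_union_Ioc_eq_Ioc hr0.le (by linarith)]
  exact (lintegral_union_le _ _ _).trans_lt (ENNReal.add_lt_top.2
    ⟨h2.trans_lt ENNReal.one_lt_top, h3⟩)

end IsSelfSimilarGaussian

/-- The pointwise sequential limits of elements of a linear space of functions. -/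
def limitSpace {Ω : Type*} (S : Submodule ℝ (Ω → ℝ)) : Submodule ℝ (Ω → ℝ) where
  carrier := {f | ∃ g : ℕ → Ω → ℝ, (∀ n, g n ∈ S) ∧ ∀ ω, Tendsto (fun n => g n ω) atTop (𝓝 (f ω))}
  add_mem' := by
    rintro f f' ⟨g, hg, hgt⟩ ⟨g', hg', hgt'⟩
    exact ⟨fun n => g n + g' n, fun n => S.add_mem (hg n) (hg' n), fun ω => (hgt ω).add (hgt' ω)⟩
  zero_mem' := ⟨fun _ => 0, fun _ => S.zero_mem, fun _ => tendsto_const_nhds⟩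
  smul_mem' := by
    rintro c f ⟨g, hg, hgt⟩
    exact ⟨fun n => c • g n, fun n => S.smul_mem c (hg n), fun ω => (hgt ω).const_mul c⟩

lemma le_limitSpace {Ω : Type*} (S : Submodule ℝ (Ω → ℝ)) : S ≤ limitSpace S :=
  fun f hf => ⟨fun _ => f, fun _ => hf, fun _ => tendsto_const_nhds⟩

lemma tendsto_charFun_map {Ω : Type*} [MeasurableSpace Ω] {P : Measure Ω} [IsProbabilityMeasure P]
    {g : ℕ → Ω → ℝ} {f : Ω → ℝ} (hg : ∀ n, Measurable (g n)) (hf : Measurable f)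
    (h : ∀ ω, Tendsto (fun n => g n ω) atTop (𝓝 (f ω))) (x : ℝ) :
    Tendsto (fun n => charFun (P.map (g n)) x) atTop (𝓝 (charFun (P.map f) x)) := by
  have key : ∀ {f : Ω → ℝ}, Measurable f →
      charFun (P.map f) x = ∫ ω, Complex.exp (x * f ω * Complex.I) ∂P := by
    intro f hf
    rw [charFun_apply_real, integral_map hf.aemeasurable (by fun_prop)]
  rw [key hf]
  simp_rw [key (hg _)]
  refine tendsto_integral_of_dominated_convergence (fun _ => 1) (fun n => ?_)
    (integrable_const _) (fun n => .of_forall fun ω => ?_) (.of_forall fun ω => ?_)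
  · have := hg n
    fun_prop
  · rw [← Complex.ofReal_mul, Complex.norm_exp_ofReal_mul_I]
  · have : Continuous fun y : ℝ => Complex.exp (x * y * Complex.I) := by fun_prop
    exact (this.tendsto _).comp (h ω)

/-- Pointwise limits of centered Gaussian variables form a Gaussian space. -/
lemma IsGaussSpace.limitSpace {Ω : Type*} [MeasurableSpace Ω] {P : Measure Ω}
    {S : Submodule ℝ (Ω → ℝ)} (hS : IsGaussSpace P S) : IsGaussSpace P (limitSpace S) := by
  have := hS.isProbabilityMeasure
  have hm : ∀ f ∈ _root_.limitSpace S, Measurable f := by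
    rintro f ⟨g, hg, hgt⟩
    exact measurable_of_tendsto_metrizable (fun n => hS.measurable _ (hg n))
      (tendsto_pi_nhds.2 hgt)
  refine ⟨hm, ?_⟩
  rintro f hf
  have hfm := hm f hf
  obtain ⟨g, hg, hgt⟩ := hf
  choose v hv using fun n => hS.gauss (g n) (hg n)
  have hlim := tendsto_charFun_map (P := P) (fun n => hS.measurable _ (hg n)) hfm hgt
  have hprob : IsProbabilityMeasure (P.map f) := Measure.isProbabilityMeasure_map hfm.aemeasurable
  have hval : ∀ n (x : ℝ), charFun (P.map (g n)) x = ((exp (-(v n / 2)) ^ (x ^ 2 : ℝ) : ℝ) : ℂ) := by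
    intro n x
    rw [hv, charFun_gaussianReal, ← exp_mul]
    push_cast
    congr 1
    ring
  simp_rw [hval] at hlim
  set z := (charFun (P.map f) 1).re with hz
  have hzt : Tendsto (fun n => exp (-(v n / 2 : ℝ))) atTop (𝓝 z) := by
    have := (Complex.continuous_re.tendsto _).comp (hlim 1)
    simpa only [Function.comp_def, one_pow, one_rpow, rpow_one, Complex.ofReal_re, hz] using this
  have hz0 : 0 ≤ z := ge_of_tendsto' hzt fun n => (exp_pos _).le
  have hch : ∀ x : ℝ, x ≠ 0 → charFun (P.map f) x = ((z ^ (x ^ 2 : ℝ) : ℝ) : ℂ) := by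
    intro x hx
    refine tendsto_nhds_unique (hlim x) ?_
    refine (Complex.continuous_ofReal.tendsto _).comp ?_
    exact hzt.rpow_const (Or.inr (by positivity))
  have hzpos : 0 < z := by
    refine lt_of_le_of_ne hz0 fun h0 => ?_
    have h1 := tendsto_charFun_map (P := P) (g := fun n ω => (1 / ((n : ℝ) + 1)) * f ω)
      (f := fun _ => 0) (fun n => by fun_prop) measurable_const
      (fun ω => by simpa using (tendsto_one_div_add_atTop_nhds_zero_nat (𝕜 := ℝ)).mul_const (f ω)) 1
    have h2 : charFun (P.map fun _ : Ω => (0:ℝ)) 1 = 1 := by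
      rw [charFun_apply_real, integral_map (by fun_prop) (by fun_prop)]
      simp
    rw [h2] at h1
    have h3 : ∀ n : ℕ, charFun (P.map fun ω => (1 / ((n : ℝ) + 1)) * f ω) 1 = 0 := by
      intro n
      have hne : (1 / ((n : ℝ) + 1)) ≠ 0 := by positivity
      have := hch _ hne
      rw [← h0, zero_rpow (by positivity)] at this
      rw [charFun_apply_real, integral_map (by fun_prop) (by fun_prop)] at this ⊢
      rw [Complex.ofReal_zero] at this
      rw [← this]
      congr 1
      ext ω
      push_cast
      ring_nf
    simp_rw [h3] at h1
    exact zero_ne_one (tendsto_nhds_unique tendsto_const_nhds h1)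
  have hz1 : z ≤ 1 := le_of_tendsto' hzt fun n => exp_le_one_iff.2 (by
    have : (0:ℝ) ≤ v n := (v n).2
    linarith)
  refine ⟨(-2 * log z).toNNReal, Measure.ext_of_charFun (funext fun x => ?_)⟩
  rw [charFun_gaussianReal]
  rcases eq_or_ne x 0 with rfl | hx
  · simp
  have hl : 0 ≤ -2 * log z := by have := log_nonpos hz0 hz1; linarith
  rw [hch x hx, rpow_def_of_pos hzpos, Real.coe_toNNReal _ hl]
  push_cast
  congr 1
  ring

/-- A Riesz representation criterion: prescribed inner products with a family of vectors. -/
lemma exists_inner_eq {E ι : Type*} [NormedAddCommGroup E] [InnerProductSpace ℝ E]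
    [CompleteSpace E] (x : ι → E) (b : ι → ℝ) {D : ℝ} (hD : 0 ≤ D)
    (h : ∀ c : ι →₀ ℝ, |c.sum fun i a => a * b i| ≤ D * ‖c.sum fun i a => a • x i‖) :
    ∃ N : E, ‖N‖ ≤ D ∧ ∀ i, inner ℝ (x i) N = b i := by
  set A := Finsupp.linearCombination ℝ x
  set B := Finsupp.linearCombination ℝ b
  have hAB : ∀ c, |B c| ≤ D * ‖A c‖ := by
    intro c
    have := h c
    simpa [A, B, Finsupp.linearCombination_apply] using this
  obtain ⟨G, hG⟩ := A.rangeRestrict.exists_rightInverse_of_surjective A.range_rangeRestrict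
  have hG' : ∀ y, A (G y) = y := fun y => congrArg Subtype.val (LinearMap.congr_fun hG y)
  have hle : ∀ y : A.range, ‖(B ∘ₗ G) y‖ ≤ D * ‖y‖ := by
    intro y
    have := hAB (G y)
    rwa [hG'] at this
  obtain ⟨L, hL, hLn⟩ := exists_extension_norm_eq A.range ((B ∘ₗ G).mkContinuous D hle)
  refine ⟨(InnerProductSpace.toDual ℝ E).symm L, ?_, fun i => ?_⟩
  · rw [LinearIsometryEquiv.norm_map, hLn]
    exact LinearMap.mkContinuous_norm_le _ hD _
  · rw [real_inner_comm, InnerProductSpace.toDual_symm_apply]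
    have hx : A (Finsupp.single i 1) = x i := by simp [A]
    have h1 := hL (A.rangeRestrict (Finsupp.single i 1))
    have h2 : L (x i) = B (G (A.rangeRestrict (Finsupp.single i 1))) := by
      rw [← hx]; exact h1
    rw [h2]
    have h3 := hAB (G (A.rangeRestrict (Finsupp.single i 1)) - Finsupp.single i 1)
    rw [map_sub, map_sub, hG'] at h3
    rw [show ((A.rangeRestrict (Finsupp.single i 1) : A.range) : E) = A (Finsupp.single i 1) from rfl,
      sub_self, norm_zero, mul_zero] at h3
    have h4 := sub_eq_zero.1 (abs_nonpos_iff.1 h3)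
    rw [h4]
    simp [B]

/-- Riemann sums of a continuous function converge. -/
lemma tendsto_riemannSum {f : ℝ → ℝ} (hf : Continuous f) :
    Tendsto (fun n : ℕ => ∑ k ∈ Finset.range (n + 1), ((n : ℝ) + 1)⁻¹ * f (k / ((n : ℝ) + 1))) atTop
      (𝓝 (∫ x in (0:ℝ)..1, f x)) := by
  have huc := isCompact_Icc.uniformContinuousOn_of_continuous (hf.continuousOn (s := Icc (0:ℝ) 1))
  rw [Metric.uniformContinuousOn_iff] at huc
  rw [Metric.tendsto_atTop]
  intro ε hε
  obtain ⟨δ, hδ, h⟩ := huc (ε / 2) (by positivity)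
  obtain ⟨N, hN⟩ := exists_nat_gt δ⁻¹
  refine ⟨N, fun n hn => ?_⟩
  set m : ℝ := (n : ℝ) + 1 with hm
  have hmpos : 0 < m := by positivity
  have hmδ : m⁻¹ < δ := by
    have : δ⁻¹ < m := hN.trans_le (by
      have : (N:ℝ) ≤ n := by exact_mod_cast hn
      linarith)
    exact inv_lt_of_inv_lt₀ hδ this
  have hsum : ∫ x in (0:ℝ)..1, f x =
      ∑ k ∈ Finset.range (n + 1), ∫ x in ((k : ℕ) : ℝ) / m..((k + 1 : ℕ) : ℝ) / m, f x := by
    rw [intervalIntegral.sum_integral_adjacent_intervals (a := fun k : ℕ => (k : ℝ) / m)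
      (fun k _ => hf.intervalIntegrable _ _)]
    have : ((n + 1 : ℕ) : ℝ) / m = 1 := by rw [hm]; push_cast; field_simp
    rw [this]; simp
  rw [hsum, dist_eq_norm, ← Finset.sum_sub_distrib]
  have hterm : ∀ k ∈ Finset.range (n + 1),
      ‖m⁻¹ * f (k / m) - ∫ x in ((k : ℕ) : ℝ) / m..((k + 1 : ℕ) : ℝ) / m, f x‖ ≤ m⁻¹ * (ε / 2) := by
    intro k hk
    have hlen : ((k + 1 : ℕ) : ℝ) / m - (k : ℝ) / m = m⁻¹ := by push_cast; field_simp; ring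
    have hk1 : ((k + 1 : ℕ) : ℝ) / m ≤ 1 := by
      rw [div_le_one hmpos, hm]
      have := Finset.mem_range.1 hk
      exact_mod_cast this
    have h0 : (0:ℝ) ≤ k / m := by positivity
    have : m⁻¹ * f (k / m) = ∫ _ in ((k : ℕ) : ℝ) / m..((k + 1 : ℕ) : ℝ) / m, f (k / m) := by
      rw [intervalIntegral.integral_const, hlen, smul_eq_mul]
    rw [this, ← intervalIntegral.integral_sub (by simp) (hf.intervalIntegrable _ _)]
    have hle : (k : ℝ) / m ≤ ((k + 1 : ℕ) : ℝ) / m := by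
      have : 0 < m⁻¹ := by positivity
      linarith
    have := intervalIntegral.norm_integral_le_of_norm_le_const (a := (k : ℝ) / m)
      (b := ((k + 1 : ℕ) : ℝ) / m) (f := fun x => f (k / m) - f x) (C := ε / 2) (by
        intro x hx
        rw [uIoc_of_le hle] at hx
        rw [← dist_eq_norm]
        refine (h _ ⟨h0, hle.trans hk1⟩ _ ⟨h0.trans hx.1.le, hx.2.trans hk1⟩ ?_).le
        rw [dist_comm, Real.dist_eq, abs_of_nonneg (by linarith [hx.1])]
        linarith [hx.2])
    refine this.trans (le_of_eq ?_)
    rw [hlen, abs_of_pos (by positivity)]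
    ring
  refine (norm_sum_le_of_le _ hterm).trans_lt ?_
  rw [Finset.sum_const, Finset.card_range, nsmul_eq_mul]
  have : ((n + 1 : ℕ) : ℝ) = m := by rw [hm]; push_cast; ring
  rw [this, ← mul_assoc, mul_inv_cancel₀ hmpos.ne']
  linarith

lemma abs_integral_mul_le_sqrt {X : Type*} [MeasurableSpace X] {μ : Measure X} {f g : X → ℝ}
    (hf : MemLp f 2 μ) (hg : MemLp g 2 μ) :
    |∫ x, f x * g x ∂μ| ≤ √(∫ x, f x ^ 2 ∂μ) * √(∫ x, g x ^ 2 ∂μ) := by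
  have key : ∀ {f g : X → ℝ} (hf : MemLp f 2 μ) (hg : MemLp g 2 μ),
      inner ℝ (hf.toLp f) (hg.toLp g) = ∫ x, f x * g x ∂μ := by
    intro f g hf hg
    rw [L2.inner_def]
    refine integral_congr_ae ?_
    filter_upwards [hf.coeFn_toLp, hg.coeFn_toLp] with x h1 h2
    rw [h1, h2]
    simp [mul_comm]
  have hn : ∀ {f : X → ℝ} (hf : MemLp f 2 μ), ‖hf.toLp f‖ = √(∫ x, f x ^ 2 ∂μ) := by
    intro f hf
    rw [norm_eq_sqrt_real_inner, key]
    simp_rw [sq]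
  rw [← key hf hg, ← hn hf, ← hn hg]
  exact abs_real_inner_le_norm _ _

lemma integrableOn_Ioo_rpow {a : ℝ} (ha : -1 < a) (b : ℝ) :
    IntegrableOn (fun x : ℝ => x ^ a) (Ioo 0 b) := by
  rcases le_total 0 b with hb | hb
  · have := (intervalIntegral.intervalIntegrable_rpow' (a := 0) (b := b) ha)
    rw [intervalIntegrable_iff_integrableOn_Ioo_of_le hb] at this
    exact this
  · simp [Ioo_eq_empty_of_le hb]

lemma integral_Ioo_rpow {a b : ℝ} (ha : -1 < a) (hb : 0 ≤ b) :
    ∫ x in Ioo 0 b, x ^ a = b ^ (a + 1) / (a + 1) := by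
  rw [← integral_Ioc_eq_integral_Ioo, ← intervalIntegral.integral_of_le hb,
    integral_rpow (Or.inl ha), zero_rpow (by linarith), sub_zero]

lemma integrableOn_rpow_div_add_sq {a q : ℝ} (ha : -1 < a) (ha1 : a < 1) (hq : 0 < q) :
    IntegrableOn (fun y : ℝ => y ^ a / (y + q) ^ 2) (Ioi 0) := by
  have hsplit : Ioi (0:ℝ) = Ioo 0 1 ∪ Ici 1 := by
    rw [Ioo_union_Ici_eq_Ioi zero_lt_one]
  have hm : Measurable fun y : ℝ => y ^ a / (y + q) ^ 2 := by fun_prop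
  rw [hsplit]
  refine IntegrableOn.union ?_ ?_
  · refine Integrable.mono' ((integrableOn_Ioo_rpow ha 1).const_mul (q ^ 2)⁻¹)
      hm.aestronglyMeasurable ?_
    refine (ae_restrict_iff' measurableSet_Ioo).2 (.of_forall fun y hy => ?_)
    have hy0 := hy.1
    rw [norm_of_nonneg (by positivity), div_eq_mul_inv, mul_comm]
    gcongr
    linarith
  · rw [integrableOn_Ici_iff_integrableOn_Ioi]
    refine Integrable.mono' (integrableOn_Ioi_rpow_of_lt (a := a - 2) (by linarith) zero_lt_one)
      hm.aestronglyMeasurable ?_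
    refine (ae_restrict_iff' measurableSet_Ioi).2 (.of_forall fun y hy => ?_)
    have hy0 : 0 < y := zero_lt_one.trans hy
    rw [norm_of_nonneg (by positivity), rpow_sub hy0, rpow_two]
    gcongr
    linarith

/-- The constant `∫₀^∞ y^{-α} (1+y)^{-2} dy`. -/
noncomputable def abelConst (α : ℝ) : ℝ := ∫ y in Ioi (0:ℝ), y ^ (-α) / (y + 1) ^ 2

lemma abelConst_pos {α : ℝ} (h1 : -1 < α) (h2 : α < 1) : 0 < abelConst α := by
  rw [abelConst, setIntegral_pos_iff_support_of_nonneg_ae]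
  · have : Ioi (0:ℝ) ⊆ Function.support fun y : ℝ => y ^ (-α) / (y + 1) ^ 2 := by
      intro y hy
      have : (0:ℝ) < y := hy
      exact (by positivity : (0:ℝ) < y ^ (-α) / (y + 1) ^ 2).ne'
    rw [inter_eq_right.2 this]
    simp
  · refine (ae_restrict_iff' measurableSet_Ioi).2 (.of_forall fun y hy => ?_)
    have : (0:ℝ) < y := hy
    simp only [Pi.zero_apply]
    positivity
  · exact integrableOn_rpow_div_add_sq (by linarith) (by linarith) one_pos

lemma integral_rpow_div_add_sq {α q : ℝ} (hq : 0 < q) :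
    ∫ y in Ioi (0:ℝ), y ^ (-α) / (y + q) ^ 2 = q ^ (-α - 1) * abelConst α := by
  have h := integral_comp_mul_left_Ioi (fun y : ℝ => y ^ (-α) / (y + q) ^ 2) 0 hq
  rw [mul_zero] at h
  have h2 : ∫ y in Ioi (0:ℝ), y ^ (-α) / (y + q) ^ 2 =
      q * ∫ y in Ioi (0:ℝ), (q * y) ^ (-α) / (q * y + q) ^ 2 := by
    rw [h, smul_eq_mul, mul_inv_cancel_left₀ hq.ne']
  rw [h2, abelConst, ← integral_const_mul, ← integral_const_mul]
  refine setIntegral_congr_fun measurableSet_Ioi fun y hy => ?_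
  have hy' : (0:ℝ) < y := hy
  rw [mul_rpow hq.le hy'.le, rpow_sub_one hq.ne']
  field_simp

lemma integral_rpow_mul_sub {α p : ℝ} (h0 : α ≠ 0) (h1 : -1 < α) (h2 : α < 1) (hp : 0 < p)
    (hp1 : p ≤ 1) :
    ∫ y in Ioi (0:ℝ), y ^ (-α) * ((y + p)⁻¹ - (y + 1)⁻¹) = abelConst α * ((p ^ (-α) - 1) / α) := by
  have hinner : ∀ y ∈ Ioi (0:ℝ), y ^ (-α) * ((y + p)⁻¹ - (y + 1)⁻¹) =
      ∫ q in Ioc p 1, y ^ (-α) / (y + q) ^ 2 := by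
    intro y hy
    have hy' : (0:ℝ) < y := hy
    rw [← intervalIntegral.integral_of_le hp1]
    have hd : ∀ q ∈ uIcc p 1, HasDerivAt (fun q => -(y ^ (-α) * (y + q)⁻¹))
        (y ^ (-α) / (y + q) ^ 2) q := by
      intro q hq
      rw [uIcc_of_le hp1] at hq
      have hne : y + q ≠ 0 := by have := hp.trans_le hq.1; positivity
      have := ((((hasDerivAt_id q).const_add y).inv hne).const_mul (y ^ (-α))).neg
      refine HasDerivAt.congr_deriv this ?_
      simp only [id]
      ring
    rw [intervalIntegral.integral_eq_sub_of_hasDerivAt hd]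
    · ring
    · refine ContinuousOn.intervalIntegrable fun q hq => ContinuousAt.continuousWithinAt ?_
      rw [uIcc_of_le hp1] at hq
      have hne : y + q ≠ 0 := by have := hp.trans_le hq.1; positivity
      fun_prop (disch := positivity)
  rw [setIntegral_congr_fun measurableSet_Ioi hinner, integral_integral_swap]
  · have hq : ∀ q ∈ Ioc p 1, ∫ y in Ioi (0:ℝ), y ^ (-α) / (y + q) ^ 2 =
        q ^ (-α - 1) * abelConst α := fun q hq => integral_rpow_div_add_sq (hp.trans hq.1)
    rw [setIntegral_congr_fun measurableSet_Ioc hq, integral_mul_const,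
      ← intervalIntegral.integral_of_le hp1, integral_rpow, one_rpow]
    · have : -α - 1 + 1 = -α := by ring
      rw [this]
      field_simp
      ring
    · refine Or.inr ⟨fun h => h0 (by linarith), ?_⟩
      rw [uIcc_of_le hp1]
      exact fun h => absurd h.1 (by linarith)
  · have hi := (integrableOn_rpow_div_add_sq (a := -α) (by linarith) (by linarith) hp)
    refine Integrable.mono' (hi.comp_fst (volume.restrict (Ioc p 1))) ?_ ?_
    · have : Measurable (Function.uncurry fun y q : ℝ => y ^ (-α) / (y + q) ^ 2) := by
        unfold Function.uncurry
        fun_prop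
      exact this.aestronglyMeasurable
    · rw [Measure.prod_restrict]
      refine (ae_restrict_iff' (measurableSet_Ioi.prod measurableSet_Ioc)).2
        (.of_forall fun z hz => ?_)
      obtain ⟨y, q⟩ := z
      have hy : (0:ℝ) < y := hz.1
      have hq : p < q := hz.2.1
      have hq0 : 0 < q := hp.trans hq
      simp only [Function.uncurry]
      rw [norm_of_nonneg (by positivity)]
      gcongr

/-- An Abel type inversion formula. -/
lemma integral_abel {α r w : ℝ} (h0 : α ≠ 0) (h1 : -1 < α) (h2 : α < 1) (hr : 0 < r) (hw : 0 < w) :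
    ∫ x in Ioo 0 r, (r - x) ^ α * (x ^ (-α) / (w + x)) =
      abelConst α / α * ((1 + r / w) ^ α - 1) := by
  set f : ℝ → ℝ := fun y => r * y / (1 + y)
  have himg : f '' Ioi 0 = Ioo 0 r := by
    ext x
    constructor
    · rintro ⟨y, hy, rfl⟩
      have hy' : (0:ℝ) < y := hy
      refine ⟨by simp only [f]; positivity, ?_⟩
      simp only [f]
      rw [div_lt_iff₀ (by positivity)]
      linarith
    · intro hx
      have h3 : 0 < r - x := sub_pos.2 hx.2
      refine ⟨x / (r - x), div_pos hx.1 h3, ?_⟩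
      simp only [f]
      rw [show 1 + x / (r - x) = r / (r - x) by field_simp; ring]
      field_simp
  have hder : ∀ y ∈ Ioi (0:ℝ), HasDerivWithinAt f (r / (1 + y) ^ 2) (Ioi 0) y := by
    intro y hy
    have hy' : (0:ℝ) < y := hy
    have := ((hasDerivAt_id y).const_mul r).div ((hasDerivAt_id y).const_add 1)
      (by simp only [id]; positivity)
    refine (HasDerivAt.congr_deriv this ?_).hasDerivWithinAt
    simp only [id]
    ring
  have hinj : InjOn f (Ioi 0) := by
    intro y hy z hz hyz
    have hy' : (0:ℝ) < y := hy
    have hz' : (0:ℝ) < z := hz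
    simp only [f] at hyz
    rw [div_eq_div_iff (by positivity) (by positivity)] at hyz
    have : r * (y - z) = 0 := by linarith
    have := (mul_eq_zero.1 this).resolve_left hr.ne'
    linarith
  rw [← himg, integral_image_eq_integral_abs_deriv_smul measurableSet_Ioi hder hinj]
  have hp : 0 < w / (r + w) := by positivity
  have hp1 : w / (r + w) ≤ 1 := by rw [div_le_one (by positivity)]; linarith
  have key := integral_rpow_mul_sub h0 h1 h2 hp hp1
  have hrw : (w / (r + w)) ^ (-α) = (1 + r / w) ^ α := by
    rw [rpow_neg hp.le, ← inv_rpow hp.le]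
    congr 1
    field_simp
    ring
  rw [hrw] at key
  rw [show abelConst α / α * ((1 + r / w) ^ α - 1) = abelConst α * (((1 + r / w) ^ α - 1) / α) by ring,
    ← key]
  refine setIntegral_congr_fun measurableSet_Ioi fun y hy => ?_
  have hy' : (0:ℝ) < y := hy
  have e1 : r - r * y / (1 + y) = r * y / (1 + y) * y⁻¹ := by
    field_simp; ring
  simp only [f, smul_eq_mul]
  rw [e1, mul_rpow (by positivity) (by positivity), rpow_neg (by positivity) (x := r * y / (1 + y)),
    inv_rpow hy'.le, rpow_neg hy'.le, abs_of_pos (by positivity)]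
  have : (r * y / (1 + y)) ^ α ≠ 0 := (rpow_pos_of_pos (by positivity) _).ne'
  have : y ^ α ≠ 0 := (rpow_pos_of_pos hy' _).ne'
  have : y + w / (r + w) ≠ 0 := by positivity
  have : w + r * y / (1 + y) ≠ 0 := by positivity
  have : y * (r + w) + w ≠ 0 := by positivity
  have : w * (1 + y) + r * y ≠ 0 := by positivity
  field_simp
  ring

/-- Admissible parameters of a nondegenerate generalized fractional Brownian motion. -/
structure GFBMParam (α γ : ℝ) : Prop where
  ne_zero : α ≠ 0
  nonneg : 0 ≤ γ
  lt_one : γ < 1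
  gt : -1 / 2 + γ / 2 < α
  lt : α < 1 / 2

/-- The integration kernel of the generalized fractional Brownian motion. -/
noncomputable def gfbmKernel (α γ v u : ℝ) : ℝ :=
  ((max (v - u) 0) ^ α - (max (-u) 0) ^ α) * |u| ^ (-γ / 2)

lemma gfbmCov_eq (α γ s t : ℝ) : gfbmCov α γ s t = ∫ u, gfbmKernel α γ s u * gfbmKernel α γ t u := by
  refine integral_congr_ae (.of_forall fun u => ?_)
  have : |u| ^ (-γ) = (|u| ^ (-γ / 2)) ^ 2 := by
    rw [← rpow_mul_natCast (abs_nonneg u)]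
    congr 1
    push_cast
    ring
  simp only [gfbmKernel, this]
  ring

lemma measurable_gfbmKernel (α γ v : ℝ) : Measurable (gfbmKernel α γ v) := by
  unfold gfbmKernel
  fun_prop

lemma integrableOn_Iio_zero_iff {f : ℝ → ℝ} :
    IntegrableOn f (Iio 0) ↔ IntegrableOn (fun w => f (-w)) (Ioi 0) := by
  have := (Measure.measurePreserving_neg (volume : Measure ℝ)).integrableOn_comp_preimage
    (MeasurableEquiv.neg ℝ).measurableEmbedding (f := f) (s := Iio 0)
  rw [← this]
  simp [Function.comp_def]

lemma setIntegral_Iio_neg {f : ℝ → ℝ} {R : ℝ} :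
    ∫ u in Iio (-R), f u = ∫ w in Ioi R, f (-w) := by
  rw [integral_comp_neg_Ioi, integral_Iic_eq_integral_Iio]

lemma setIntegral_Ioo_neg {f : ℝ → ℝ} {R : ℝ} :
    ∫ u in Ioo (-R) 0, f u = ∫ w in Ioo 0 R, f (-w) := by
  have := (Measure.measurePreserving_neg (volume : Measure ℝ)).setIntegral_preimage_emb
    (MeasurableEquiv.neg ℝ).measurableEmbedding f (Ioo (-R) 0)
  rw [← this]
  simp

lemma abs_add_rpow_sub_le {α v w : ℝ} (h1 : -1 ≤ α) (h2 : α ≤ 1) (hv : 0 ≤ v) (hw : 0 < w) :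
    |(v + w) ^ α - w ^ α| ≤ v * w ^ (α - 1) := by
  have hx : 0 ≤ v / w := by positivity
  have h1x : 1 ≤ 1 + v / w := by linarith
  have e : (v + w) ^ α = w ^ α * (1 + v / w) ^ α := by
    rw [← mul_rpow hw.le (by positivity)]
    congr 1
    field_simp
    ring
  rw [e, rpow_sub_one hw.ne', ← mul_sub_one, abs_mul, abs_of_pos (rpow_pos_of_pos hw _)]
  have : |(1 + v / w) ^ α - 1| ≤ v / w := by
    have hu : (1 + v / w) ^ α ≤ 1 + v / w := by
      simpa using rpow_le_rpow_of_exponent_le h1x h2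
    have hl : (1 + v / w)⁻¹ ≤ (1 + v / w) ^ α := by
      simpa [rpow_neg_one] using rpow_le_rpow_of_exponent_le h1x h1
    have hl' : 1 - v / w ≤ (1 + v / w)⁻¹ := by
      rw [← one_div, le_div_iff₀ (by linarith)]
      nlinarith
    rw [abs_le]
    constructor <;> linarith
  calc w ^ α * |(1 + v / w) ^ α - 1| ≤ w ^ α * (v / w) := by gcongr
    _ = _ := by ring

lemma abs_add_rpow_sub_le_near {α v w : ℝ} (h2 : α ≤ 1) (hv : 0 ≤ v) (hw : 0 < w) (hw1 : w ≤ 1) :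
    |(v + w) ^ α - w ^ α| ≤ (v + 1) * w ^ (min α 0) := by
  have hwp := rpow_pos_of_pos hw α
  have hvp : 0 < (v + w) ^ α := by positivity
  rcases le_total 0 α with h | h
  · rw [min_eq_right h, rpow_zero, mul_one]
    have h3 : w ^ α ≤ (v + w) ^ α := rpow_le_rpow hw.le (by linarith) h
    rw [abs_of_nonneg (by linarith)]
    have h4 : (v + w) ^ α ≤ (v + 1) ^ α := rpow_le_rpow (by linarith) (by linarith) h
    have h5 : (v + 1) ^ α ≤ v + 1 := by
      simpa using rpow_le_rpow_of_exponent_le (x := v + 1) (by linarith) h2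
    linarith
  · rw [min_eq_left h]
    have h3 : (v + w) ^ α ≤ w ^ α := rpow_le_rpow_of_nonpos hw (by linarith) h
    rw [abs_of_nonpos (by linarith)]
    nlinarith

namespace GFBMParam

variable {α γ : ℝ}

lemma gt_neg_half (h : GFBMParam α γ) : -1 / 2 < α := by linarith [h.gt, h.nonneg]

lemma near_exponent (h : GFBMParam α γ) : -1 < 2 * min α 0 - γ := by
  have := h.gt
  have := h.lt_one
  rcases min_choice α 0 with h | h <;> rw [h] <;> linarith

lemma kernel_of_le {v u : ℝ} (hu : 0 ≤ u) (hvu : v ≤ u) :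
    gfbmKernel α γ v u = 0 := by
  rw [gfbmKernel, max_eq_right (by linarith), max_eq_right (by linarith), sub_self, zero_mul]

lemma kernel_of_mem (h : GFBMParam α γ) {v u : ℝ} (hu : 0 < u) (hvu : u ≤ v) :
    gfbmKernel α γ v u = (v - u) ^ α * u ^ (-γ / 2) := by
  rw [gfbmKernel, max_eq_left (by linarith), max_eq_right (by linarith), zero_rpow h.ne_zero,
    sub_zero, abs_of_pos hu]

lemma kernel_neg {v w : ℝ} (hv : 0 ≤ v) (hw : 0 < w) :
    gfbmKernel α γ v (-w) = ((v + w) ^ α - w ^ α) * w ^ (-γ / 2) := by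
  rw [gfbmKernel, neg_neg, sub_neg_eq_add, max_eq_left (by linarith), max_eq_left hw.le, abs_neg,
    abs_of_pos hw]

lemma sq_rpow {x : ℝ} (hx : 0 ≤ x) (a : ℝ) : (x ^ a) ^ 2 = x ^ (2 * a) := by
  rw [← rpow_mul_natCast hx]
  congr 1
  push_cast
  ring

lemma kernel_neg_sq_le_near (h : GFBMParam α γ) {v w : ℝ} (hv : 0 ≤ v) (hw : 0 < w) (hw1 : w ≤ 1) :
    gfbmKernel α γ v (-w) ^ 2 ≤ (v + 1) ^ 2 * w ^ (2 * min α 0 - γ) := by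
  have h1 := abs_add_rpow_sub_le_near (by linarith [h.lt]) hv hw hw1 (α := α)
  rw [kernel_neg hv hw, mul_pow, ← sq_abs, sq_rpow hw.le (-γ / 2)]
  calc |(v + w) ^ α - w ^ α| ^ 2 * w ^ (2 * (-γ / 2))
      ≤ ((v + 1) * w ^ min α 0) ^ 2 * w ^ (2 * (-γ / 2)) := by gcongr
    _ = _ := by
        rw [mul_pow, sq_rpow hw.le, mul_assoc, ← rpow_add hw]
        congr 2
        ring

lemma kernel_neg_sq_le_far (h : GFBMParam α γ) {v w : ℝ} (hv : 0 ≤ v) (hw : 0 < w) :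
    gfbmKernel α γ v (-w) ^ 2 ≤ v ^ 2 * w ^ (2 * α - 2 - γ) := by
  have h1 := abs_add_rpow_sub_le (by linarith [h.gt_neg_half]) (by linarith [h.lt]) hv hw (α := α)
  rw [kernel_neg hv hw, mul_pow, ← sq_abs, sq_rpow hw.le (-γ / 2)]
  calc |(v + w) ^ α - w ^ α| ^ 2 * w ^ (2 * (-γ / 2))
      ≤ (v * w ^ (α - 1)) ^ 2 * w ^ (2 * (-γ / 2)) := by gcongr
    _ = _ := by
        rw [mul_pow, sq_rpow hw.le, mul_assoc, ← rpow_add hw]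
        congr 2
        ring

lemma integrableOn_kernel_sq_neg (h : GFBMParam α γ) {v : ℝ} (hv : 0 ≤ v) :
    IntegrableOn (fun u => gfbmKernel α γ v u ^ 2) (Iio 0) := by
  rw [integrableOn_Iio_zero_iff]
  have hm : Measurable fun w => gfbmKernel α γ v (-w) ^ 2 :=
    ((measurable_gfbmKernel α γ v).comp measurable_neg).pow_const 2
  rw [← Ioo_union_Ici_eq_Ioi (zero_lt_one (α := ℝ))]
  refine IntegrableOn.union ?_ ?_
  · refine Integrable.mono' ((integrableOn_Ioo_rpow h.near_exponent 1).const_mul ((v + 1) ^ 2))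
      hm.aestronglyMeasurable ((ae_restrict_iff' measurableSet_Ioo).2 (.of_forall fun w hw => ?_))
    rw [norm_of_nonneg (by positivity)]
    exact h.kernel_neg_sq_le_near hv hw.1 hw.2.le
  · rw [integrableOn_Ici_iff_integrableOn_Ioi]
    refine Integrable.mono' ((integrableOn_Ioi_rpow_of_lt (a := 2 * α - 2 - γ)
      (by linarith [h.lt, h.nonneg]) zero_lt_one).const_mul (v ^ 2))
      hm.aestronglyMeasurable ((ae_restrict_iff' measurableSet_Ioi).2 (.of_forall fun w hw => ?_))
    rw [norm_of_nonneg (by positivity)]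
    exact h.kernel_neg_sq_le_far hv (zero_lt_one.trans hw)

lemma rpow_sub_le {b v x : ℝ} (hx : 0 ≤ x) (hxv : 2 * x < v) :
    (v - x) ^ b ≤ (v / 2) ^ b + v ^ b := by
  have hv : 0 < v := by linarith
  have h1 : 0 < (v / 2) ^ b := by positivity
  have h2 : 0 < v ^ b := by positivity
  rcases le_total 0 b with h | h
  · have := rpow_le_rpow (x := v - x) (y := v) (by linarith) (by linarith) h
    linarith
  · have := rpow_le_rpow_of_nonpos (x := v / 2) (y := v - x) (by linarith) (by linarith) h
    linarith

lemma integrableOn_kernel_sq_pos (h : GFBMParam α γ) {v : ℝ} :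
    IntegrableOn (fun u => gfbmKernel α γ v u ^ 2) (Ioo 0 v) := by
  have hm : Measurable fun w => gfbmKernel α γ v w ^ 2 := (measurable_gfbmKernel α γ v).pow_const 2
  have ha : -1 < 2 * α := by linarith [h.gt_neg_half]
  have hb : -1 < -γ := by linarith [h.lt_one]
  have i1 := (integrableOn_Ioo_rpow hb v).const_mul ((v / 2) ^ (2 * α) + v ^ (2 * α))
  have i2 : IntegrableOn (fun x => (v - x) ^ (2 * α)) (Ioo 0 v) := by
    rcases le_total 0 v with hv | hv
    · have := (intervalIntegral.intervalIntegrable_rpow' (a := 0) (b := v) ha).comp_sub_left v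
      rw [sub_zero, sub_self] at this
      have := this.symm
      rwa [intervalIntegrable_iff_integrableOn_Ioo_of_le hv] at this
    · simp [Ioo_eq_empty_of_le hv]
  have i3 := i2.const_mul ((v / 2) ^ (-γ) + v ^ (-γ))
  refine Integrable.mono' (i1.add i3) hm.aestronglyMeasurable
    ((ae_restrict_iff' measurableSet_Ioo).2 (.of_forall fun x hx => ?_))
  have hx0 := hx.1
  have hxv : 0 < v - x := sub_pos.2 hx.2
  have hv : 0 < v := hx0.trans hx.2
  rw [norm_of_nonneg (by positivity), h.kernel_of_mem hx.1 hx.2.le, mul_pow, sq_rpow hxv.le,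
    sq_rpow hx0.le, show 2 * (-γ / 2) = -γ by ring]
  simp only [Pi.add_apply]
  rcases lt_or_ge (2 * x) v with h1 | h1
  · have := rpow_sub_le (b := 2 * α) hx0.le h1
    have e : 0 ≤ ((v / 2) ^ (-γ) + v ^ (-γ)) * (v - x) ^ (2 * α) := by positivity
    have : (v - x) ^ (2 * α) * x ^ (-γ) ≤ ((v / 2) ^ (2 * α) + v ^ (2 * α)) * x ^ (-γ) := by gcongr
    linarith
  · have : x ^ (-γ) ≤ (v / 2) ^ (-γ) :=
      rpow_le_rpow_of_nonpos (by positivity) (by linarith) (by linarith [h.nonneg])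
    have e : 0 ≤ ((v / 2) ^ (2 * α) + v ^ (2 * α)) * x ^ (-γ) := by positivity
    have : (v - x) ^ (2 * α) * x ^ (-γ) ≤ (v - x) ^ (2 * α) * ((v / 2) ^ (-γ) + v ^ (-γ)) := by
      gcongr
      have : 0 < v ^ (-γ) := by positivity
      linarith
    linarith

lemma memLp_kernel (h : GFBMParam α γ) {v : ℝ} (hv : 0 ≤ v) :
    MemLp (gfbmKernel α γ v) 2 volume := by
  rw [memLp_two_iff_integrable_sq (measurable_gfbmKernel α γ v).aestronglyMeasurable,
    ← integrableOn_univ, ← Iio_union_Ici (a := (0:ℝ))]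
  refine (h.integrableOn_kernel_sq_neg hv).union ?_
  rw [integrableOn_Ici_iff_integrableOn_Ioi, ← Ioc_union_Ioi_eq_Ioi hv]
  refine IntegrableOn.union ?_ ?_
  · rw [integrableOn_Ioc_iff_integrableOn_Ioo]
    exact h.integrableOn_kernel_sq_pos
  · refine (integrableOn_zero).congr_fun (fun u hu => ?_) measurableSet_Ioi
    have hu' : v < u := hu
    rw [kernel_of_le (hv.trans hu'.le) hu'.le]
    simp

lemma integral_kernel_sq_near_le (h : GFBMParam α γ) {s R v : ℝ} (hs : 0 < s) (hsR : s ≤ R)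
    (hR : R ≤ 1) (hv : 2 * s < v) (hv1 : v ≤ 1) :
    ∫ u in Ioo (-R) s, gfbmKernel α γ v u ^ 2 ≤
      5 / (2 * min α 0 - γ + 1) * R ^ (2 * min α 0 - γ + 1) := by
  have hR0 : 0 < R := hs.trans_le hsR
  have hv0 : 0 < v := by linarith
  have ha := h.near_exponent
  set a := 2 * min α 0 - γ with hadef
  have hi : Integrable fun u => gfbmKernel α γ v u ^ 2 := (h.memLp_kernel hv0.le).integrable_sq
  have hsplit : Ioo (-R) s = Ioo (-R) 0 ∪ Ico 0 s :=
    (Ioo_union_Ico_eq_Ioo (by linarith) hs.le).symm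
  rw [hsplit, setIntegral_union (disjoint_left.2 fun x hx hx' => absurd hx.2 (not_lt.2 hx'.1))
    measurableSet_Ico hi.integrableOn hi.integrableOn, setIntegral_Ioo_neg,
    integral_Ico_eq_integral_Ioo]
  have h1 : ∫ w in Ioo 0 R, gfbmKernel α γ v (-w) ^ 2 ≤ ∫ w in Ioo 0 R, 4 * w ^ a := by
    refine setIntegral_mono_on (hi.comp_neg.integrableOn)
      ((integrableOn_Ioo_rpow ha R).const_mul 4) measurableSet_Ioo fun w hw => ?_
    refine (h.kernel_neg_sq_le_near hv0.le hw.1 (hw.2.le.trans hR)).trans ?_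
    have := rpow_nonneg hw.1.le a
    have : (v + 1) ^ 2 ≤ 4 := by nlinarith
    gcongr
  have h2 : ∫ u in Ioo 0 s, gfbmKernel α γ v u ^ 2 ≤ ∫ u in Ioo 0 s, u ^ a := by
    refine setIntegral_mono_on hi.integrableOn (integrableOn_Ioo_rpow ha s) measurableSet_Ioo
      fun u hu => ?_
    have hu0 := hu.1
    have hus := hu.2
    rw [h.kernel_of_mem hu0 (by linarith), mul_pow, sq_rpow hu0.le]
    have h3 : (v - u) ^ α ≤ u ^ min α 0 := by
      rcases le_total 0 α with h0 | h0
      · rw [min_eq_right h0, rpow_zero]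
        exact rpow_le_one (by linarith) (by linarith) h0
      · rw [min_eq_left h0]
        exact rpow_le_rpow_of_nonpos hu0 (by linarith) h0
    have h4 : 0 ≤ (v - u) ^ α := rpow_nonneg (by linarith) _
    calc ((v - u) ^ α) ^ 2 * u ^ (2 * (-γ / 2)) ≤ (u ^ min α 0) ^ 2 * u ^ (2 * (-γ / 2)) := by gcongr
      _ = u ^ a := by
        rw [sq_rpow hu0.le, ← rpow_add hu0]
        congr 1
        rw [hadef]
        ring
  rw [integral_const_mul, integral_Ioo_rpow ha hR0.le] at h1
  rw [integral_Ioo_rpow ha hs.le] at h2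
  have h3 : s ^ (a + 1) / (a + 1) ≤ R ^ (a + 1) / (a + 1) := by
    have : 0 < a + 1 := by linarith
    gcongr
  have h4 : 5 / (a + 1) * R ^ (a + 1) = 4 * (R ^ (a + 1) / (a + 1)) + R ^ (a + 1) / (a + 1) := by ring
  linarith

lemma kernel_zero (u : ℝ) : gfbmKernel α γ 0 u = 0 := by
  simp [gfbmKernel]

lemma hurst_pos (h : GFBMParam α γ) : 0 < α - γ / 2 + 1 / 2 := by linarith [h.gt]

lemma kernel_scaling {r : ℝ} (hr : 0 < r) (v u : ℝ) :
    gfbmKernel α γ (r * v) (r * u) = r ^ (α - γ / 2) * gfbmKernel α γ v u := by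
  have h1 : ∀ x : ℝ, max (r * x) 0 = r * max x 0 := fun x => by
    rw [mul_max_of_nonneg _ _ hr.le, mul_zero]
  rw [gfbmKernel, gfbmKernel, ← mul_sub, ← mul_neg, h1, h1, abs_mul, abs_of_pos hr,
    mul_rpow hr.le (le_max_right _ _), mul_rpow hr.le (le_max_right _ _),
    mul_rpow hr.le (abs_nonneg u), sub_eq_add_neg α, rpow_add hr,
    show -γ / 2 = -(γ / 2) by ring]
  ring

lemma cov_scaling {r : ℝ} (hr : 0 < r) (s t : ℝ) :
    gfbmCov α γ (r * s) (r * t) = (r ^ (α - γ / 2 + 1 / 2)) ^ 2 * gfbmCov α γ s t := by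
  rw [gfbmCov_eq, gfbmCov_eq]
  have h1 := Measure.integral_comp_mul_left
    (fun u => gfbmKernel α γ (r * s) u * gfbmKernel α γ (r * t) u) r
  simp only [kernel_scaling hr] at h1
  have h2 : ∫ u, gfbmKernel α γ (r * s) u * gfbmKernel α γ (r * t) u =
      r * ∫ u, r ^ (α - γ / 2) * gfbmKernel α γ s u * (r ^ (α - γ / 2) * gfbmKernel α γ t u) := by
    rw [h1, smul_eq_mul, abs_of_pos (by positivity), mul_inv_cancel_left₀ hr.ne']
  rw [h2, ← integral_const_mul, ← integral_const_mul]
  refine integral_congr_ae (.of_forall fun u => ?_)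
  have e : (r ^ (α - γ / 2 + 1 / 2)) ^ 2 = r * (r ^ (α - γ / 2)) ^ 2 := by
    rw [rpow_add hr, mul_pow, ← sqrt_eq_rpow, sq_sqrt hr.le]
    ring
  simp only [e]
  ring

lemma cov_self (h : GFBMParam α γ) {v : ℝ} (hv : 0 ≤ v) :
    gfbmCov α γ v v = (v ^ (α - γ / 2 + 1 / 2)) ^ 2 * gfbmCov α γ 1 1 := by
  rcases hv.eq_or_lt with rfl | hv
  · rw [zero_rpow h.hurst_pos.ne', gfbmCov_eq]
    simp [kernel_zero]
  · have := cov_scaling (α := α) (γ := γ) hv 1 1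
    rwa [mul_one] at this

lemma cov_self_nonneg (α γ v : ℝ) : 0 ≤ gfbmCov α γ v v := by
  rw [gfbmCov_eq]
  exact integral_nonneg fun u => mul_self_nonneg _

lemma integral_kernel_sq (h : GFBMParam α γ) {v : ℝ} (hv : 0 ≤ v) :
    ∫ u, gfbmKernel α γ v u ^ 2 = (v ^ (α - γ / 2 + 1 / 2)) ^ 2 * gfbmCov α γ 1 1 := by
  rw [← h.cov_self hv, gfbmCov_eq]
  simp_rw [sq]

lemma integral_kernel_sq_le (h : GFBMParam α γ) {v : ℝ} (hv : 0 ≤ v) (hv1 : v ≤ 1) :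
    ∫ u, gfbmKernel α γ v u ^ 2 ≤ gfbmCov α γ 1 1 := by
  rw [h.integral_kernel_sq hv]
  refine mul_le_of_le_one_left (cov_self_nonneg _ _ _) ?_
  exact pow_le_one₀ (by positivity) (rpow_le_one hv hv1 h.hurst_pos.le)

/-- The span of the kernels with parameter in `[0, s]`. -/
def kernelSpan (α γ s : ℝ) : Submodule ℝ (ℝ → ℝ) :=
  Submodule.span ℝ (gfbmKernel α γ '' Icc 0 s)

lemma memLp_of_mem_kernelSpan (h : GFBMParam α γ) {s : ℝ} {f : ℝ → ℝ} (hf : f ∈ kernelSpan α γ s) :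
    MemLp f 2 volume := by
  refine Submodule.span_induction ?_ ?_ ?_ ?_ hf
  · rintro _ ⟨r, hr, rfl⟩
    exact h.memLp_kernel hr.1
  · exact MemLp.zero
  · exact fun f g _ _ hf hg => hf.add hg
  · exact fun c f _ hf => hf.const_smul c

lemma eq_zero_of_mem_kernelSpan {s u : ℝ} (hs : 0 ≤ s) (hu : s ≤ u) {f : ℝ → ℝ}
    (hf : f ∈ kernelSpan α γ s) : f u = 0 := by
  refine Submodule.span_induction (p := fun f _ => f u = 0) ?_ rfl ?_ ?_ hf
  · rintro _ ⟨r, hr, rfl⟩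
    exact kernel_of_le (hs.trans hu) (hr.2.trans hu)
  · exact fun f g _ _ hf hg => by simp [hf, hg]
  · exact fun c f _ hf => by simp [hf]

lemma far_exponent (h : GFBMParam α γ) : 0 < 1 + γ - 2 * α := by linarith [h.lt, h.nonneg]

lemma integrableOn_weight_sq (h : GFBMParam α γ) {s w : ℝ} (hw : 0 < w) :
    IntegrableOn (fun x : ℝ => (x ^ (γ / 2 - α) / (w + x)) ^ 2) (Ioo 0 s) ∧
    ∀ x ∈ Ioo 0 s, (x ^ (γ / 2 - α) / (w + x)) ^ 2 ≤ (w ^ 2)⁻¹ * x ^ (γ - 2 * α) := by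
  have hle : ∀ x ∈ Ioo 0 s, (x ^ (γ / 2 - α) / (w + x)) ^ 2 ≤ (w ^ 2)⁻¹ * x ^ (γ - 2 * α) := by
    intro x hx
    have hx0 := hx.1
    rw [div_pow, sq_rpow hx0.le, div_eq_inv_mul, show 2 * (γ / 2 - α) = γ - 2 * α by ring]
    gcongr
    linarith
  refine ⟨?_, hle⟩
  have := h.far_exponent
  refine Integrable.mono' ((integrableOn_Ioo_rpow (a := γ - 2 * α) (by linarith) s).const_mul
    (w ^ 2)⁻¹) (Measurable.aestronglyMeasurable (by fun_prop)) ((ae_restrict_iff' measurableSet_Ioo).2 (.of_forall fun x hx => ?_))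
  rw [norm_of_nonneg (by positivity)]
  exact hle x hx

lemma memLp_weight (h : GFBMParam α γ) (s : ℝ) {w : ℝ} (hw : 0 < w) :
    MemLp (fun x : ℝ => x ^ (γ / 2 - α) / (w + x)) 2 (volume.restrict (Ioo 0 s)) :=
  (memLp_two_iff_integrable_sq (Measurable.aestronglyMeasurable (by fun_prop))).2 (h.integrableOn_weight_sq hw).1

lemma kernel_neg_eq (h : GFBMParam α γ) {r s w : ℝ} (hr : 0 ≤ r) (hrs : r ≤ s) (hw : 0 < w) :
    gfbmKernel α γ r (-w) = α / abelConst α * w ^ (α - γ / 2) *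
      ∫ x in Ioo 0 s, gfbmKernel α γ r x * (x ^ (γ / 2 - α) / (w + x)) := by
  rcases hr.eq_or_lt with rfl | hr
  · simp [kernel_zero]
  have hα1 : -1 < α := by linarith [h.gt_neg_half]
  have hα2 : α < 1 := by linarith [h.lt]
  have hc := abelConst_pos hα1 hα2
  have h1 : ∫ x in Ioo 0 s, gfbmKernel α γ r x * (x ^ (γ / 2 - α) / (w + x)) =
      ∫ x in Ioo 0 r, gfbmKernel α γ r x * (x ^ (γ / 2 - α) / (w + x)) := by
    refine setIntegral_eq_of_subset_of_forall_sdiff_eq_zero measurableSet_Ioo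
      (Ioo_subset_Ioo_right hrs) fun x hx => ?_
    have hx0 : 0 < x := hx.1.1
    have hxr : r ≤ x := not_lt.1 fun h => hx.2 ⟨hx0, h⟩
    rw [kernel_of_le hx0.le hxr, zero_mul]
  have h2 : ∫ x in Ioo 0 r, gfbmKernel α γ r x * (x ^ (γ / 2 - α) / (w + x)) =
      ∫ x in Ioo 0 r, (r - x) ^ α * (x ^ (-α) / (w + x)) := by
    refine setIntegral_congr_fun measurableSet_Ioo fun x hx => ?_
    have hx0 := hx.1
    rw [h.kernel_of_mem hx0 hx.2.le, show -α = -γ / 2 + (γ / 2 - α) by ring, rpow_add hx0]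
    ring
  rw [h1, h2, integral_abel h.ne_zero hα1 hα2 hr hw, kernel_neg hr.le hw]
  have e : (r + w) ^ α = w ^ α * (1 + r / w) ^ α := by
    rw [← mul_rpow hw.le (by positivity)]
    congr 1
    field_simp
    ring
  have := h.ne_zero
  rw [e, sub_eq_add_neg α, rpow_add hw, show -γ / 2 = -(γ / 2) by ring]
  field_simp

lemma apply_neg_eq (h : GFBMParam α γ) {s w : ℝ} (hw : 0 < w) {f : ℝ → ℝ}
    (hf : f ∈ kernelSpan α γ s) :
    f (-w) = α / abelConst α * w ^ (α - γ / 2) *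
      ∫ x in Ioo 0 s, f x * (x ^ (γ / 2 - α) / (w + x)) := by
  have hfi : ∀ f ∈ kernelSpan α γ s,
      Integrable (fun x => f x * (x ^ (γ / 2 - α) / (w + x))) (volume.restrict (Ioo 0 s)) :=
    fun f hf => ((h.memLp_of_mem_kernelSpan hf).restrict _).integrable_mul (h.memLp_weight s hw)
  refine Submodule.span_induction (p := fun f _ => f (-w) = α / abelConst α * w ^ (α - γ / 2) *
      ∫ x in Ioo 0 s, f x * (x ^ (γ / 2 - α) / (w + x))) ?_ (by simp) ?_ ?_ hf
  · rintro _ ⟨r, hr, rfl⟩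
    exact h.kernel_neg_eq hr.1 hr.2 hw
  · intro f g hfm hgm hf hg
    simp only [Pi.add_apply, add_mul]
    rw [integral_add (hfi f hfm) (hfi g hgm), hf, hg]
    ring
  · intro c f _ hf
    simp only [Pi.smul_apply, smul_eq_mul, mul_assoc c]
    rw [integral_const_mul, hf]
    ring

lemma apply_neg_sq_le (h : GFBMParam α γ) {s w : ℝ} (hs : 0 ≤ s) (hw : 0 < w) {f : ℝ → ℝ}
    (hf : f ∈ kernelSpan α γ s) :
    f (-w) ^ 2 ≤ (α / abelConst α) ^ 2 * (s ^ (1 + γ - 2 * α) / (1 + γ - 2 * α)) *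
      (∫ x, f x ^ 2) * w ^ (2 * α - γ - 2) := by
  have hb := h.far_exponent
  have hL := h.memLp_of_mem_kernelSpan hf
  rw [h.apply_neg_eq hw hf, mul_pow, mul_pow, sq_rpow hw.le]
  have h1 := abs_integral_mul_le_sqrt (hL.restrict (Ioo 0 s)) (h.memLp_weight s hw)
  have h2 : (∫ x in Ioo 0 s, f x * (x ^ (γ / 2 - α) / (w + x))) ^ 2 ≤
      (∫ x, f x ^ 2) * ((w ^ 2)⁻¹ * (s ^ (1 + γ - 2 * α) / (1 + γ - 2 * α))) := by
    rw [← sq_abs]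
    refine (pow_le_pow_left₀ (abs_nonneg _) h1 2).trans ?_
    rw [mul_pow, sq_sqrt (integral_nonneg fun x => sq_nonneg _),
      sq_sqrt (integral_nonneg fun x => sq_nonneg _)]
    have h3 : ∫ x in Ioo 0 s, f x ^ 2 ≤ ∫ x, f x ^ 2 :=
      setIntegral_le_integral hL.integrable_sq (.of_forall fun x => sq_nonneg _)
    have h4 : ∫ x in Ioo 0 s, (x ^ (γ / 2 - α) / (w + x)) ^ 2 ≤
        (w ^ 2)⁻¹ * (s ^ (1 + γ - 2 * α) / (1 + γ - 2 * α)) := by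
      have h5 := h.integrableOn_weight_sq hw (s := s)
      refine (setIntegral_mono_on h5.1 ((integrableOn_Ioo_rpow (a := γ - 2 * α) (by linarith)
        s).const_mul (w ^ 2)⁻¹) measurableSet_Ioo h5.2).trans (le_of_eq ?_)
      rw [integral_const_mul, integral_Ioo_rpow (by linarith) hs,
        show γ - 2 * α + 1 = 1 + γ - 2 * α by ring]
    exact mul_le_mul h3 h4 (integral_nonneg fun x => sq_nonneg _)
      (integral_nonneg fun x => sq_nonneg _)
  calc (α / abelConst α) ^ 2 * w ^ (2 * (α - γ / 2)) *
        (∫ x in Ioo 0 s, f x * (x ^ (γ / 2 - α) / (w + x))) ^ 2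
      ≤ (α / abelConst α) ^ 2 * w ^ (2 * (α - γ / 2)) *
        ((∫ x, f x ^ 2) * ((w ^ 2)⁻¹ * (s ^ (1 + γ - 2 * α) / (1 + γ - 2 * α)))) := by gcongr
    _ = _ := by
      rw [show 2 * α - γ - 2 = 2 * (α - γ / 2) - 2 by ring, rpow_sub hw _ 2, rpow_two]
      field_simp

lemma setIntegral_sq_far_le (h : GFBMParam α γ) {s R : ℝ} (hs : 0 ≤ s) (hR : 0 < R) {f : ℝ → ℝ}
    (hf : f ∈ kernelSpan α γ s) :
    ∫ u in Iio (-R), f u ^ 2 ≤ (α / abelConst α / (1 + γ - 2 * α)) ^ 2 *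
      (s / R) ^ (1 + γ - 2 * α) * ∫ x, f x ^ 2 := by
  have hb := h.far_exponent
  have hL := (h.memLp_of_mem_kernelSpan hf).integrable_sq
  rw [setIntegral_Iio_neg]
  have h1 : ∫ w in Ioi R, f (-w) ^ 2 ≤ ∫ w in Ioi R,
      (α / abelConst α) ^ 2 * (s ^ (1 + γ - 2 * α) / (1 + γ - 2 * α)) *
      (∫ x, f x ^ 2) * w ^ (2 * α - γ - 2) :=
    setIntegral_mono_on hL.comp_neg.integrableOn
      ((integrableOn_Ioi_rpow_of_lt (by linarith) hR).const_mul _) measurableSet_Ioi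
      fun w hw => h.apply_neg_sq_le hs (hR.trans hw) hf
  refine h1.trans (le_of_eq ?_)
  rw [integral_const_mul, integral_Ioi_rpow_of_lt (by linarith) hR, div_rpow hs hR.le,
    show 2 * α - γ - 2 + 1 = -(1 + γ - 2 * α) by ring, rpow_neg hR.le, neg_div_neg_eq]
  field_simp

/-- The kernels are asymptotically orthogonal to those with small parameters. -/
lemma exists_abs_integral_mul_kernel_le (h : GFBMParam α γ) :
    ∃ D : ℝ, 0 < D ∧ ∃ ε : ℝ, 0 < ε ∧ ∀ s : ℝ, 0 < s → s ≤ 1 → ∀ v ∈ Icc (0:ℝ) 1,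
      ∀ f ∈ kernelSpan α γ s, |∫ u, f u * gfbmKernel α γ v u| ≤ D * s ^ ε * √(∫ u, f u ^ 2) := by
  have hb := h.far_exponent
  have hH := h.hurst_pos
  have he : 0 < 2 * min α 0 - γ + 1 := by linarith [h.near_exponent]
  set b := 1 + γ - 2 * α with hbdef
  set H := α - γ / 2 + 1 / 2 with hHdef
  set e := 2 * min α 0 - γ + 1 with hedef
  set A := |α / abelConst α / b| with hA
  set V := √(gfbmCov α γ 1 1) with hV
  have hA0 : 0 ≤ A := abs_nonneg _
  have hV0 : 0 ≤ V := sqrt_nonneg _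
  refine ⟨2 ^ H * V + (A * V + √(5 / e)) + 1, by positivity, min H (min (b / 4) (e / 4)),
    by positivity, fun s hs hs1 v hv f hf => ?_⟩
  set ε := min H (min (b / 4) (e / 4)) with hε
  have hpow : ∀ x, ε ≤ x → s ^ x ≤ s ^ ε := fun x hx => rpow_le_rpow_of_exponent_ge hs hs1 hx
  have hsε : 0 < s ^ ε := rpow_pos_of_pos hs _
  have hf2 := h.memLp_of_mem_kernelSpan hf
  have hk2 := h.memLp_kernel hv.1
  set F := √(∫ u, f u ^ 2) with hF
  have hF0 : 0 ≤ F := sqrt_nonneg _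
  rcases le_or_gt v (2 * s) with hvs | hvs
  · have h1 := abs_integral_mul_le_sqrt hf2 hk2
    rw [h.integral_kernel_sq hv.1, sqrt_mul (by positivity), sqrt_sq (rpow_nonneg hv.1 _)] at h1
    have h2 : v ^ H ≤ 2 ^ H * s ^ ε := by
      calc v ^ H ≤ (2 * s) ^ H := rpow_le_rpow hv.1 hvs hH.le
        _ = 2 ^ H * s ^ H := mul_rpow (by norm_num) hs.le
        _ ≤ _ := mul_le_mul_of_nonneg_left (hpow _ (min_le_left _ _)) (by positivity)
    calc _ ≤ F * (v ^ H * V) := h1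
      _ ≤ F * (2 ^ H * s ^ ε * V) := by gcongr
      _ = (2 ^ H * V) * s ^ ε * F := by ring
      _ ≤ _ := by
        gcongr
        have : 0 ≤ A * V + √(5 / e) := by positivity
        linarith
  · set R := √s with hR
    have hR0 : 0 < R := sqrt_pos.2 hs
    have hR1 : R ≤ 1 := by exact sqrt_le_one.2 hs1
    have hsR : s ≤ R := by
      rw [hR]; exact le_sqrt_of_sq_le (by nlinarith)
    have hfar : |∫ u in Iio (-R), f u * gfbmKernel α γ v u| ≤ A * s ^ ε * F * V := by
      refine (abs_integral_mul_le_sqrt (hf2.restrict _) (hk2.restrict _)).trans ?_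
      have h1 : √(∫ u in Iio (-R), f u ^ 2) ≤ A * s ^ ε * F := by
        rw [sqrt_le_left (by positivity)]
        refine (h.setIntegral_sq_far_le hs.le hR0 hf).trans ?_
        rw [mul_pow, mul_pow, hF, sq_sqrt (integral_nonneg fun x => sq_nonneg _), hA, sq_abs]
        have hsR' : s / R = R := by rw [hR, div_sqrt]
        have h2 : (s / R) ^ b ≤ (s ^ ε) ^ 2 := by
          rw [hsR', hR, sqrt_eq_rpow, ← rpow_mul hs.le, sq_rpow hs.le]
          refine rpow_le_rpow_of_exponent_ge hs hs1 ?_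
          have : ε ≤ b / 4 := (min_le_right _ _).trans (min_le_left _ _)
          linarith
        have : 0 ≤ ∫ x, f x ^ 2 := integral_nonneg fun x => sq_nonneg _
        gcongr
      have h2 : √(∫ u in Iio (-R), gfbmKernel α γ v u ^ 2) ≤ V := by
        refine sqrt_le_sqrt (le_trans ?_ (h.integral_kernel_sq_le hv.1 hv.2))
        exact setIntegral_le_integral hk2.integrable_sq (.of_forall fun x => sq_nonneg _)
      gcongr
    have hnear : |∫ u in Ici (-R), f u * gfbmKernel α γ v u| ≤ F * (√(5 / e) * s ^ ε) := by
      have e1 : ∫ u in Ici (-R), f u * gfbmKernel α γ v u =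
          ∫ u in Ioo (-R) s, f u * gfbmKernel α γ v u := by
        rw [integral_Ici_eq_integral_Ioi]
        refine setIntegral_eq_of_subset_of_forall_sdiff_eq_zero measurableSet_Ioi
          (fun u hu => hu.1) fun u hu => ?_
        have : s ≤ u := not_lt.1 fun h => hu.2 ⟨hu.1, h⟩
        rw [eq_zero_of_mem_kernelSpan hs.le this hf, zero_mul]
      rw [e1]
      refine (abs_integral_mul_le_sqrt (hf2.restrict _) (hk2.restrict _)).trans ?_
      have h1 : √(∫ u in Ioo (-R) s, f u ^ 2) ≤ F :=
        sqrt_le_sqrt (setIntegral_le_integral hf2.integrable_sq (.of_forall fun x => sq_nonneg _))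
      have h2 : √(∫ u in Ioo (-R) s, gfbmKernel α γ v u ^ 2) ≤ √(5 / e) * s ^ ε := by
        rw [sqrt_le_left (by positivity)]
        refine (h.integral_kernel_sq_near_le hs hsR hR1 hvs hv.2).trans ?_
        rw [mul_pow, sq_sqrt (by positivity)]
        have h2 : R ^ e ≤ (s ^ ε) ^ 2 := by
          rw [hR, sqrt_eq_rpow, ← rpow_mul hs.le, sq_rpow hs.le]
          refine rpow_le_rpow_of_exponent_ge hs hs1 ?_
          have : ε ≤ e / 4 := (min_le_right _ _).trans (min_le_right _ _)
          linarith
        gcongr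
      gcongr
    have hfi : Integrable fun u => f u * gfbmKernel α γ v u := hf2.integrable_mul hk2
    have hsum : ∫ u, f u * gfbmKernel α γ v u = (∫ u in Iio (-R), f u * gfbmKernel α γ v u) +
        ∫ u in Ici (-R), f u * gfbmKernel α γ v u := by
      rw [← compl_Iio, integral_add_compl measurableSet_Iio hfi]
    rw [hsum]
    refine (abs_add_le _ _).trans ((add_le_add hfar hnear).trans ?_)
    have : 0 ≤ (2 ^ H * V + 1) * s ^ ε * F := by positivity
    calc _ = (A * V + √(5 / e)) * s ^ ε * F := by ring
      _ ≤ _ := by linarith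

end GFBMParam

/-- A generalized fractional Brownian motion all of whose paths are continuous on the whole line
and whose values lie in a Gaussian space. -/
structure IsRegularGFBM {Ω : Type*} [MeasurableSpace Ω] (P : Measure Ω)
    (S : Submodule ℝ (Ω → ℝ)) (α γ : ℝ) (X : ℝ → Ω → ℝ) : Prop where
  param : GFBMParam α γ
  gaussSpace : IsGaussSpace P S
  mem : ∀ t, X t ∈ S
  continuous : ∀ ω, Continuous fun t => X t ω
  cov : ∀ s t, 0 ≤ s → 0 ≤ t → ∫ ω, X s ω * X t ω ∂P = gfbmCov α γ s t

lemma integral_toLp_mul {Ω : Type*} [MeasurableSpace Ω] {P : Measure Ω} {f : Ω → ℝ}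
    (hf : MemLp f 2 P) (N : Lp ℝ 2 P) : inner ℝ (hf.toLp f) N = ∫ ω, f ω * N ω ∂P := by
  rw [L2.inner_def]
  refine integral_congr_ae ?_
  filter_upwards [hf.coeFn_toLp] with x h1
  rw [h1]
  simp [mul_comm]

lemma integral_rpow_mul_eq {f : ℝ → ℝ} {θ t : ℝ} (hθ : 0 < θ) (ht : 0 < t) :
    ∫ u in (0:ℝ)..t, (t - u) ^ (θ - 1) * f u =
      t ^ θ / θ * ∫ z in (0:ℝ)..1, f (t * (1 - z ^ θ⁻¹)) := by
  set φ : ℝ → ℝ := fun z => t * (1 - z ^ θ⁻¹)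
  have hθ' : 0 < θ⁻¹ := inv_pos.2 hθ
  have himg : φ '' Ioo 0 1 = Ioo 0 t := by
    ext u
    constructor
    · rintro ⟨z, hz, rfl⟩
      have h1 : 0 < z ^ θ⁻¹ := rpow_pos_of_pos hz.1 _
      have h2 : z ^ θ⁻¹ < 1 := rpow_lt_one hz.1.le hz.2 hθ'
      exact ⟨mul_pos ht (by linarith), by simp only [φ]; nlinarith⟩
    · intro hu
      have h1 : 0 < 1 - u / t := by rw [sub_pos, div_lt_one ht]; exact hu.2
      have h2 : 1 - u / t < 1 := by have := div_pos hu.1 ht; linarith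
      refine ⟨(1 - u / t) ^ θ, ⟨by positivity, rpow_lt_one h1.le h2 hθ⟩, ?_⟩
      simp only [φ]
      rw [← rpow_mul h1.le, mul_inv_cancel₀ hθ.ne', rpow_one]
      field_simp
      ring
  have hder : ∀ z ∈ Ioo (0:ℝ) 1, HasDerivWithinAt φ (-(t * (θ⁻¹ * z ^ (θ⁻¹ - 1)))) (Ioo 0 1) z := by
    intro z hz
    have := ((hasDerivAt_rpow_const (p := θ⁻¹) (Or.inl hz.1.ne')).const_sub 1).const_mul t
    exact (this.congr_deriv (by ring)).hasDerivWithinAt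
  have hinj : InjOn φ (Ioo 0 1) := by
    intro y hy z hz hyz
    simp only [φ] at hyz
    have h1 : y ^ θ⁻¹ = z ^ θ⁻¹ := by
      have := mul_left_cancel₀ ht.ne' hyz
      linarith
    exact (rpow_left_inj hy.1.le hz.1.le hθ'.ne').1 h1
  rw [intervalIntegral.integral_of_le ht.le, intervalIntegral.integral_of_le zero_le_one,
    integral_Ioc_eq_integral_Ioo, integral_Ioc_eq_integral_Ioo, ← himg,
    integral_image_eq_integral_abs_deriv_smul measurableSet_Ioo hder hinj, ← integral_const_mul]
  refine setIntegral_congr_fun measurableSet_Ioo fun z hz => ?_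
  have hz0 := hz.1
  have e1 : t - φ z = t * z ^ θ⁻¹ := by simp only [φ]; ring
  have e2 : t ^ θ = t * t ^ (θ - 1) := by
    rw [rpow_sub_one ht.ne']; field_simp
  have e3 : z ^ (θ⁻¹ - 1) * z ^ (θ⁻¹ * (θ - 1)) = 1 := by
    rw [← rpow_add hz0, mul_sub_one, inv_mul_cancel₀ hθ.ne']
    simp
  simp only [smul_eq_mul]
  rw [e1, abs_neg, abs_of_pos (by positivity), mul_rpow ht.le (by positivity), ← rpow_mul hz0.le, e2]
  simp only [φ]
  linear_combination (t * θ⁻¹ * t ^ (θ - 1) * f (t * (1 - z ^ θ⁻¹))) * e3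

lemma fracInt_eq {Ω : Type*} {X : ℝ → Ω → ℝ} {θ t : ℝ} (hθ : 0 < θ) (ht : 0 ≤ t) (ω : Ω) :
    fracInt θ X t ω = (Gamma θ)⁻¹ * (t ^ θ / θ * ∫ z in (0:ℝ)..1, X (t * (1 - z ^ θ⁻¹)) ω) := by
  rcases ht.eq_or_lt with rfl | ht
  · simp [fracInt, zero_rpow hθ.ne']
  · rw [fracInt, integral_rpow_mul_eq (f := fun u => X u ω) hθ ht]

lemma intervalIntegrable_sub_rpow {θ t : ℝ} (hθ : 0 < θ) :
    IntervalIntegrable (fun u => (t - u) ^ (θ - 1)) volume 0 t := by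
  have := (intervalIntegral.intervalIntegrable_rpow' (a := 0) (b := t)
    (r := θ - 1) (by linarith)).comp_sub_left t
  rw [sub_zero, sub_self] at this
  exact this.symm

lemma integral_sub_rpow {θ t : ℝ} (hθ : 0 < θ) :
    ∫ u in (0:ℝ)..t, (t - u) ^ (θ - 1) = t ^ θ / θ := by
  rw [intervalIntegral.integral_comp_sub_left (fun u => u ^ (θ - 1)), sub_self, sub_zero,
    integral_rpow (Or.inl (by linarith)), sub_add_cancel, zero_rpow hθ.ne', sub_zero]

lemma integral_sub_rpow_mul_scaling {θ r t A : ℝ} (hr : 0 < r) (ht : 0 ≤ t) {G g : ℝ → ℝ}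
    (hG : ∀ u, 0 ≤ u → G (r * u) = A * g u) :
    ∫ u in (0:ℝ)..r * t, (r * t - u) ^ (θ - 1) * G u =
      r ^ θ * A * ∫ u in (0:ℝ)..t, (t - u) ^ (θ - 1) * g u := by
  have h := intervalIntegral.smul_integral_comp_mul_left (a := 0) (b := t)
    (fun u => (r * t - u) ^ (θ - 1) * G u) r
  rw [mul_zero] at h
  rw [← h, smul_eq_mul, ← intervalIntegral.integral_const_mul, ← intervalIntegral.integral_const_mul]
  refine intervalIntegral.integral_congr fun u hu => ?_
  rw [uIcc_of_le ht] at hu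
  rw [hG u hu.1, ← mul_sub, mul_rpow hr.le (by linarith [hu.2]), rpow_sub_one hr.ne']
  field_simp

namespace IsRegularGFBM

variable {Ω : Type*} [MeasurableSpace Ω] {P : Measure Ω} {S : Submodule ℝ (Ω → ℝ)} {α γ : ℝ}
  {X : ℝ → Ω → ℝ}

lemma memLp (h : IsRegularGFBM P S α γ X) (t : ℝ) : MemLp (X t) 2 P :=
  h.gaussSpace.memLp (h.mem t) (by simp)

lemma measurable (h : IsRegularGFBM P S α γ X) (t : ℝ) : Measurable (X t) :=
  h.gaussSpace.measurable _ (h.mem t)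

/-- Transport of functionals from the kernel space to the Gaussian space. -/
lemma exists_dual (h : IsRegularGFBM P S α γ X) {s D : ℝ} (hD : 0 ≤ D) {g : ℝ → ℝ}
    (hg : MemLp g 2 volume)
    (hb : ∀ f ∈ GFBMParam.kernelSpan α γ s, |∫ u, f u * g u| ≤ D * √(∫ u, f u ^ 2)) :
    ∃ N : Ω → ℝ, MemLp N 2 P ∧ √(∫ ω, N ω ^ 2 ∂P) ≤ D ∧
      ∀ r ∈ Icc 0 s, ∫ ω, X r ω * N ω ∂P = ∫ u, gfbmKernel α γ r u * g u := by
  have hk : ∀ r : Icc 0 s, MemLp (gfbmKernel α γ r) 2 volume := fun r => h.param.memLp_kernel r.2.1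
  have hkg : ∀ r : Icc 0 s, Integrable fun u => gfbmKernel α γ r u * g u := fun r =>
    (hk r).integrable_mul hg
  have hkk : ∀ i j : Icc 0 s, Integrable fun u => gfbmKernel α γ i u * gfbmKernel α γ j u :=
    fun i j => (hk i).integrable_mul (hk j)
  obtain ⟨N, hN, hXN⟩ := exists_inner_eq (fun r : Icc 0 s => (h.memLp r).toLp (X r))
    (fun r => ∫ u, gfbmKernel α γ r u * g u) hD (by
      intro c
      set f : ℝ → ℝ := ∑ r ∈ c.support, c r • gfbmKernel α γ r with hf
      have hfm : f ∈ GFBMParam.kernelSpan α γ s := Submodule.sum_mem _ fun r _ =>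
        Submodule.smul_mem _ _ (Submodule.subset_span ⟨r, r.2, rfl⟩)
      have h1 : (c.sum fun i a => a * ∫ u, gfbmKernel α γ i u * g u) = ∫ u, f u * g u := by
        simp only [Finsupp.sum, hf, Finset.sum_apply, Pi.smul_apply, smul_eq_mul, Finset.sum_mul,
          mul_assoc]
        rw [integral_finsetSum _ fun r _ => (hkg r).const_mul _]
        simp_rw [integral_const_mul]
      have h2 : ‖c.sum fun i a => a • (h.memLp i).toLp (X i)‖ = √(∫ u, f u ^ 2) := by
        rw [norm_eq_sqrt_real_inner]
        congr 1
        simp only [Finsupp.sum, sum_inner, inner_sum, inner_smul_left, inner_smul_right]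
        have h3 : ∀ u, f u ^ 2 = ∑ i ∈ c.support, ∑ j ∈ c.support,
            c i * (c j * (gfbmKernel α γ j u * gfbmKernel α γ i u)) := by
          intro u
          simp only [hf, Finset.sum_apply, Pi.smul_apply, smul_eq_mul, sq, Finset.sum_mul_sum]
          refine Finset.sum_congr rfl fun i _ => Finset.sum_congr rfl fun j _ => by ring
        simp_rw [h3]
        rw [integral_finsetSum _ fun i _ => integrable_finsetSum _ fun j _ =>
          ((hkk j i).const_mul _).const_mul _]
        refine Finset.sum_congr rfl fun i _ => ?_
        rw [integral_finsetSum _ fun j _ => ((hkk j i).const_mul _).const_mul _, Finset.mul_sum]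
        simp_rw [integral_const_mul]
        refine Finset.sum_congr rfl fun j _ => ?_
        rw [← gfbmCov_eq, integral_toLp_mul, ← h.cov j i j.2.1 i.2.1]
        have : ∫ ω, X j ω * ((h.memLp i).toLp (X i) : Lp ℝ 2 P) ω ∂P = ∫ ω, X j ω * X i ω ∂P := by
          refine integral_congr_ae ?_
          filter_upwards [(h.memLp i).coeFn_toLp] with ω hω
          rw [hω]
        rw [this]
        simp
      rw [h1, h2]
      exact hb f hfm)
  refine ⟨N, Lp.memLp N, ?_, fun r hr => ?_⟩
  · refine le_trans (le_of_eq ?_) hN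
    rw [norm_eq_sqrt_real_inner, L2.inner_def]
    simp [sq]
  · rw [← hXN ⟨r, hr⟩, integral_toLp_mul]

lemma stronglyMeasurable_uncurry (h : IsRegularGFBM P S α γ X) :
    StronglyMeasurable (Function.uncurry X) := by
  have : Measurable (Function.uncurry fun (t : ℝ) ω => X t ω) :=
    measurable_uncurry_of_continuous_of_measurable h.continuous h.measurable
  exact this.stronglyMeasurable

lemma integral_sq_le (h : IsRegularGFBM P S α γ X) {u t : ℝ} (hu : 0 ≤ u) (hut : u ≤ t) :
    ∫ ω, X u ω ^ 2 ∂P ≤ (t ^ (α - γ / 2 + 1 / 2)) ^ 2 * gfbmCov α γ 1 1 := by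
  simp_rw [sq (X u _)]
  rw [h.cov u u hu hu, h.param.cov_self hu]
  have := GFBMParam.cov_self_nonneg α γ 1
  have := rpow_le_rpow hu hut h.param.hurst_pos.le
  have := rpow_nonneg hu (α - γ / 2 + 1 / 2)
  gcongr

lemma integrable_prod (h : IsRegularGFBM P S α γ X) {θ t : ℝ} (hθ : 0 < θ)
    {N : Ω → ℝ} (hN : MemLp N 2 P) :
    Integrable (Function.uncurry fun (u : ℝ) ω => (t - u) ^ (θ - 1) * (X u ω * N ω))
      ((volume.restrict (Ioc 0 t)).prod P) := by
  have := h.gaussSpace.isProbabilityMeasure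
  have hm : AEStronglyMeasurable (Function.uncurry fun (u : ℝ) ω => (t - u) ^ (θ - 1) * (X u ω * N ω))
      ((volume.restrict (Ioc 0 t)).prod P) := by
    refine AEStronglyMeasurable.mul (Measurable.aestronglyMeasurable (by fun_prop)) ?_
    exact h.stronglyMeasurable_uncurry.aestronglyMeasurable.mul hN.1.comp_snd
  refine (integrable_prod_iff hm).2 ⟨.of_forall fun u => ?_, ?_⟩
  · have : Integrable (fun ω => X u ω * N ω) P := (h.memLp u).integrable_mul hN
    exact this.const_mul ((t - u) ^ (θ - 1))
  · have hi := (intervalIntegrable_sub_rpow (t := t) hθ).1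
    refine Integrable.mono' (hi.mul_const (√((t ^ (α - γ / 2 + 1 / 2)) ^ 2 * gfbmCov α γ 1 1) *
      √(∫ ω, N ω ^ 2 ∂P))) hm.norm.integral_prod_right'
      ((ae_restrict_iff' measurableSet_Ioc).2 (.of_forall fun u hu => ?_))
    have h0 : 0 ≤ (t - u) ^ (θ - 1) := rpow_nonneg (by linarith [hu.2]) _
    rw [norm_of_nonneg (integral_nonneg fun ω => norm_nonneg _)]
    simp only [Function.uncurry, norm_mul, norm_of_nonneg h0]
    rw [integral_const_mul]
    refine mul_le_mul_of_nonneg_left ?_ h0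
    have := (le_abs_self _).trans (abs_integral_mul_le_sqrt (h.memLp u).norm hN.norm)
    refine this.trans ?_
    simp only [norm_eq_abs, sq_abs]
    gcongr
    exact h.integral_sq_le hu.1.le hu.2

lemma integral_fracInt_mul (h : IsRegularGFBM P S α γ X) {θ t : ℝ} (hθ : 0 < θ) (ht : 0 ≤ t)
    {N : Ω → ℝ} (hN : MemLp N 2 P) :
    ∫ ω, fracInt θ X t ω * N ω ∂P =
      (Gamma θ)⁻¹ * ∫ u in (0:ℝ)..t, (t - u) ^ (θ - 1) * ∫ ω, X u ω * N ω ∂P := by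
  have := h.gaussSpace.isProbabilityMeasure
  have h1 := integral_integral_swap (h.integrable_prod (t := t) hθ hN)
  rw [intervalIntegral.integral_of_le ht]
  have h2 : ∀ u, (t - u) ^ (θ - 1) * ∫ ω, X u ω * N ω ∂P =
      ∫ ω, (t - u) ^ (θ - 1) * (X u ω * N ω) ∂P := fun u => (integral_const_mul _ _).symm
  simp_rw [h2]
  rw [h1, ← integral_const_mul]
  refine integral_congr_ae (.of_forall fun ω => ?_)
  simp only [fracInt, intervalIntegral.integral_of_le ht, mul_assoc, ← integral_mul_const]

lemma continuous_fracInt (h : IsRegularGFBM P S α γ X) {θ : ℝ} (hθ : 0 < θ) (ω : Ω) :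
    Continuous fun t => fracInt θ X (max t 0) ω := by
  simp_rw [fun t : ℝ => fracInt_eq (X := X) hθ (le_max_right t 0) ω]
  have hx := h.continuous ω
  have hθ' : 0 ≤ θ⁻¹ := (inv_pos.2 hθ).le
  have h1 : Continuous fun t : ℝ => ∫ z in (0:ℝ)..1, X (max t 0 * (1 - z ^ θ⁻¹)) ω := by
    refine intervalIntegral.continuous_parametric_intervalIntegral_of_continuous' ?_ 0 1
    refine hx.comp ?_
    have : Continuous fun z : ℝ => z ^ θ⁻¹ := continuous_rpow_const hθ'
    fun_prop
  have h2 : Continuous fun t : ℝ => (max t 0) ^ θ :=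
    (continuous_rpow_const hθ.le).comp (by fun_prop)
  fun_prop

lemma fracInt_mem (h : IsRegularGFBM P S α γ X) {θ : ℝ} (hθ : 0 < θ) (t : ℝ) :
    fracInt θ X (max t 0) ∈ limitSpace S := by
  set t' := max t 0
  have ht : 0 ≤ t' := le_max_right _ _
  have hθ' : 0 ≤ θ⁻¹ := (inv_pos.2 hθ).le
  have : fracInt θ X t' = (Gamma θ)⁻¹ • ((t' ^ θ / θ) • fun ω =>
      ∫ z in (0:ℝ)..1, X (t' * (1 - z ^ θ⁻¹)) ω) := by
    ext ω
    rw [fracInt_eq hθ ht]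
    rfl
  rw [this]
  refine Submodule.smul_mem _ _ (Submodule.smul_mem _ _ ?_)
  refine ⟨fun n => ∑ k ∈ Finset.range (n + 1), ((n : ℝ) + 1)⁻¹ •
    X (t' * (1 - (k / ((n : ℝ) + 1)) ^ θ⁻¹)), fun n => ?_, fun ω => ?_⟩
  · exact Submodule.sum_mem _ fun k _ => Submodule.smul_mem _ _ (h.mem _)
  · have hc : Continuous fun z : ℝ => X (t' * (1 - z ^ θ⁻¹)) ω := by
      refine (h.continuous ω).comp ?_
      have : Continuous fun z : ℝ => z ^ θ⁻¹ := continuous_rpow_const hθ'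
      fun_prop
    simpa [Finset.sum_apply] using tendsto_riemannSum hc

lemma memLp_fracInt (h : IsRegularGFBM P S α γ X) {θ : ℝ} (hθ : 0 < θ) {t : ℝ} (ht : 0 ≤ t) :
    MemLp (fracInt θ X t) 2 P := by
  have := h.gaussSpace.limitSpace.memLp (h.fracInt_mem hθ t) (p := 2) (by simp)
  rwa [max_eq_left ht] at this

lemma isSelfSimilarGaussian (h : IsRegularGFBM P S α γ X) {θ : ℝ} (hθ : 0 < θ) :
    IsSelfSimilarGaussian P (limitSpace S) (fun t => fracInt θ X (max t 0))
      (α - γ / 2 + 1 / 2 + θ) where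
  gaussSpace := h.gaussSpace.limitSpace
  mem t := h.fracInt_mem hθ t
  continuous ω := h.continuous_fracInt hθ ω
  scaling := by
    intro r s t hr hs ht
    have hrs : 0 ≤ r * s := by positivity
    have hrt : 0 ≤ r * t := by positivity
    simp only [max_eq_left hs, max_eq_left ht, max_eq_left hrs, max_eq_left hrt]
    rw [h.integral_fracInt_mul hθ hrs (h.memLp_fracInt hθ hrt),
      h.integral_fracInt_mul hθ hs (h.memLp_fracInt hθ ht)]
    have key : ∀ u, 0 ≤ u → ∫ ω, X (r * u) ω * fracInt θ X (r * t) ω ∂P =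
        (r ^ θ * (r ^ (α - γ / 2 + 1 / 2)) ^ 2) * ∫ ω, X u ω * fracInt θ X t ω ∂P := by
      intro u hu
      have hru : 0 ≤ r * u := by positivity
      simp_rw [mul_comm (X _ _)]
      rw [h.integral_fracInt_mul hθ hrt (h.memLp _), h.integral_fracInt_mul hθ ht (h.memLp _),
        integral_sub_rpow_mul_scaling (A := (r ^ (α - γ / 2 + 1 / 2)) ^ 2)
          (g := fun v => ∫ ω, X v ω * X u ω ∂P) hr ht]
      · ring
      · intro v hv
        rw [h.cov _ _ (by positivity) hru, h.cov _ _ hv hu, GFBMParam.cov_scaling hr]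
    rw [integral_sub_rpow_mul_scaling hr hs key, rpow_add hr (α - γ / 2 + 1 / 2) θ]
    ring

end IsRegularGFBM

namespace GFBMParam

variable {α γ : ℝ}

lemma integral_kernel_mul_indicator (h : GFBMParam α γ) {u t v : ℝ} (hu : 0 ≤ u) (hv : v ≤ t) :
    ∫ w, gfbmKernel α γ v w * (Ioo u t).indicator (fun w => w ^ (γ / 2)) w =
      max (v - u) 0 ^ (α + 1) / (α + 1) := by
  have hα := h.gt_neg_half
  have h1 : ∀ w, gfbmKernel α γ v w * (Ioo u t).indicator (fun w => w ^ (γ / 2)) w =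
      (Ioo u v).indicator (fun w => (v - w) ^ α) w +
        ({v} ∩ Ioo u t : Set ℝ).indicator (fun w => gfbmKernel α γ v w * w ^ (γ / 2)) w := by
    intro w
    by_cases hw : w ∈ Ioo u t
    · have hw0 : 0 < w := hu.trans_lt hw.1
      rw [indicator_of_mem hw]
      rcases lt_trichotomy w v with hwv | rfl | hwv
      · rw [indicator_of_mem (show w ∈ Ioo u v from ⟨hw.1, hwv⟩), indicator_of_notMem
          (fun hh => hwv.ne hh.1), h.kernel_of_mem hw0 hwv.le, mul_assoc, ← rpow_add hw0]
        have e : -γ / 2 + γ / 2 = 0 := by ring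
        simp [e]
      · rw [indicator_of_notMem (fun hh => lt_irrefl _ hh.2), indicator_of_mem (show w ∈ ({w} ∩ Ioo u t : Set ℝ) from ⟨rfl, hw⟩), zero_add]
      · rw [indicator_of_notMem (fun hh => hwv.not_gt hh.2), indicator_of_notMem
          (fun hh => hwv.ne' hh.1), kernel_of_le hw0.le hwv.le]
        simp
    · rw [indicator_of_notMem hw, indicator_of_notMem (fun hh => hw ⟨hh.1, hh.2.trans_le hv⟩),
        indicator_of_notMem (fun hh => hw hh.2)]
      simp
  have h2 : (fun w => gfbmKernel α γ v w * (Ioo u t).indicator (fun w => w ^ (γ / 2)) w) =ᵐ[volume]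
      (Ioo u v).indicator (fun w => (v - w) ^ α) := by
    filter_upwards [measure_eq_zero_iff_ae_notMem.1 (measure_singleton (μ := volume) v)] with w hw
    rw [h1, indicator_of_notMem (fun hh => hw hh.1) (fun w => gfbmKernel α γ v w * w ^ (γ / 2)), add_zero]
  rw [integral_congr_ae h2, integral_indicator measurableSet_Ioo]
  rcases le_total v u with hvu | hvu
  · rw [Ioo_eq_empty hvu.not_gt, max_eq_right (by linarith), zero_rpow (by linarith)]
    simp
  · rw [← integral_Ioc_eq_integral_Ioo, ← intervalIntegral.integral_of_le hvu,
      intervalIntegral.integral_comp_sub_left (fun u => u ^ α), sub_self,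
      integral_rpow (Or.inl (by linarith)), max_eq_left (by linarith), zero_rpow (by linarith), sub_zero]

lemma integrable_indicator_sq (h : GFBMParam α γ) {u t : ℝ} (hu : 0 ≤ u) (ht : t ≤ 1) :
    Integrable fun w => ((Ioo u t).indicator (fun w => w ^ (γ / 2)) w) ^ 2 := by
  have : (fun w => ((Ioo u t).indicator (fun w : ℝ => w ^ (γ / 2)) w) ^ 2) =
      (Ioo u t).indicator fun w => (w ^ (γ / 2)) ^ 2 := by
    ext w
    by_cases hw : w ∈ Ioo u t <;> simp [hw]
  rw [this, integrable_indicator_iff measurableSet_Ioo]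
  refine Measure.integrableOn_of_bounded (M := 1) (by simp) (Measurable.aestronglyMeasurable (by fun_prop)) ?_
  refine (ae_restrict_iff' measurableSet_Ioo).2 (.of_forall fun w hw => ?_)
  have h0 : 0 ≤ w := hu.trans hw.1.le
  rw [norm_of_nonneg (by positivity)]
  exact pow_le_one₀ (by positivity) (rpow_le_one h0 (hw.2.le.trans ht) (by linarith [h.nonneg]))

lemma integral_indicator_sq_le (h : GFBMParam α γ) {u t : ℝ} (hu : 0 ≤ u) (hut : u ≤ t) (ht : t ≤ 1) :
    ∫ w, ((Ioo u t).indicator (fun w => w ^ (γ / 2)) w) ^ 2 ≤ t - u := by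
  have : ∫ w, (Ioo u t).indicator (fun _ => (1:ℝ)) w = t - u := by
    rw [integral_indicator measurableSet_Ioo]
    simp [hut]
  rw [← this]
  refine integral_mono (h.integrable_indicator_sq hu ht) ?_ fun w => ?_
  · rw [integrable_indicator_iff measurableSet_Ioo]
    exact integrableOn_const (by simp)
  · by_cases hw : w ∈ Ioo u t
    · have h0 : 0 ≤ w := hu.trans hw.1.le
      simp only [hw, indicator_of_mem]
      exact pow_le_one₀ (by positivity) (rpow_le_one h0 (hw.2.le.trans ht) (by linarith [h.nonneg]))
    · simp [hw]

lemma memLp_indicator (h : GFBMParam α γ) {u t : ℝ} (hu : 0 ≤ u) (ht : t ≤ 1) :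
    MemLp ((Ioo u t).indicator fun w : ℝ => w ^ (γ / 2)) 2 volume := by
  refine (memLp_two_iff_integrable_sq ?_).2 (h.integrable_indicator_sq hu ht)
  exact (Measurable.indicator (by fun_prop) measurableSet_Ioo).aestronglyMeasurable

end GFBMParam

namespace IsRegularGFBM

variable {Ω : Type*} [MeasurableSpace Ω] {P : Measure Ω} {S : Submodule ℝ (Ω → ℝ)} {α γ : ℝ}
  {X : ℝ → Ω → ℝ}

/-- The innovation of the process on `(u, t)`, as a random variable. -/
lemma exists_innovation (h : IsRegularGFBM P S α γ X) {u t : ℝ} (hu : 0 ≤ u) (hut : u ≤ t)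
    (ht : t ≤ 1) :
    ∃ N : Ω → ℝ, MemLp N 2 P ∧ √(∫ ω, N ω ^ 2 ∂P) ≤ √(t - u) ∧
      ∀ r ∈ Icc 0 t, ∫ ω, X r ω * N ω ∂P = max (r - u) 0 ^ (α + 1) / (α + 1) := by
  obtain ⟨N, h1, h2, h3⟩ := h.exists_dual (s := t) (sqrt_nonneg (t - u)) (h.param.memLp_indicator hu ht) (by
    intro f hf
    refine (abs_integral_mul_le_sqrt (h.param.memLp_of_mem_kernelSpan hf)
      (h.param.memLp_indicator hu ht)).trans ?_
    rw [mul_comm]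
    gcongr
    exact h.param.integral_indicator_sq_le hu hut ht)
  refine ⟨N, h1, h2, fun r hr => ?_⟩
  rw [h3 r hr, h.param.integral_kernel_mul_indicator hu hr.2]

lemma isNondeterministic (h : IsRegularGFBM P S α γ X) {θ : ℝ} (hθ : 0 < θ) :
    IsNondeterministic P (fun t => fracInt θ X (max t 0)) (α + θ + 1 / 2) := by
  have hP := h.gaussSpace.isProbabilityMeasure
  have hα := h.param.gt_neg_half
  have hα1 : 0 < α + 1 := by linarith
  have hΓ := Gamma_pos_of_pos hθ
  set c : ℝ := (Gamma θ)⁻¹ * ((1 / 2) ^ θ / θ * ((1 / 2) ^ (α + 1) / (α + 1))) with hc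
  have hc0 : 0 < c := by positivity
  refine ⟨c, hc0, fun ι _ t a u v hu huv hv ht => ?_⟩
  have hv0 : 0 < v := hu.trans_lt huv
  set δ := v - u with hδ
  have hδ0 : 0 < δ := sub_pos.2 huv
  obtain ⟨N, hN, hN2, hXN⟩ := h.exists_innovation hu huv.le hv
  set ρ : ℝ → ℝ := fun r => max (r - u) 0 ^ (α + 1) / (α + 1) with hρ
  have hρ0 : ∀ r, 0 ≤ ρ r := fun r => by simp only [hρ]; positivity
  have hρc : Continuous ρ := by
    have : Continuous fun r : ℝ => r ^ (α + 1) := continuous_rpow_const hα1.le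
    exact (this.comp (by fun_prop : Continuous fun r => max (r - u) 0)).div_const _
  have hY : ∀ r, 0 ≤ r → r ≤ v → ∫ ω, fracInt θ X r ω * N ω ∂P =
      (Gamma θ)⁻¹ * ∫ w in (0:ℝ)..r, (r - w) ^ (θ - 1) * ρ w := by
    intro r hr hrv
    rw [h.integral_fracInt_mul hθ hr hN]
    congr 1
    refine intervalIntegral.integral_congr fun w hw => ?_
    rw [uIcc_of_le hr] at hw
    simp only [hXN w ⟨hw.1, hw.2.trans hrv⟩, hρ]
  have hY0 : ∀ j, ∫ ω, fracInt θ X (t j) ω * N ω ∂P = 0 := by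
    intro j
    rw [hY _ (ht j).1 ((ht j).2.trans huv.le)]
    have : ∫ w in (0:ℝ)..t j, (t j - w) ^ (θ - 1) * ρ w = ∫ w in (0:ℝ)..t j, 0 := by
      refine intervalIntegral.integral_congr fun w hw => ?_
      rw [uIcc_of_le (ht j).1] at hw
      have : w - u ≤ 0 := by linarith [hw.2, (ht j).2]
      simp [hρ, max_eq_right this, zero_rpow hα1.ne']
    rw [this]
    simp
  have hlow : c * δ ^ (α + θ + 1 / 2) * √δ ≤ ∫ ω, fracInt θ X v ω * N ω ∂P := by
    rw [hY v hv0.le le_rfl]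
    have hfi : IntervalIntegrable (fun w => (v - w) ^ (θ - 1) * ρ w) volume 0 v :=
      (intervalIntegrable_sub_rpow hθ).mul_continuousOn hρc.continuousOn
    have h1 : ∫ w in (v - δ / 2)..v, (v - w) ^ (θ - 1) * ((δ / 2) ^ (α + 1) / (α + 1)) ≤
        ∫ w in (v - δ / 2)..v, (v - w) ^ (θ - 1) * ρ w := by
      have hsub : uIcc (v - δ / 2) v ⊆ uIcc 0 v := by
        rw [uIcc_of_le (by linarith), uIcc_of_le hv0.le]
        exact Icc_subset_Icc (by linarith) le_rfl
      refine intervalIntegral.integral_mono_on (by linarith)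
        (((intervalIntegrable_sub_rpow hθ).mono_set hsub).mul_const _) (hfi.mono_set hsub)
        fun w hw => ?_
      refine mul_le_mul_of_nonneg_left ?_ (rpow_nonneg (by linarith [hw.2]) _)
      simp only [hρ]
      gcongr
      exact le_max_of_le_left (by linarith [hw.1])
    have h2 : ∫ w in (v - δ / 2)..v, (v - w) ^ (θ - 1) * ρ w ≤
        ∫ w in (0:ℝ)..v, (v - w) ^ (θ - 1) * ρ w := by
      refine intervalIntegral.integral_mono_interval (by linarith) (by linarith) le_rfl ?_ hfi
      refine (ae_restrict_iff' measurableSet_Ioc).2 (.of_forall fun w hw => ?_)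
      exact mul_nonneg (rpow_nonneg (by linarith [hw.2]) _) (hρ0 w)
    have h3 : ∫ w in (v - δ / 2)..v, (v - w) ^ (θ - 1) * ((δ / 2) ^ (α + 1) / (α + 1)) =
        (δ / 2) ^ θ / θ * ((δ / 2) ^ (α + 1) / (α + 1)) := by
      rw [intervalIntegral.integral_mul_const,
        intervalIntegral.integral_comp_sub_left (fun w => w ^ (θ - 1)), sub_self, sub_sub_cancel,
        integral_rpow (Or.inl (by linarith)), sub_add_cancel, zero_rpow hθ.ne', sub_zero]
    have h4 : c * δ ^ (α + θ + 1 / 2) * √δ =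
        (Gamma θ)⁻¹ * ((δ / 2) ^ θ / θ * ((δ / 2) ^ (α + 1) / (α + 1))) := by
      have e1 : δ ^ (α + θ + 1 / 2) * √δ = δ ^ θ * δ ^ (α + 1) := by
        rw [sqrt_eq_rpow, ← rpow_add hδ0, ← rpow_add hδ0]
        ring_nf
      rw [mul_assoc, e1, hc, div_eq_mul_one_div δ 2, mul_rpow hδ0.le (by norm_num),
        mul_rpow hδ0.le (by norm_num)]
      ring
    rw [h4, ← h3]
    have := inv_pos.2 hΓ
    gcongr
    exact h1.trans h2
  have hmax : ∀ j, max (t j) 0 = t j := fun j => max_eq_left (ht j).1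
  simp only [max_eq_left hv0.le, hmax]
  have hmem : ∀ j, MemLp (fracInt θ X (t j)) 2 P := fun j => h.memLp_fracInt hθ (ht j).1
  have hmemv : MemLp (fracInt θ X v) 2 P := h.memLp_fracInt hθ hv0.le
  set Z : Ω → ℝ := fun ω => fracInt θ X v ω - ∑ j, a j * fracInt θ X (t j) ω with hZ
  have hZm : MemLp Z 2 P := hmemv.sub (memLp_finsetSum _ fun j _ => (hmem j).const_mul _)
  have hZN : ∫ ω, Z ω * N ω ∂P = ∫ ω, fracInt θ X v ω * N ω ∂P := by
    have i1 : Integrable (fun ω => fracInt θ X v ω * N ω) P := hmemv.integrable_mul hN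
    have i2 : ∀ j, Integrable (fun ω => a j * (fracInt θ X (t j) ω * N ω)) P := fun j => by
      have : Integrable (fun ω => fracInt θ X (t j) ω * N ω) P := (hmem j).integrable_mul hN
      exact this.const_mul _
    simp only [hZ, sub_mul, Finset.sum_mul, mul_assoc]
    rw [integral_sub i1 (integrable_finsetSum _ fun j _ => i2 j), integral_finsetSum _ fun j _ => i2 j]
    simp_rw [integral_const_mul, hY0]
    simp
  have hcs := (le_abs_self _).trans (abs_integral_mul_le_sqrt hZm hN)
  rw [hZN] at hcs
  have h5 : c * δ ^ (α + θ + 1 / 2) * √δ ≤ √(∫ ω, Z ω ^ 2 ∂P) * √δ :=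
    hlow.trans (hcs.trans (by gcongr))
  have h6 := le_of_mul_le_mul_right h5 (sqrt_pos.2 hδ0)
  have h7 : 0 ≤ ∫ ω, Z ω ^ 2 ∂P := integral_nonneg fun ω => sq_nonneg _
  calc (c * δ ^ (α + θ + 1 / 2)) ^ 2 ≤ √(∫ ω, Z ω ^ 2 ∂P) ^ 2 := by gcongr
    _ = _ := sq_sqrt h7

end IsRegularGFBM

lemma integrableOn_abs_rpow {q : ℝ} (hq : 0 ≤ q) {w : ℝ → ℝ} (hw : Measurable w)
    {B : ℝ} (hB : ∀ v ∈ Icc (0:ℝ) 1, |w v| ≤ B) :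
    IntegrableOn (fun v => |w v| ^ q) (Ioc 0 1) := by
  refine Measure.integrableOn_of_bounded (M := B ^ q) (by simp)
    (Measurable.aestronglyMeasurable (by fun_prop)) ?_
  refine (ae_restrict_iff' measurableSet_Ioc).2 (.of_forall fun v hv => ?_)
  rw [norm_of_nonneg (by positivity)]
  exact rpow_le_rpow (abs_nonneg _) (hB v ⟨hv.1.le, hv.2⟩) hq

lemma abs_integral_sub_rpow_mul_le {θ : ℝ} (hθ : 0 < θ) {w : ℝ → ℝ} (hw : Measurable w)
    {B : ℝ} (hB : ∀ v ∈ Icc (0:ℝ) 1, |w v| ≤ B) {u : ℝ} (hu : u ∈ Icc (0:ℝ) 1) :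
    |∫ v in (0:ℝ)..u, (u - v) ^ (θ - 1) * w v| ≤
      (θ / 2 + θ ^ 2 / 2)⁻¹ + ∫ v in Ioc (0:ℝ) 1, |w v| ^ (1 + 2 / θ) := by
  have hpq : (1 + θ / 2).HolderConjugate (1 + 2 / θ) := by
    refine (Real.holderConjugate_iff).2 ⟨by linarith [half_pos hθ], ?_⟩
    have : 2 + θ ≠ 0 := by positivity
    field_simp
    ring
  have ha : 0 < θ / 2 + θ ^ 2 / 2 := by positivity
  have hq0 : 0 ≤ 1 + 2 / θ := by positivity
  have hI := integrableOn_abs_rpow hq0 hw hB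
  have hI' : IntervalIntegrable (fun v => |w v| ^ (1 + 2 / θ)) volume 0 u := by
    rw [intervalIntegrable_iff_integrableOn_Ioc_of_le hu.1]
    exact hI.mono_set (Ioc_subset_Ioc_right hu.2)
  have h1 : ∀ v ∈ Ioc 0 u, ‖(u - v) ^ (θ - 1) * w v‖ ≤
      (u - v) ^ ((θ / 2 + θ ^ 2 / 2) - 1) + |w v| ^ (1 + 2 / θ) := by
    intro v hv
    have h0 : 0 ≤ u - v := by linarith [hv.2]
    have h2 : 0 ≤ (u - v) ^ (θ - 1) := rpow_nonneg h0 _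
    rw [norm_mul, norm_of_nonneg h2, norm_eq_abs]
    refine (Real.young_inequality_of_nonneg h2 (abs_nonneg _) hpq).trans (add_le_add ?_ ?_)
    · rw [← rpow_mul h0, show (θ - 1) * (1 + θ / 2) = θ / 2 + θ ^ 2 / 2 - 1 by ring]
      exact div_le_self (rpow_nonneg h0 _) (by linarith)
    · exact div_le_self (by positivity) (by have : 0 < 2 / θ := by positivity
                                            linarith)
  have h2 := intervalIntegral.norm_integral_le_of_norm_le hu.1
    (.of_forall h1) ((intervalIntegrable_sub_rpow ha).add hI')
  rw [norm_eq_abs, intervalIntegral.integral_add (intervalIntegrable_sub_rpow ha) hI',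
    integral_sub_rpow ha] at h2
  refine h2.trans (add_le_add ?_ ?_)
  · rw [inv_eq_one_div]
    gcongr
    exact rpow_le_one hu.1 hu.2 ha.le
  · rw [intervalIntegral.integral_of_le hu.1]
    exact setIntegral_mono_set hI (.of_forall fun v => by positivity)
      (LE.le.eventuallyLE (Ioc_subset_Ioc_right hu.2))

lemma exists_lintegral_abs_rpow_le {q : ℝ} (hq : 0 < q) : ∃ C : ℝ, 0 < C ∧
    ∀ {Ω : Type*} [MeasurableSpace Ω] {P : Measure Ω} {S : Submodule ℝ (Ω → ℝ)},
      IsGaussSpace P S → ∀ f ∈ S, ∀ σ : ℝ, 0 < σ → √(∫ ω, f ω ^ 2 ∂P) ≤ σ →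
      ∫⁻ ω, ENNReal.ofReal (|σ⁻¹ * f ω| ^ q) ∂P ≤ ENNReal.ofReal C := by
  have hi : Integrable (fun x : ℝ => |x| ^ q) (gaussianReal 0 1) := by
    lift q to ℝ≥0 using hq.le
    have hq' : q ≠ 0 := by simpa using hq.ne'
    simpa using (memLp_id_gaussianReal (μ := 0) (v := 1) q).integrable_norm_rpow (by simpa) (by simp)
  refine ⟨(∫ x : ℝ, |x| ^ q ∂(gaussianReal 0 1)) + 1,
    add_pos_of_nonneg_of_pos (integral_nonneg fun x => by positivity) one_pos, ?_⟩
  intro Ω _ P S hS f hf σ hσ hfσ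
  set τ := √(∫ ω, f ω ^ 2 ∂P) with hτ
  have h0 : 0 ≤ ∫ ω, f ω ^ 2 ∂P := integral_nonneg fun ω => sq_nonneg _
  have hτ0 : 0 ≤ τ := sqrt_nonneg _
  have hmap : P.map f = (gaussianReal 0 1).map fun x => τ * x := by
    rw [hS.map_eq hf, gaussianReal_map_const_mul, mul_zero]
    congr 1
    ext
    simp [hτ, sq_sqrt h0, Real.coe_toNNReal _ h0]
  have hm : Measurable fun x : ℝ => ENNReal.ofReal (|σ⁻¹ * x| ^ q) := by fun_prop
  rw [← lintegral_map hm (hS.measurable f hf), hmap, lintegral_map hm (by fun_prop)]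
  calc ∫⁻ x, ENNReal.ofReal (|σ⁻¹ * (τ * x)| ^ q) ∂gaussianReal 0 1
      ≤ ∫⁻ x, ENNReal.ofReal (|x| ^ q) ∂gaussianReal 0 1 := by
        refine lintegral_mono fun x => ENNReal.ofReal_le_ofReal
          (rpow_le_rpow (abs_nonneg _) ?_ hq.le)
        rw [← mul_assoc, abs_mul, abs_of_nonneg (by positivity)]
        refine mul_le_of_le_one_left (abs_nonneg _) ?_
        rw [inv_mul_le_iff₀ hσ]
        linarith
    _ = ENNReal.ofReal (∫ x : ℝ, |x| ^ q ∂gaussianReal 0 1) :=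
        (ofReal_integral_eq_lintegral_ofReal hi (.of_forall fun x => by positivity)).symm
    _ ≤ _ := ENNReal.ofReal_le_ofReal (by linarith)

/-- The orthogonal projection on a finite family depends linearly on the inner products. -/
lemma IsGaussSpace.exists_linear_projection {Ω : Type*} [MeasurableSpace Ω] {P : Measure Ω}
    {S : Submodule ℝ (Ω → ℝ)} (hS : IsGaussSpace P S) {n : ℕ} {g : Fin n → Ω → ℝ}
    (hg : ∀ i, g i ∈ S) :
    ∃ A : Fin n → Fin n → ℝ, ∀ f ∈ S, ∀ j,
      ∫ ω, (f ω - ∑ k, (∑ i, A k i * ∫ ω, f ω * g i ω ∂P) * g k ω) * g j ω ∂P = 0 := by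
  let G : (Fin n → ℝ) →ₗ[ℝ] (Fin n → ℝ) :=
    Matrix.mulVecLin (Matrix.of fun j k => ∫ ω, g k ω * g j ω ∂P)
  have hG : ∀ c j, G c j = ∑ k, c k * ∫ ω, g k ω * g j ω ∂P := fun c j => by
    simp [G, Matrix.mulVec, dotProduct, mul_comm]
  obtain ⟨R, hR⟩ := G.rangeRestrict.exists_rightInverse_of_surjective G.range_rangeRestrict
  obtain ⟨T, hT⟩ := LinearMap.exists_extend R
  have hT' : ∀ c, G (T (G c)) = G c := by
    intro c
    have h1 : T (G c) = R ⟨G c, LinearMap.mem_range_self _ _⟩ := by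
      rw [← hT]; rfl
    have h2 := LinearMap.congr_fun hR ⟨G c, LinearMap.mem_range_self _ _⟩
    rw [h1]
    exact congrArg Subtype.val h2
  have hfi : ∀ f ∈ S, ∀ (c : Fin n → ℝ) j, ∫ ω, (f ω - ∑ k, c k * g k ω) * g j ω ∂P =
      (∫ ω, f ω * g j ω ∂P) - G c j := by
    intro f hf c j
    have i1 := hS.integrable_mul hf (hg j)
    have i2 : ∀ k, Integrable (fun ω => c k * (g k ω * g j ω)) P := fun k =>
      (hS.integrable_mul (hg k) (hg j)).const_mul _
    simp only [sub_mul, Finset.sum_mul, mul_assoc]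
    rw [integral_sub i1 (integrable_finsetSum _ fun k _ => i2 k), integral_finsetSum _ fun k _ => i2 k, hG]
    simp_rw [integral_const_mul]
  refine ⟨fun k i => LinearMap.toMatrix' T k i, fun f hf j => ?_⟩
  obtain ⟨c, hc⟩ := hS.exists_projection hf hg
  set b : Fin n → ℝ := fun i => ∫ ω, f ω * g i ω ∂P with hb
  have hbc : b = G c := by
    ext i
    have := hc i
    rw [hfi f hf] at this
    simp only [hb]
    linarith
  have hTb : (fun k => ∑ i, LinearMap.toMatrix' T k i * b i) = T b := by
    rw [← LinearMap.toMatrix'_mulVec]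
    rfl
  have := hfi f hf (T b) j
  rw [← hTb] at this
  rw [this, hTb, hbc, hT', ← hbc]
  simp [hb]

namespace IsRegularGFBM

variable {Ω : Type*} [MeasurableSpace Ω] {P : Measure Ω} {S : Submodule ℝ (Ω → ℝ)} {α γ : ℝ}
  {X : ℝ → Ω → ℝ}

lemma measurable_integral_mul (h : IsRegularGFBM P S α γ X) {g : Ω → ℝ} (hg : Measurable g) :
    Measurable fun v => ∫ ω, X v ω * g ω ∂P := by
  have := h.gaussSpace.isProbabilityMeasure
  have hm : StronglyMeasurable (Function.uncurry fun (v : ℝ) ω => X v ω * g ω) :=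
    h.stronglyMeasurable_uncurry.mul (hg.comp measurable_snd).stronglyMeasurable
  exact hm.integral_prod_right.measurable

lemma abs_integral_mul_le (h : IsRegularGFBM P S α γ X) {g : Ω → ℝ} (hg : MemLp g 2 P) {v : ℝ}
    (hv : v ∈ Icc (0:ℝ) 1) :
    |∫ ω, X v ω * g ω ∂P| ≤ √(gfbmCov α γ 1 1) * √(∫ ω, g ω ^ 2 ∂P) := by
  refine (abs_integral_mul_le_sqrt (h.memLp v) hg).trans ?_
  gcongr
  simpa using h.integral_sq_le hv.1 hv.2

lemma sum_fracInt_mul (h : IsRegularGFBM P S α γ X) {θ u : ℝ} (hθ : 0 < θ) (hu : u ∈ Icc (0:ℝ) 1)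
    {n : ℕ} {g : Fin n → Ω → ℝ} (hgm : ∀ i, Measurable (g i)) (hg : ∀ i, MemLp (g i) 2 P)
    (x : Fin n → ℝ) :
    ∑ i, (∫ ω, fracInt θ X u ω * g i ω ∂P) * x i =
      (Gamma θ)⁻¹ * ∫ v in (0:ℝ)..u, (u - v) ^ (θ - 1) * ∑ i, (∫ ω, X v ω * g i ω ∂P) * x i := by
  have hfi : ∀ i, IntervalIntegrable
      (fun v => (u - v) ^ (θ - 1) * ((∫ ω, X v ω * g i ω ∂P) * x i)) volume 0 u := by
    intro i
    have h1 : IntegrableOn (fun v => (u - v) ^ (θ - 1)) (Ioc 0 u) :=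
      (intervalIntegrable_iff_integrableOn_Ioc_of_le hu.1).1 (intervalIntegrable_sub_rpow hθ)
    rw [intervalIntegrable_iff_integrableOn_Ioc_of_le hu.1]
    refine Integrable.mul_bdd (c := √(gfbmCov α γ 1 1) * √(∫ ω, g i ω ^ 2 ∂P) * |x i|) h1
      (Measurable.aestronglyMeasurable ((h.measurable_integral_mul (hgm i)).mul_const _)) ?_
    refine (ae_restrict_iff' measurableSet_Ioc).2 (.of_forall fun v hv => ?_)
    rw [norm_mul, norm_eq_abs, norm_eq_abs]
    gcongr
    exact h.abs_integral_mul_le (hg i) ⟨hv.1.le, hv.2.trans hu.2⟩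
  simp_rw [h.integral_fracInt_mul hθ hu.1 (hg _), Finset.mul_sum]
  rw [intervalIntegral.integral_finsetSum fun i _ => hfi i, Finset.mul_sum]
  refine Finset.sum_congr rfl fun i _ => ?_
  rw [mul_assoc, ← intervalIntegral.integral_mul_const]
  simp_rw [mul_assoc]

lemma isDecorrelated (h : IsRegularGFBM P S α γ X) {θ : ℝ} (hθ : 0 < θ) :
    IsDecorrelated P fun t => fracInt θ X (max t 0) := by
  obtain ⟨D, hD, ε, hε, hcov⟩ := h.param.exists_abs_integral_mul_kernel_le
  have hP := h.gaussSpace.isProbabilityMeasure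
  have hS := h.gaussSpace.limitSpace
  have hΓ := Gamma_pos_of_pos hθ
  set q := 1 + 2 / θ with hq
  have hq0 : 0 < q := by positivity
  obtain ⟨C, hC, hmom⟩ := exists_lintegral_abs_rpow_le hq0
  refine ⟨(Gamma θ)⁻¹ * (D * ((θ / 2 + θ ^ 2 / 2)⁻¹ + 2 * C)), by positivity, ε, hε,
    fun s hs hs1 n m t u ht hu => ?_⟩
  set σ := D * s ^ ε with hσ
  have hσ0 : 0 < σ := by positivity
  set g : Fin n → Ω → ℝ := fun k => fracInt θ X (max (t k) 0) with hgdef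
  have hg : ∀ k, g k ∈ limitSpace S := fun k => h.fracInt_mem hθ _
  have hgm : ∀ k, Measurable (g k) := fun k => hS.measurable _ (hg k)
  have hg2 : ∀ k, MemLp (g k) 2 P := fun k => hS.memLp (hg k) (by simp)
  obtain ⟨A, hA⟩ := hS.exists_linear_projection hg
  set V : Fin n → Ω → ℝ := fun i ω => ∑ k, A k i * g k ω with hV
  have hswap : ∀ (b : Fin n → ℝ) ω, ∑ k, (∑ i, A k i * b i) * g k ω = ∑ i, b i * V i ω := by
    intro b ω
    simp only [hV, Finset.sum_mul, Finset.mul_sum]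
    rw [Finset.sum_comm]
    refine Finset.sum_congr rfl fun i _ => Finset.sum_congr rfl fun k _ => by ring
  set W : ℝ → Ω → ℝ := fun v ω => ∑ i, (∫ ω, X v ω * g i ω ∂P) * V i ω with hW
  have hWsum : ∀ v, W v = ∑ k, (∑ i, A k i * ∫ ω, X v ω * g i ω ∂P) • g k := by
    intro v
    ext ω
    simp only [hW, Finset.sum_apply, Pi.smul_apply, smul_eq_mul]
    rw [hswap]
  have hWmem : ∀ v, W v ∈ limitSpace S := fun v => by
    rw [hWsum]
    exact Submodule.sum_mem _ fun k _ => Submodule.smul_mem _ _ (hg k)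
  have hXmem : ∀ v, X v ∈ limitSpace S := fun v => le_limitSpace S (h.mem v)
  have hdual : ∀ v ∈ Icc (0:ℝ) 1, ∀ a : Fin n → ℝ,
      |∫ ω, (∑ k, a k * g k ω) * X v ω ∂P| ≤ √(∫ ω, (∑ k, a k * g k ω) ^ 2 ∂P) * σ := by
    intro v hv a
    obtain ⟨N, hN, hN2, hXN⟩ := h.exists_dual hσ0.le (h.param.memLp_kernel hv.1) (hcov s hs hs1 v hv)
    have hgN : ∀ k, ∫ ω, g k ω * X v ω ∂P = ∫ ω, g k ω * N ω ∂P := by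
      intro k
      have hmax : max (t k) 0 = t k := max_eq_left (ht k).1
      simp only [hgdef, hmax]
      rw [h.integral_fracInt_mul hθ (ht k).1 (h.memLp v), h.integral_fracInt_mul hθ (ht k).1 hN]
      congr 1
      refine intervalIntegral.integral_congr fun r hr => ?_
      rw [uIcc_of_le (ht k).1] at hr
      simp only [hXN r ⟨hr.1, hr.2.trans (ht k).2⟩, h.cov r v hr.1 hv.1, gfbmCov_eq]
    have hsum : ∀ Z : Ω → ℝ, MemLp Z 2 P →
        ∫ ω, (∑ k, a k * g k ω) * Z ω ∂P = ∑ k, a k * ∫ ω, g k ω * Z ω ∂P := by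
      intro Z hZ
      simp only [Finset.sum_mul, mul_assoc]
      rw [integral_finsetSum]
      · simp_rw [integral_const_mul]
      · intro k _
        have : Integrable (fun ω => g k ω * Z ω) P := (hg2 k).integrable_mul hZ
        exact this.const_mul _
    rw [hsum _ (h.memLp v)]
    simp_rw [hgN]
    rw [← hsum _ hN]
    have hm : MemLp (fun ω => ∑ k, a k * g k ω) 2 P :=
      memLp_finsetSum _ fun k _ => (hg2 k).const_mul _
    exact (abs_integral_mul_le_sqrt hm hN).trans (by gcongr)
  have hWσ : ∀ v ∈ Icc (0:ℝ) 1, √(∫ ω, W v ω ^ 2 ∂P) ≤ σ := by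
    intro v hv
    set a : Fin n → ℝ := fun k => ∑ i, A k i * ∫ ω, X v ω * g i ω ∂P with ha
    have hWa : ∀ ω, W v ω = ∑ k, a k * g k ω := fun ω => by
      simp [hWsum v, Finset.sum_apply, ha]
    have hort : ∀ j, ∫ ω, (X v ω - W v ω) * g j ω ∂P = 0 := fun j => by
      simp_rw [hWa]
      exact hA _ (hXmem v) j
    have hXW : X v - W v ∈ limitSpace S := Submodule.sub_mem _ (hXmem v) (hWmem v)
    have hXWg : ∀ k, Integrable (fun ω => (X v ω - W v ω) * g k ω) P := fun k =>
      hS.integrable_mul hXW (hg k)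
    have h0 : ∫ ω, (X v ω - W v ω) * W v ω ∂P = 0 := by
      have : ∀ ω, (X v ω - W v ω) * W v ω = ∑ k, a k * ((X v ω - W v ω) * g k ω) := by
        intro ω
        have : (X v ω - W v ω) * W v ω = (X v ω - W v ω) * ∑ k, a k * g k ω := by rw [← hWa]
        rw [this, Finset.mul_sum]
        exact Finset.sum_congr rfl fun k _ => by ring
      simp_rw [this]
      rw [integral_finsetSum _ fun k _ => (hXWg k).const_mul _]
      simp_rw [integral_const_mul, hort]
      simp
    have h1 : ∫ ω, W v ω ^ 2 ∂P = ∫ ω, W v ω * X v ω ∂P := by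
      have i1 := hS.integrable_mul (hXmem v) (hWmem v)
      have i2 := hS.integrable_mul (hWmem v) (hWmem v)
      simp only [sub_mul] at h0
      rw [integral_sub i1 i2] at h0
      simp_rw [sq, mul_comm (W v _) (X v _)]
      linarith
    have h2 := (le_abs_self _).trans (hdual v hv a)
    simp_rw [← hWa] at h2
    rw [← h1] at h2
    have h3 : 0 ≤ ∫ ω, W v ω ^ 2 ∂P := integral_nonneg fun ω => sq_nonneg _
    rcases (sqrt_nonneg (∫ ω, W v ω ^ 2 ∂P)).eq_or_lt with h4 | h4
    · rw [← h4]; exact hσ0.le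
    · refine le_of_mul_le_mul_left ?_ h4
      rwa [mul_self_sqrt h3]
  have hbm : ∀ i, Measurable fun v => ∫ ω, X v ω * g i ω ∂P := fun i =>
    h.measurable_integral_mul (hgm i)
  have hVm : ∀ i, Measurable (V i) := fun i =>
    Finset.measurable_sum _ fun k _ => (hgm k).const_mul _
  have hWm : Measurable (Function.uncurry W) := by
    refine Finset.measurable_sum _ fun i _ => ?_
    exact ((hbm i).comp measurable_fst).mul ((hVm i).comp measurable_snd)
  have hfm : Measurable (Function.uncurry fun v ω => ENNReal.ofReal (|σ⁻¹ * W v ω| ^ q)) := by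
    have : Measurable fun p : ℝ × Ω => ENNReal.ofReal (|σ⁻¹ * Function.uncurry W p| ^ q) := by fun_prop
    exact this
  set Q : Ω → ℝ≥0∞ := fun ω => ∫⁻ v in Ioc (0:ℝ) 1, ENNReal.ofReal (|σ⁻¹ * W v ω| ^ q) with hQ
  have hQm : Measurable Q := hfm.lintegral_prod_left
  have hQint : ∫⁻ ω, Q ω ∂P ≤ ENNReal.ofReal C := by
    rw [hQ, ← lintegral_lintegral_swap hfm.aemeasurable]
    calc ∫⁻ v in Ioc (0:ℝ) 1, ∫⁻ ω, ENNReal.ofReal (|σ⁻¹ * W v ω| ^ q) ∂P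
        ≤ ∫⁻ v in Ioc (0:ℝ) 1, ENNReal.ofReal C :=
          setLIntegral_mono measurable_const fun v hv =>
            hmom hS _ (hWmem v) σ hσ0 (hWσ v ⟨hv.1.le, hv.2⟩)
      _ = _ := by simp
  have hbad : P {ω | ENNReal.ofReal (2 * C) ≤ Q ω} ≤ 2⁻¹ := by
    refine (meas_ge_le_lintegral_div hQm.aemeasurable (ENNReal.ofReal_pos.2 (by positivity)).ne'
      ENNReal.ofReal_ne_top).trans ?_
    refine (ENNReal.div_le_div_right hQint _).trans (le_of_eq ?_)
    rw [← ENNReal.ofReal_div_of_pos (by positivity), show C / (2 * C) = 2⁻¹ by field_simp,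
      ENNReal.ofReal_inv_of_pos two_pos]
    simp
  refine ⟨fun i k => ∑ l, A k l * ∫ ω, fracInt θ X (max (u i) 0) ω * g l ω ∂P,
    fun i j => hA _ (h.fracInt_mem hθ _) j, ?_⟩
  have hgood : {ω | ENNReal.ofReal (2 * C) ≤ Q ω}ᶜ ⊆ {ω | ∀ i,
      |∑ k, (∑ l, A k l * ∫ ω, fracInt θ X (max (u i) 0) ω * g l ω ∂P) *
        fracInt θ X (max (t k) 0) ω| ≤
          (Gamma θ)⁻¹ * (D * ((θ / 2 + θ ^ 2 / 2)⁻¹ + 2 * C)) * s ^ ε} := by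
    intro ω hω i
    have hω' : Q ω < ENNReal.ofReal (2 * C) := not_le.1 hω
    change |∑ k, (∑ l, A k l * ∫ ω, fracInt θ X (max (u i) 0) ω * g l ω ∂P) * g k ω| ≤ _
    rw [hswap, max_eq_left (hu i).1, h.sum_fracInt_mul hθ (hu i) hgm hg2]
    have hwm : Measurable fun v => σ⁻¹ * W v ω := (hWm.comp measurable_prodMk_right).const_mul _
    have hwB : ∀ v ∈ Icc (0:ℝ) 1, |σ⁻¹ * W v ω| ≤ σ⁻¹ *
        ∑ i, √(gfbmCov α γ 1 1) * √(∫ ω, g i ω ^ 2 ∂P) * |V i ω| := by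
      intro v hv
      rw [abs_mul, abs_of_pos (inv_pos.2 hσ0)]
      gcongr
      refine (Finset.abs_sum_le_sum_abs _ _).trans (Finset.sum_le_sum fun i _ => ?_)
      rw [abs_mul]
      gcongr
      exact h.abs_integral_mul_le (hg2 i) hv
    have hmain := abs_integral_sub_rpow_mul_le hθ hwm hwB (hu i)
    have hI := integrableOn_abs_rpow hq0.le hwm hwB
    have h1 : ∫ v in Ioc (0:ℝ) 1, |σ⁻¹ * W v ω| ^ q ≤ 2 * C := by
      rw [hQ] at hω'
      simp only at hω'
      rw [← ofReal_integral_eq_lintegral_ofReal hI (.of_forall fun v => by positivity)] at hω'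
      exact ((ENNReal.ofReal_lt_ofReal_iff (by positivity)).1 hω').le
    have h2 : ∀ v, (u i - v) ^ (θ - 1) * W v ω = σ * ((u i - v) ^ (θ - 1) * (σ⁻¹ * W v ω)) := by
      intro v
      field_simp
    have h3 : ∫ v in (0:ℝ)..u i, (u i - v) ^ (θ - 1) * W v ω =
        σ * ∫ v in (0:ℝ)..u i, (u i - v) ^ (θ - 1) * (σ⁻¹ * W v ω) := by
      rw [← intervalIntegral.integral_const_mul]
      simp_rw [h2]
    change |(Gamma θ)⁻¹ * ∫ v in (0:ℝ)..u i, (u i - v) ^ (θ - 1) * W v ω| ≤ _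
    rw [h3, abs_mul, abs_mul, abs_of_pos hσ0, abs_of_pos (inv_pos.2 hΓ)]
    calc (Gamma θ)⁻¹ * (σ * |∫ v in (0:ℝ)..u i, (u i - v) ^ (θ - 1) * (σ⁻¹ * W v ω)|)
        ≤ (Gamma θ)⁻¹ * (σ * ((θ / 2 + θ ^ 2 / 2)⁻¹ + 2 * C)) := by
          have := inv_pos.2 hΓ
          gcongr
          linarith
      _ = _ := by rw [hσ]; ring
  refine le_trans ?_ (measure_mono hgood)
  rw [prob_compl_eq_one_sub (measurableSet_le measurable_const hQm)]
  rw [← ENNReal.one_sub_inv_two]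
  exact tsub_le_tsub_left hbad _

end IsRegularGFBM

lemma rpow_sub_rpow_le_mul {θ s t : ℝ} (hθ : 0 < θ) (hs : 0 ≤ s) (hst : s ≤ t) (ht : t ≤ 1) :
    t ^ θ - s ^ θ ≤ (1 + θ) * (t - s) ^ min θ 1 := by
  have hd : 0 ≤ t - s := sub_nonneg.2 hst
  rcases le_total θ 1 with h1 | h1
  · rw [min_eq_left h1]
    have := Real.rpow_add_le_add_rpow hs hd hθ.le h1
    rw [add_sub_cancel] at this
    have := rpow_nonneg hd θ
    nlinarith
  · rw [min_eq_right h1, rpow_one]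
    rcases (hs.trans hst).eq_or_lt with h0 | h0
    · obtain rfl : s = 0 := by linarith
      simp [← h0]
    have hb := one_add_mul_self_le_rpow_one_add (s := (s - t) / t)
      (by rw [le_div_iff₀ h0]; linarith) h1
    have e : 1 + (s - t) / t = s / t := by field_simp; ring
    rw [e, div_rpow hs h0.le, le_div_iff₀ (by positivity)] at hb
    have e2 : t ^ θ = t * t ^ (θ - 1) := by rw [rpow_sub_one h0.ne']; field_simp
    have h3 : t ^ (θ - 1) ≤ 1 := rpow_le_one h0.le ht (by linarith)
    have h4 : (1 + θ * ((s - t) / t)) * t ^ θ = t ^ θ - θ * (t - s) * t ^ (θ - 1) := by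
      rw [e2]; field_simp; ring
    rw [h4] at hb
    have h5 : θ * (t - s) * t ^ (θ - 1) ≤ θ * (t - s) * 1 := by gcongr
    linarith

lemma abs_integral_sub_rpow_sub_le {θ s t K : ℝ} (hθ : 0 < θ) (hs : 0 ≤ s) (hst : s ≤ t)
    (ht : t ≤ 1) {x : ℝ → ℝ} (hx : Continuous x) (hK : ∀ u ∈ Icc (0:ℝ) 1, |x u| ≤ K) :
    |(∫ u in (0:ℝ)..t, (t - u) ^ (θ - 1) * x u) - ∫ u in (0:ℝ)..s, (s - u) ^ (θ - 1) * x u| ≤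
      K * ((3 + θ) / θ) * (t - s) ^ min θ 1 := by
  have ht0 := hs.trans hst
  have hd : 0 ≤ t - s := sub_nonneg.2 hst
  have hK0 : 0 ≤ K := (abs_nonneg _).trans (hK 0 (by simp))
  have hsub1 : uIcc 0 s ⊆ uIcc 0 t := by
    rw [uIcc_of_le hs, uIcc_of_le ht0]; exact Icc_subset_Icc_right hst
  have hsub2 : uIcc s t ⊆ uIcc 0 t := by
    rw [uIcc_of_le hst, uIcc_of_le ht0]; exact Icc_subset_Icc_left hs
  have it := intervalIntegrable_sub_rpow (t := t) hθ
  have is := intervalIntegrable_sub_rpow (t := s) hθ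
  have it1 := it.mono_set hsub1
  have it2 := it.mono_set hsub2
  have e1 : (∫ u in (0:ℝ)..t, (t - u) ^ (θ - 1) * x u) - ∫ u in (0:ℝ)..s, (s - u) ^ (θ - 1) * x u =
      (∫ u in (0:ℝ)..s, ((t - u) ^ (θ - 1) - (s - u) ^ (θ - 1)) * x u) +
        ∫ u in s..t, (t - u) ^ (θ - 1) * x u := by
    simp_rw [sub_mul]
    rw [intervalIntegral.integral_sub (it1.mul_continuousOn hx.continuousOn)
      (is.mul_continuousOn hx.continuousOn), ← intervalIntegral.integral_add_adjacent_intervals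
      (it1.mul_continuousOn hx.continuousOn) (it2.mul_continuousOn hx.continuousOn)]
    ring
  have v1 : ∫ u in (0:ℝ)..s, (t - u) ^ (θ - 1) = (t ^ θ - (t - s) ^ θ) / θ := by
    rw [intervalIntegral.integral_comp_sub_left (fun u => u ^ (θ - 1)), sub_zero,
      integral_rpow (Or.inl (by linarith)), sub_add_cancel]
  have v2 : ∫ u in s..t, (t - u) ^ (θ - 1) = (t - s) ^ θ / θ := by
    rw [intervalIntegral.integral_comp_sub_left (fun u => u ^ (θ - 1)), sub_self,
      integral_rpow (Or.inl (by linarith)), sub_add_cancel, zero_rpow hθ.ne', sub_zero]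
  have hmono : s ^ θ ≤ t ^ θ := rpow_le_rpow hs hst hθ.le
  have hd0 : 0 ≤ (t - s) ^ θ := rpow_nonneg hd _
  have b1 : |∫ u in (0:ℝ)..s, ((t - u) ^ (θ - 1) - (s - u) ^ (θ - 1)) * x u| ≤
      (t ^ θ - s ^ θ + (t - s) ^ θ) / θ * K := by
    have aux : ∀ σ : ℝ, (∀ u, 0 < u → u < s →
        |(t - u) ^ (θ - 1) - (s - u) ^ (θ - 1)| ≤ σ * ((t - u) ^ (θ - 1) - (s - u) ^ (θ - 1))) →
        |∫ u in (0:ℝ)..s, ((t - u) ^ (θ - 1) - (s - u) ^ (θ - 1)) * x u| ≤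
          σ * ((t ^ θ - (t - s) ^ θ) / θ - s ^ θ / θ) * K := by
      intro σ hσ
      rw [← v1, ← integral_sub_rpow hθ, ← intervalIntegral.integral_sub it1 is,
        ← intervalIntegral.integral_const_mul, ← intervalIntegral.integral_mul_const,
        ← norm_eq_abs]
      refine intervalIntegral.norm_integral_le_of_norm_le hs ?_
        (((it1.sub is).const_mul _).mul_const _)
      filter_upwards [measure_eq_zero_iff_ae_notMem.1 (measure_singleton (μ := volume) s)] with u hus hu
      have hus' : u < s := lt_of_le_of_ne hu.2 hus
      rw [norm_mul, norm_eq_abs, norm_eq_abs]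
      have h1 := hσ u hu.1 hus'
      have h2 := (abs_nonneg _).trans h1
      exact mul_le_mul h1 (hK u ⟨hu.1.le, by linarith⟩) (abs_nonneg _) h2
    rcases le_total θ 1 with h1 | h1
    · refine (aux (-1) fun u hu hus => ?_).trans ?_
      · have := rpow_le_rpow_of_nonpos (z := θ - 1) (sub_pos.2 hus) (by linarith : s - u ≤ t - u)
          (by linarith)
        rw [abs_of_nonpos (by linarith)]
        linarith
      · rw [← sub_div, ← mul_div_assoc]
        gcongr
        linarith
    · refine (aux 1 fun u hu hus => ?_).trans ?_
      · have := rpow_le_rpow (z := θ - 1) (sub_pos.2 hus).le (by linarith : s - u ≤ t - u)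
          (by linarith)
        rw [abs_of_nonneg (by linarith)]
        linarith
      · rw [← sub_div, one_mul]
        gcongr
        linarith
  have b2 : |∫ u in s..t, (t - u) ^ (θ - 1) * x u| ≤ (t - s) ^ θ / θ * K := by
    rw [← v2, ← intervalIntegral.integral_mul_const, ← norm_eq_abs]
    refine intervalIntegral.norm_integral_le_of_norm_le hst (.of_forall fun u hu => ?_)
      (it2.mul_const _)
    have h0 : 0 ≤ (t - u) ^ (θ - 1) := rpow_nonneg (by linarith [hu.2]) _
    rw [norm_mul, norm_of_nonneg h0]
    exact mul_le_mul_of_nonneg_left (hK u ⟨hs.trans hu.1.le, hu.2.trans ht⟩) h0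
  have b3 := rpow_sub_rpow_le_mul hθ hs hst ht
  have b4 : (t - s) ^ θ ≤ (t - s) ^ min θ 1 :=
    rpow_le_rpow_of_exponent_ge' hd (by linarith) (by positivity) (min_le_left _ _)
  rw [e1]
  calc _ ≤ (t ^ θ - s ^ θ + (t - s) ^ θ) / θ * K + (t - s) ^ θ / θ * K :=
        (abs_add_le _ _).trans (add_le_add b1 b2)
    _ = (t ^ θ - s ^ θ + 2 * (t - s) ^ θ) * (K / θ) := by ring
    _ ≤ ((3 + θ) * (t - s) ^ min θ 1) * (K / θ) := by
        gcongr
        linarith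
    _ = _ := by ring

lemma exists_measure_le_card_mul {Ω κ : Type*} [MeasurableSpace Ω] {P : Measure Ω} {G : Set Ω}
    (hG : P G ≠ 0) {F : Finset κ} {f : Ω → κ} (hf : ∀ ω ∈ G, f ω ∈ F) :
    ∃ k ∈ F, P G ≤ F.card * P (G ∩ f ⁻¹' {k}) := by
  have hcov : G ⊆ ⋃ k ∈ F, G ∩ f ⁻¹' {k} := fun ω hω => by
    simp only [mem_iUnion]
    exact ⟨f ω, hf ω hω, hω, rfl⟩
  have hF : F.Nonempty := by
    obtain ⟨ω, hω⟩ := nonempty_of_measure_ne_zero hG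
    exact ⟨_, hf ω hω⟩
  obtain ⟨k, hk, hmax⟩ := F.exists_max_image (fun k => P (G ∩ f ⁻¹' {k})) hF
  refine ⟨k, hk, (measure_mono hcov).trans ((measure_biUnion_finset_le _ _).trans ?_)⟩
  rw [← nsmul_eq_mul]
  exact Finset.sum_le_card_nsmul _ _ _ hmax

/-- A crude lower bound on small ball probabilities from Hölder continuity and Anderson's
inequality. -/
lemma IsSelfSimilarGaussian.exp_le_smallBall {Ω : Type*} [MeasurableSpace Ω] {P : Measure Ω}
    {S : Submodule ℝ (Ω → ℝ)} {Y : ℝ → Ω → ℝ} {κ : ℝ} (h : IsSelfSimilarGaussian P S Y κ)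
    {A τ : ℝ} (hA : 1 ≤ A) (hτ : 0 < τ) {G : Set Ω} (hG : 1 / 2 ≤ P G)
    (hH : ∀ ω ∈ G, ∀ s t, 0 ≤ s → s ≤ t → t ≤ 1 → |Y t ω - Y s ω| ≤ A * (t - s) ^ τ)
    (hb : ∀ ω ∈ G, ∀ t ∈ Icc (0:ℝ) 1, |Y t ω| ≤ A) {x : ℝ} (hx0 : 0 < x) (hx1 : x ≤ 1) :
    exp (-((1 + 33 * A * (3 * A) ^ (1 / τ)) * x ^ (-(1 / τ + 1)))) ≤ smallBall P Y x := by
  have hP := h.gaussSpace.isProbabilityMeasure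
  have hA0 : 0 < A := by linarith
  set r := x / 3 with hr
  have hr0 : 0 < r := by positivity
  have hAr : 0 < A / r := by positivity
  set m := ⌈(A / r) ^ (1 / τ)⌉₊ with hm
  have hm0 : 0 < m := Nat.ceil_pos.2 (by positivity)
  have hm0' : (0:ℝ) < m := Nat.cast_pos.2 hm0
  have hmA : A * (1 / m) ^ τ ≤ r := by
    have h1 : (A / r) ^ (1 / τ) ≤ m := Nat.le_ceil _
    have h2 := rpow_le_rpow (by positivity) h1 hτ.le
    rw [← rpow_mul hAr.le, one_div_mul_cancel hτ.ne', rpow_one, div_le_iff₀ hr0] at h2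
    rw [div_rpow zero_le_one hm0'.le, one_rpow, mul_one_div, div_le_iff₀ (by positivity)]
    linarith
  set L : ℕ := ⌈A / r⌉₊ + 1 with hL
  have hLA : A / r + 1 ≤ L := by
    have := Nat.le_ceil (A / r)
    push_cast [hL]; linarith
  let f : Ω → Fin (m + 1) → ℤ := fun ω k => ⌊Y ((k : ℕ) / m) ω / r⌋
  let F : Finset (Fin (m + 1) → ℤ) := Fintype.piFinset fun _ => Finset.Icc (-(L:ℤ)) L
  have hFc : F.card = (2 * L + 1) ^ (m + 1) := by
    simp only [F, Fintype.card_piFinset_const, Int.card_Icc]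
    congr 1; omega
  have hfF : ∀ ω ∈ G, f ω ∈ F := by
    intro ω hω
    refine Fintype.mem_piFinset.2 fun k => Finset.mem_Icc.2 ?_
    have hk : ((k : ℕ) / m : ℝ) ∈ Icc (0:ℝ) 1 :=
      ⟨by positivity, (div_le_one hm0').2 (by exact_mod_cast Nat.lt_succ_iff.1 k.2)⟩
    have h1 := abs_le.1 (hb ω hω _ hk)
    constructor
    · refine Int.le_floor.2 ?_
      rw [le_div_iff₀ hr0]
      rw [← le_sub_iff_add_le, div_le_iff₀ hr0] at hLA
      push_cast
      nlinarith
    · have h2 : Y ((k : ℕ) / m) ω / r ≤ A / r := by gcongr; exact h1.2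
      have h3 : ((⌊Y ((k : ℕ) / m) ω / r⌋ : ℤ) : ℝ) ≤ L := (Int.floor_le _).trans (by linarith)
      exact_mod_cast h3
  have hG0 : P G ≠ 0 := fun h0 => by simp [h0] at hG
  obtain ⟨c, -, hc⟩ := exists_measure_le_card_mul hG0 hfF
  set B := G ∩ f ⁻¹' {c} with hB
  have hB0 : P B ≠ 0 := fun h0 => hG0 (by simpa [h0] using hc)
  obtain ⟨ω₀, hω₀⟩ := nonempty_of_measure_ne_zero hB0
  have hdist : ∀ ω ∈ B, ∀ t ∈ Icc (0:ℝ) 1, |Y t ω - Y t ω₀| ≤ x := by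
    intro ω hω t ht
    set k := ⌊t * m⌋₊ with hk
    have hk1 : (k:ℝ) ≤ t * m := Nat.floor_le (mul_nonneg ht.1 hm0'.le)
    have hk2 : t * m < k + 1 := Nat.lt_floor_add_one _
    have hkm : k < m + 1 := by
      have : (k:ℝ) ≤ m := hk1.trans (mul_le_of_le_one_left hm0'.le ht.2)
      exact Nat.lt_succ_of_le (by exact_mod_cast this)
    have hs0 : (0:ℝ) ≤ k / m := by positivity
    have hst : (k / m : ℝ) ≤ t := (div_le_iff₀ hm0').2 hk1
    have hts : t - k / m ≤ 1 / m := by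
      rw [sub_le_iff_le_add, ← add_div, le_div_iff₀ hm0']; linarith
    have hY : ∀ ω ∈ G, |Y t ω - Y (k / m) ω| ≤ r := fun ω hω =>
      (hH ω hω _ _ hs0 hst ht.2).trans <| le_trans
        (mul_le_mul_of_nonneg_left (rpow_le_rpow (sub_nonneg.2 hst) hts hτ.le) hA0.le) hmA
    have hfl : |Y (k / m) ω / r - Y (k / m) ω₀ / r| < 1 := by
      apply Int.abs_sub_lt_one_of_floor_eq_floor
      exact (congrFun (hω.2 : f ω = c) ⟨k, hkm⟩).trans (congrFun (hω₀.2 : f ω₀ = c) ⟨k, hkm⟩).symm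
    rw [← sub_div, abs_div, abs_of_pos hr0, div_lt_one hr0] at hfl
    have h1 := abs_le.1 (hY ω hω.1)
    have h2 := abs_le.1 (hY ω₀ hω₀.1)
    have h3 := abs_lt.1 hfl
    have : x = 3 * r := by rw [hr]; ring
    rw [abs_le]
    constructor <;> linarith
  have hBx : P B ≤ P {ω | runSup Y 1 ω ≤ x} := by
    refine ge_of_tendsto' (h.tendsto_grid_single zero_le_one x) fun n => ?_
    have hsub : B ⊆ {ω | ∀ i : Fin n, |Y (1 * unitSeq i) ω + -Y (1 * unitSeq i) ω₀| ≤ x} := by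
      intro ω hω i
      rw [← sub_eq_add_neg, one_mul]
      exact hdist ω hω _ (unitSeq_mem _)
    exact (measure_mono hsub).trans (h.gaussSpace.measure_box_add_le
      (f := fun i : Fin n => Y (1 * unitSeq i)) (fun i => h.mem _) _ x)
  have hmain : 1 / 2 ≤ (2 * L + 1 : ℝ) ^ (m + 1) * smallBall P Y x := by
    have h1 : 1 / 2 ≤ ((2 * L + 1) ^ (m + 1) : ℕ) * P {ω | runSup Y 1 ω ≤ x} := by
      refine hG.trans (hc.trans ?_)
      rw [hFc]
      gcongr
    have h2 := ENNReal.toReal_mono (ENNReal.mul_ne_top (ENNReal.natCast_ne_top _)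
      (measure_ne_top _ _)) h1
    rw [ENNReal.toReal_mul, ENNReal.toReal_natCast] at h2
    have e : (1 / 2 : ℝ≥0∞).toReal = 1 / 2 := by simp
    rw [e] at h2
    exact_mod_cast h2
  have hx1' : 1 ≤ x⁻¹ := (one_le_inv₀ hx0).2 hx1
  have hAx : 1 ≤ A * x⁻¹ := one_le_mul_of_one_le_of_one_le hA hx1'
  have hArx : A / r = 3 * A * x⁻¹ := by rw [hr]; field_simp
  have hLx : (2 * L + 1 : ℝ) ≤ 11 * (A * x⁻¹) := by
    have := Nat.ceil_lt_add_one hAr.le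
    rw [hArx] at this
    push_cast [hL]
    rw [hArx]
    linarith
  have hmx : (m + 1 : ℝ) ≤ 3 * ((3 * A) ^ (1 / τ) * x⁻¹ ^ (1 / τ)) := by
    have h1 := Nat.ceil_lt_add_one (a := (A / r) ^ (1 / τ)) (by positivity)
    rw [← mul_rpow (by positivity) (by positivity), ← hArx]
    have h2 : 1 ≤ (A / r) ^ (1 / τ) := one_le_rpow (by rw [hArx]; linarith) (by positivity)
    linarith
  have hprod : (m + 1 : ℝ) * (2 * L + 1) + 1 ≤
      (1 + 33 * A * (3 * A) ^ (1 / τ)) * x ^ (-(1 / τ + 1)) := by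
    have h1 : x ^ (-(1 / τ + 1)) = x⁻¹ ^ (1 / τ) * x⁻¹ := by
      rw [rpow_neg hx0.le, ← inv_rpow hx0.le, rpow_add_one (by positivity)]
    have h2 : 1 ≤ x ^ (-(1 / τ + 1)) := by
      rw [rpow_neg hx0.le, ← inv_rpow hx0.le]
      exact one_le_rpow hx1' (by positivity)
    have h3 := mul_le_mul hmx hLx (by positivity) (by positivity)
    rw [h1] at h2 ⊢
    nlinarith
  have hN : 2 * (2 * L + 1 : ℝ) ^ (m + 1) ≤ exp ((m + 1) * (2 * L + 1) + 1) := by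
    have h1 : (2 * L + 1 : ℝ) ≤ exp (2 * L + 1) := by
      linarith [add_one_le_exp (2 * L + 1 : ℝ)]
    have h2 : (2:ℝ) ≤ exp 1 := by linarith [add_one_le_exp (1:ℝ)]
    have h3 := pow_le_pow_left₀ (by positivity) h1 (m + 1)
    rw [← exp_nat_mul] at h3
    push_cast at h3
    rw [exp_add, mul_comm (exp _)]
    exact mul_le_mul h2 h3 (by positivity) (by positivity)
  have hN' := hN.trans (exp_le_exp.2 hprod)
  rw [exp_neg]
  have hsb : 0 ≤ smallBall P Y x := ENNReal.toReal_nonneg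
  rw [inv_le_iff_one_le_mul₀ (exp_pos _)]
  nlinarith

/-- Continuous paths are uniformly bounded on `[0, 1]` with probability at least `1 / 2`. -/
lemma exists_half_le_measure_bound {Ω : Type*} [MeasurableSpace Ω] {P : Measure Ω}
    [IsProbabilityMeasure P] {X : ℝ → Ω → ℝ} (hX : ∀ ω, Continuous fun t => X t ω) :
    ∃ n : ℕ, 1 / 2 ≤ P {ω | ∀ u ∈ Icc (0:ℝ) 1, |X u ω| ≤ n} := by
  have hmono : Monotone fun n : ℕ => {ω | ∀ u ∈ Icc (0:ℝ) 1, |X u ω| ≤ n} :=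
    fun m n hmn ω hω u hu => (hω u hu).trans (Nat.cast_le.2 hmn)
  have hU : ⋃ n : ℕ, {ω | ∀ u ∈ Icc (0:ℝ) 1, |X u ω| ≤ n} = univ := by
    refine eq_univ_of_forall fun ω => mem_iUnion.2 ?_
    obtain ⟨C, hC⟩ := isCompact_Icc.exists_bound_of_continuousOn (s := Icc (0:ℝ) 1)
      (hX ω).continuousOn
    obtain ⟨n, hn⟩ := exists_nat_ge C
    exact ⟨n, fun u hu => (hC u hu).trans hn⟩
  have ht := tendsto_measure_iUnion_atTop (μ := P) hmono
  rw [hU, measure_univ] at ht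
  obtain ⟨n, hn⟩ := (ht.eventually (lt_mem_nhds (b := 1) (a := 1 / 2) (by simp))).exists
  exact ⟨n, hn.le⟩

lemma IsRegularGFBM.exists_exp_le_smallBall {Ω : Type*} [MeasurableSpace Ω] {P : Measure Ω}
    {S : Submodule ℝ (Ω → ℝ)} {α γ : ℝ} {X : ℝ → Ω → ℝ} (h : IsRegularGFBM P S α γ X) {θ : ℝ}
    (hθ : 0 < θ) : ∃ K > (0:ℝ), ∃ p > (0:ℝ), ∀ x, 0 < x → x ≤ 1 →
      exp (-(K * x ^ (-p))) ≤ smallBall P (fun t => fracInt θ X (max t 0)) x := by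
  have hP := h.gaussSpace.isProbabilityMeasure
  obtain ⟨n, hn⟩ := exists_half_le_measure_bound (P := P) h.continuous
  set C := (Gamma θ)⁻¹ * (n * ((3 + θ) / θ)) with hC
  have hτ : 0 < min θ 1 := lt_min hθ one_pos
  have hΓ : 0 < (Gamma θ)⁻¹ := inv_pos.2 (Gamma_pos_of_pos hθ)
  have hH : ∀ ω ∈ {ω | ∀ u ∈ Icc (0:ℝ) 1, |X u ω| ≤ n}, ∀ s t : ℝ, 0 ≤ s → s ≤ t → t ≤ 1 →
      |fracInt θ X (max t 0) ω - fracInt θ X (max s 0) ω| ≤ max C 1 * (t - s) ^ min θ 1 := by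
    intro ω hω s t hs hst ht
    rw [max_eq_left hs, max_eq_left (hs.trans hst), fracInt, fracInt, ← mul_sub, abs_mul,
      abs_of_pos hΓ]
    have h1 := abs_integral_sub_rpow_sub_le hθ hs hst ht (h.continuous ω) hω
    have h2 := rpow_nonneg (sub_nonneg.2 hst) (min θ 1)
    calc _ ≤ (Gamma θ)⁻¹ * (n * ((3 + θ) / θ) * (t - s) ^ min θ 1) := by gcongr
      _ = C * (t - s) ^ min θ 1 := by rw [hC]; ring
      _ ≤ _ := by gcongr; exact le_max_left _ _
  have hA : 1 ≤ max C 1 := le_max_right _ _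
  refine ⟨1 + 33 * max C 1 * (3 * max C 1) ^ (1 / min θ 1), by positivity, 1 / min θ 1 + 1,
    by positivity, fun x hx0 hx1 => (h.isSelfSimilarGaussian hθ).exp_le_smallBall hA hτ hn hH
    (fun ω hω t ht => ?_) hx0 hx1⟩
  have h1 := hH ω hω 0 t le_rfl ht.1 ht.2
  have h0 : fracInt θ X (max 0 0) ω = 0 := by simp [fracInt]
  rw [h0, sub_zero, sub_zero] at h1
  exact h1.trans (mul_le_of_le_one_right (by linarith) (rpow_le_one ht.1 ht.2 hτ.le))

lemma IsCenteredGaussianProcess.aemeasurable {Ω : Type*} [MeasurableSpace Ω] {P : Measure Ω}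
    {X : ℝ → Ω → ℝ} (hX : IsCenteredGaussianProcess P X) (t : ℝ) : AEMeasurable (X t) P := by
  obtain ⟨v, hv⟩ := hX 1 (fun _ => t) fun _ => 1
  simp only [Finset.univ_unique, one_mul, Finset.sum_singleton] at hv
  by_contra hn
  rw [Measure.map_of_not_aemeasurable hn] at hv
  exact (IsProbabilityMeasure.ne_zero (gaussianReal 0 v)) hv.symm

/-- A centered Gaussian process with paths continuous on `[0, ∞)` has a measurable version with
everywhere continuous paths that lies in a Gaussian space. -/
lemma IsCenteredGaussianProcess.exists_continuous_version {Ω : Type*} [MeasurableSpace Ω]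
    {P : Measure Ω} {X : ℝ → Ω → ℝ} (hX : IsCenteredGaussianProcess P X)
    (hc : ∀ ω, ContinuousOn (fun t => X t ω) (Ici 0)) :
    ∃ (S : Submodule ℝ (Ω → ℝ)) (X' : ℝ → Ω → ℝ), IsGaussSpace P S ∧ (∀ t, X' t ∈ S) ∧
      (∀ ω, Continuous fun t => X' t ω) ∧ ∀ᵐ ω ∂P, ∀ t, 0 ≤ t → X' t ω = X t ω := by
  have hc' : ∀ ω, Continuous fun t => X (max t 0) ω := fun ω =>
    (hc ω).comp_continuous (f := fun t : ℝ => max t 0) (by fun_prop) fun t => le_max_right t 0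
  let g : ℚ → Ω → ℝ := fun q => (hX.aemeasurable (max (q:ℝ) 0)).mk
  have hg : ∀ᵐ ω ∂P, ∀ q : ℚ, X (max (q:ℝ) 0) ω = g q ω :=
    ae_all_iff.2 fun q => (hX.aemeasurable _).ae_eq_mk
  obtain ⟨N, hN, hNm, hNg⟩ := hg.exists_measurable_mem
  let X' : ℝ → Ω → ℝ := fun t => N.indicator (X (max t 0))
  have hX'c : ∀ ω, Continuous fun t => X' t ω := by
    intro ω
    by_cases hω : ω ∈ N
    · simpa [X', hω] using hc' ω
    · simpa [X', hω] using continuous_const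
  have hX'm : ∀ t, Measurable (X' t) := by
    intro t
    obtain ⟨q, hq, hqt⟩ := mem_closure_iff_seq_limit.1 (Rat.isDenseEmbedding_coe_real.dense t)
    choose p hp using hq
    refine measurable_of_tendsto_metrizable (f := fun n => N.indicator (g (p n)))
      (fun n => (hX.aemeasurable _).measurable_mk.indicator hNm) ?_
    refine tendsto_pi_nhds.2 fun ω => ?_
    refine (((hX'c ω).tendsto t).comp hqt).congr fun n => ?_
    by_cases hω : ω ∈ N
    · simp only [Function.comp, X', indicator_of_mem hω, ← hp]
      exact hNg ω hω (p n)
    · simp [X', hω]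
  have hae : ∀ᵐ ω ∂P, ∀ t, X' t ω = X (max t 0) ω := by
    filter_upwards [hN] with ω hω t
    simp [X', hω]
  refine ⟨Submodule.span ℝ (range X'), X', ⟨fun f hf => ?_, fun f hf => ?_⟩,
    fun t => Submodule.subset_span ⟨t, rfl⟩, hX'c, ?_⟩
  · induction hf using Submodule.span_induction with
    | mem f hf => obtain ⟨t, rfl⟩ := hf; exact hX'm t
    | zero => exact measurable_const
    | add f g _ _ hf hg => exact hf.add hg
    | smul a f _ hf => exact hf.const_smul a
  · obtain ⟨n, c, u, rfl⟩ := Submodule.mem_span_set'.1 hf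
    choose t ht using fun i => (u i).2
    obtain ⟨v, hv⟩ := hX n (fun i => max (t i) 0) c
    refine ⟨v, hv ▸ Measure.map_congr ?_⟩
    filter_upwards [hae] with ω hω
    rw [Finset.sum_apply]
    refine Finset.sum_congr rfl fun i _ => ?_
    rw [← ht i, ← hω, Pi.smul_apply, smul_eq_mul]
  · filter_upwards [hae] with ω hω t ht
    rw [hω, max_eq_left ht]

lemma fracInt_congr {Ω : Type*} {X X' : ℝ → Ω → ℝ} {ω : Ω} (h : ∀ t, 0 ≤ t → X' t ω = X t ω)
    (θ : ℝ) {t : ℝ} (ht : 0 ≤ t) : fracInt θ X' t ω = fracInt θ X t ω := by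
  unfold fracInt
  congr 1
  refine intervalIntegral.integral_congr fun u hu => ?_
  rw [uIcc_of_le ht] at hu
  simp only [h u hu.1]

lemma runSup_congr {Ω : Type*} {Y Y' : ℝ → Ω → ℝ} {ω : Ω} (h : ∀ t, 0 ≤ t → Y' t ω = Y t ω)
    (t : ℝ) : runSup Y' t ω = runSup Y t ω := by
  unfold runSup
  congr 1
  funext s
  rw [h _ s.2.1]

lemma gfbmCov_zero_left (γ s t : ℝ) : gfbmCov 0 γ s t = 0 := by
  simp [gfbmCov]

theorem lowerClassZero_necessity
    {Ω : Type*} [MeasurableSpace Ω] (P : Measure Ω) [IsProbabilityMeasure P]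
    (γ α θ H β : ℝ) (hγ : γ ∈ Set.Ico (0:ℝ) 1)
    (hα : α ∈ Set.Ioo (-1/2 + γ/2) (1/2)) (hθ : 0 < θ)
    (hH : H = α - γ/2 + 1/2) (hβ : β = α + θ + 1/2)
    (X : ℝ → Ω → ℝ) (hX : IsGFBM P α γ X)
    (Y : ℝ → Ω → ℝ) (hY : Y = fracInt θ X)
    (M : ℝ → Ω → ℝ) (hM : M = runSup Y)
    (φ : ℝ → ℝ) (hφ : φ = smallBall P Y)
    (ξ : ℝ → ℝ)
    (hξpos : ∀ t ∈ Set.Ioc (0:ℝ) (Real.exp (Real.exp 1)), 0 < ξ t)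
    (hξmono : MonotoneOn ξ (Set.Ioc (0:ℝ) (Real.exp (Real.exp 1))))
    (hξcont : ContinuousOn ξ (Set.Ioc (0:ℝ) (Real.exp (Real.exp 1))))
    (hLLC : ∀ᵐ ω ∂P, ∃ t₀ > (0:ℝ), ∀ t : ℝ, 0 < t → t < t₀ → ξ t ≤ M t ω)
    (c : ℝ) (hc : 1 ≤ c)
    (hdouble : ∀ t ∈ Set.Ioc (0:ℝ) (Real.exp (Real.exp 1) / 2), ξ (2 * t) ≤ c * ξ t) :
    (∃ C : ℝ, ∀ t ∈ Set.Ioc (0:ℝ) (Real.exp (Real.exp 1)), ξ t / t ^ (H + θ) ≤ C) ∧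
    ∫⁻ t in Set.Ioc (0:ℝ) (Real.exp (Real.exp 1)),
        ENNReal.ofReal ((ξ t / t ^ (H + θ)) ^ (-(1/β)) * φ (ξ t / t ^ (H + θ)) / t) < ⊤ := by
  subst hH hβ hM hφ hY
  obtain ⟨hgauss, hcont, -, hcov⟩ := hX
  obtain ⟨S, X', hS, hX'S, hX'c, hX'X⟩ := hgauss.exists_continuous_version hcont
  have hcov' : ∀ s t : ℝ, 0 ≤ s → 0 ≤ t → ∫ ω, X' s ω * X' t ω ∂P = gfbmCov α γ s t := by
    intro s t hs ht
    rw [← hcov s t hs ht]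
    refine integral_congr_ae ?_
    filter_upwards [hX'X] with ω hω
    rw [hω s hs, hω t ht]
  have hM : ∀ᵐ ω ∂P, ∀ t, runSup (fun t => fracInt θ X' (max t 0)) t ω =
      runSup (fracInt θ X) t ω := by
    filter_upwards [hX'X] with ω hω t
    refine runSup_congr (fun s hs => ?_) t
    rw [max_eq_left hs, fracInt_congr hω θ hs]
  rcases eq_or_ne α 0 with rfl | hα0
  · exfalso
    have hq : ∀ᵐ ω ∂P, ∀ q : ℚ, X' (max (q:ℝ) 0) ω = 0 := by
      refine ae_all_iff.2 fun q => ?_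
      have h0 := hcov' (max (q:ℝ) 0) (max (q:ℝ) 0) (le_max_right _ _) (le_max_right _ _)
      rw [gfbmCov_zero_left, integral_eq_zero_iff_of_nonneg (fun ω => mul_self_nonneg _)
        (hS.integrable_mul (hX'S _) (hX'S _))] at h0
      filter_upwards [h0] with ω hω
      exact mul_self_eq_zero.1 hω
    obtain ⟨ω, hqω, hMω, t₀, ht₀, hω⟩ := (hq.and (hM.and hLLC)).exists
    have hz : ∀ t, 0 ≤ t → X' t ω = (fun _ _ => 0 : ℝ → Ω → ℝ) t ω := by
      have : (fun t => X' (max t 0) ω) = fun _ => 0 :=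
        Rat.isDenseEmbedding_coe_real.dense.equalizer
          ((hX'c ω).comp (by fun_prop : Continuous fun t : ℝ => max t 0)) continuous_const
          (funext fun q => hqω q)
      intro t ht
      simpa [max_eq_left ht] using congrFun this t
    set t := min (t₀ / 2) 1 with ht
    have ht0 : 0 < t := lt_min (by linarith) one_pos
    have htt : t < t₀ := (min_le_left _ _).trans_lt (by linarith)
    have h1 : (1:ℝ) ≤ exp (exp 1) := one_le_exp (exp_pos 1).le
    have h2 := hω t ht0 htt
    rw [← hMω, runSup_congr (Y := fun _ _ => 0) (fun s hs => by
      rw [max_eq_left hs, fracInt_congr (X := fun _ _ => 0) hz θ hs]; simp [fracInt])] at h2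
    have h3 := hξpos t ⟨ht0, (min_le_right _ _).trans h1⟩
    simp [runSup] at h2
    linarith
  have h : IsRegularGFBM P S α γ X' :=
    ⟨⟨hα0, hγ.1, hγ.2, hα.1, hα.2⟩, hS, hX'S, hX'c, hcov'⟩
  obtain ⟨K, hK, p, hp, hsb⟩ := h.exists_exp_le_smallBall hθ
  have hφ : smallBall P (fracInt θ X) = smallBall P fun t => fracInt θ X' (max t 0) := by
    funext x
    unfold smallBall
    congr 1
    refine measure_congr ?_
    filter_upwards [hM] with ω hω
    exact propext (by
      change runSup (fracInt θ X) 1 ω ≤ x ↔ runSup (fun t => fracInt θ X' (max t 0)) 1 ω ≤ x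
      rw [hω])
  rw [hφ]
  refine (h.isSelfSimilarGaussian hθ).lowerClass_necessity (by linarith [hα.1, hγ.1])
    (by linarith [hα.1]) (h.isNondeterministic hθ) (h.isDecorrelated hθ) hK hp hsb (exp_pos _)
    hξpos hξmono hξcont ?_ (by linarith) hdouble
  filter_upwards [hLLC, hM] with ω hω hMω
  obtain ⟨t₀, ht₀, hω⟩ := hω
  exact ⟨t₀, ht₀, fun t h0 h1 => (hω t h0 h1).trans_eq (hMω t).symm⟩
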